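/- arXiv:1303.0895 — 7 statements merged into one kernel-verified Lean document; each statement's English description precedes it below -/
import Mathlib

section
/- Let n ≥ 1 and let f : ℝP^{n-1} → ℝ^n be a continuous map such that for every line L through the origin in ℝ^n, the vector f(L) lies in the orthogonal complement L^⊥ of L (with respect to the standard inner product). Then f has a zero, i.e., there exists L ∈ ℝP^{n-1} with f(L) = 0. -/
open LinearAlgebra.Projectivization

/-- The quotient topology on the projectivization of a topological vector space. -/
noncomputable instance Projectivization.instTopologicalSpace {K V : Type*} [DivisionRing K]
    [AddCommGroup V] [Module K V] [TopologicalSpace V] :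
    TopologicalSpace (Projectivization K V) :=
  instTopologicalSpaceQuotient

theorem Finset.even_card_of_involution {α : Type*} (s : Finset α) (g : ∀ a ∈ s, α)
    (hne : ∀ a ha, g a ha ≠ a) (hmem : ∀ a ha, g a ha ∈ s)
    (hinv : ∀ a ha, g (g a ha) (hmem a ha) = a) : Even s.card := by
  have h : ∑ _x ∈ s, (1 : ZMod 2) = 0 :=
    Finset.sum_involution g (fun _ _ => by decide) (fun a ha _ => hne a ha) hmem hinv
  rw [Finset.sum_const, nsmul_one] at h
  exact (ZMod.natCast_eq_zero_iff_even).1 h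

/-- A facet of Kuhn's triangulation of `ℝ^{d+1}`: the base point `x` and the permutation `π`
determine a simplex with vertices `x + ∑_{l < j} e_{π l}` for `j ≤ d + 1`, and the facet is the
face opposite to the vertex of index `k`. -/
abbrev KuhnFacet (d : ℕ) : Type := (Fin (d + 1) → ℤ) × Equiv.Perm (Fin (d + 1)) × ℕ

namespace KuhnFacet

variable {d : ℕ}

/-- The vertex of index `j` of the simplex containing a facet. -/
def vertex (t : KuhnFacet d) (j : ℕ) : Fin (d + 1) → ℤ :=
  fun i => t.1 i + if (t.2.1.symm i).val < j then 1 else 0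

/-- The other facet with the same vertices, on the other side. -/
def reflect (t : KuhnFacet d) : KuhnFacet d :=
  if t.2.2 = 0 then
    (t.1 + Pi.single (t.2.1 0) 1, (finRotate (d + 1)).trans t.2.1, d + 1)
  else if h : t.2.2 < d + 1 then
    (t.1, (Equiv.swap ⟨t.2.2 - 1, by lia⟩ ⟨t.2.2, h⟩).trans t.2.1, t.2.2)
  else
    (t.1 - Pi.single (t.2.1 (Fin.last d)) 1, (finRotate (d + 1)).symm.trans t.2.1, 0)

/-- The image of a facet under the antipodal map. -/
def antipode (t : KuhnFacet d) : KuhnFacet d :=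
  (fun i => -t.1 i - 1, Fin.revPerm.trans t.2.1, d + 1 - t.2.2)

theorem val_finRotate_symm (q : Fin (d + 1)) :
    ((finRotate (d + 1)).symm q).val = if q.val = 0 then d else q.val - 1 := by
  obtain ⟨p, rfl⟩ := (finRotate (d + 1)).surjective q
  rw [Equiv.symm_apply_apply, coe_finRotate]
  split_ifs with h1 h2 h2
  · simp [h1]
  · simp at h2
  · simp at h2
  · simp

theorem val_swap {n : ℕ} (a b q : Fin n) :
    (Equiv.swap a b q).val = if q.val = a.val then b.val else if q.val = b.val then a.val
      else q.val := by
  simp only [Equiv.swap_apply_def, Fin.ext_iff]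
  split_ifs <;> rfl

theorem reflect_reflect (t : KuhnFacet d) (ht : t.2.2 ≤ d + 1) : t.reflect.reflect = t := by
  obtain ⟨x, π, k⟩ := t
  simp only at ht
  have h0 : (finRotate (d + 1)).symm 0 = Fin.last d := by
    rw [Equiv.symm_apply_eq, finRotate_last]
  by_cases h : k = 0
  · subst h
    simp [reflect, ← Equiv.trans_assoc]
  · by_cases h' : k < d + 1
    · simp [reflect, h, h', ← Equiv.trans_assoc]
    · obtain rfl : k = d + 1 := by lia
      simp only [reflect]
      simp [← Equiv.trans_assoc, h0]

theorem reflect_ne (t : KuhnFacet d) : t.reflect ≠ t := by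
  obtain ⟨x, π, k⟩ := t
  intro h
  by_cases hk : k = 0
  · subst hk
    simpa [reflect] using congrArg (fun t => t.2.2) h
  · by_cases h' : k < d + 1
    · simp only [reflect, hk, h', if_false, dif_pos] at h
      have h2 := congrArg (fun t : KuhnFacet d => t.2.1 ⟨k, h'⟩) h
      simp [Fin.ext_iff] at h2
      lia
    · simp only [reflect, hk, h', if_false] at h
      have := congrArg (fun t : KuhnFacet d => t.2.2) h
      simp at this
      lia

theorem reflect_index_le (t : KuhnFacet d) (ht : t.2.2 ≤ d + 1) : t.reflect.2.2 ≤ d + 1 := by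
  unfold reflect
  split_ifs <;> simp [ht]

theorem exists_vertex_reflect_eq (t : KuhnFacet d) (ht : t.2.2 ≤ d + 1) {j : ℕ} (hj : j ≤ d + 1)
    (hjk : j ≠ t.2.2) :
    ∃ j' ≤ d + 1, j' ≠ t.reflect.2.2 ∧ t.reflect.vertex j' = t.vertex j := by
  obtain ⟨x, π, k⟩ := t
  simp only at ht hjk
  by_cases hk : k = 0
  · subst hk
    refine ⟨j - 1, by lia, by simp [reflect]; lia, funext fun i => ?_⟩
    obtain ⟨q, rfl⟩ := π.surjective i
    have := q.isLt
    simp only [vertex, reflect, if_true, Equiv.symm_trans_apply, Equiv.symm_apply_apply,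
      val_finRotate_symm, Pi.add_apply, Pi.single_apply, EmbeddingLike.apply_eq_iff_eq,
      Fin.ext_iff, Fin.val_zero]
    grind
  · by_cases h' : k < d + 1
    · refine ⟨j, hj, by simpa [reflect, hk, h'] using hjk, funext fun i => ?_⟩
      obtain ⟨q, rfl⟩ := π.surjective i
      simp only [vertex, reflect, hk, h', if_false, dif_pos, Equiv.symm_trans_apply,
        Equiv.symm_apply_apply, Equiv.symm_swap, val_swap]
      grind
    · obtain rfl : k = d + 1 := by lia
      refine ⟨j + 1, by lia, by simp [reflect], funext fun i => ?_⟩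
      obtain ⟨q, rfl⟩ := π.surjective i
      have := q.isLt
      simp only [vertex, reflect, hk, h', if_false, dif_neg, not_false_eq_true,
        Equiv.symm_trans_apply, Equiv.symm_symm,
        Equiv.symm_apply_apply, coe_finRotate, Pi.sub_apply, Pi.single_apply,
        EmbeddingLike.apply_eq_iff_eq, Fin.ext_iff, Fin.val_last]
      grind

theorem antipode_antipode (t : KuhnFacet d) (ht : t.2.2 ≤ d + 1) : t.antipode.antipode = t := by
  obtain ⟨x, π, k⟩ := t
  simp only at ht
  simp only [antipode, Prod.mk.injEq, ← Equiv.trans_assoc]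
  refine ⟨by simp, by ext; simp, by lia⟩

theorem vertex_antipode (t : KuhnFacet d) {j : ℕ} (hj : j ≤ d + 1) :
    t.antipode.vertex (d + 1 - j) = -t.vertex j := by
  obtain ⟨x, π, k⟩ := t
  funext i
  obtain ⟨q, rfl⟩ := π.surjective i
  have := q.isLt
  simp only [vertex, antipode, Equiv.symm_trans_apply, Equiv.symm_apply_apply, Pi.neg_apply,
    Fin.revPerm_symm, Fin.revPerm_apply, Fin.val_rev]
  grind

/-- The facets of the simplices contained in the cube `[-m, m]^{d+1}`. -/
noncomputable def inCube (d : ℕ) (m : ℤ) : Finset (KuhnFacet d) :=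
  Fintype.piFinset (fun _ => Finset.Ico (-m) m) ×ˢ Finset.univ ×ˢ Finset.range (d + 2)

theorem mem_inCube {m : ℤ} {t : KuhnFacet d} :
    t ∈ inCube d m ↔ (∀ i, -m ≤ t.1 i ∧ t.1 i < m) ∧ t.2.2 ≤ d + 1 := by
  simp [inCube, Nat.lt_succ_iff]

theorem abs_vertex_le {m : ℤ} {t : KuhnFacet d} (ht : t ∈ inCube d m) (j : ℕ) (i : Fin (d + 1)) :
    |t.vertex j i| ≤ m := by
  have := (mem_inCube.1 ht).1 i
  rw [abs_le, vertex]
  split_ifs <;> lia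

theorem reflect_mem_inCube_iff {m : ℤ} {t : KuhnFacet d} (ht : t ∈ inCube d m) :
    t.reflect ∈ inCube d m ↔ (t.2.2 = 0 → t.1 (t.2.1 0) + 1 < m) ∧
      (t.2.2 = d + 1 → -m < t.1 (t.2.1 (Fin.last d))) := by
  have h := mem_inCube.1 ht
  rw [mem_inCube, and_iff_left (reflect_index_le t h.2)]
  obtain ⟨x, π, k⟩ := t
  simp only at h
  by_cases hk : k = 0
  · subst hk
    simp only [reflect, if_true, Pi.add_apply, Pi.single_apply, true_imp_iff]
    constructor
    · intro H
      have := H (π 0)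
      simp at this
      simp [this]
    · intro H i
      have := h.1 i
      split_ifs with hi
      · subst hi
        lia
      · lia
  · by_cases h' : k < d + 1
    · simp only [reflect, hk, h', if_false, dif_pos, false_imp_iff, true_and, h'.ne, iff_true]
      exact h.1
    · obtain rfl : k = d + 1 := by lia
      simp only [reflect, hk, h', if_false, dif_neg, not_false_eq_true, Pi.sub_apply,
        Pi.single_apply, false_imp_iff, true_imp_iff, true_and]
      constructor
      · intro H
        have := H (π (Fin.last d))
        simp at this
        lia
      · intro H i
        have := h.1 i
        split_ifs with hi
        · subst hi
          lia
        · lia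

theorem antipode_mem_inCube {m : ℤ} {t : KuhnFacet d} (ht : t ∈ inCube d m) :
    t.antipode ∈ inCube d m := by
  rw [mem_inCube] at ht ⊢
  refine ⟨fun i => ?_, by simp [antipode]⟩
  have := ht.1 i
  simp only [antipode]
  lia

theorem reflect_antipode_notMem_inCube {m : ℤ} {t : KuhnFacet d} (ht : t ∈ inCube d m)
    (h : t.reflect ∉ inCube d m) : t.antipode.reflect ∉ inCube d m := by
  rw [reflect_mem_inCube_iff (antipode_mem_inCube ht)]
  rw [reflect_mem_inCube_iff ht] at h
  have h2 := (mem_inCube.1 ht).2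
  contrapose! h
  simp only [antipode, Equiv.trans_apply, Fin.revPerm_apply, Fin.rev_zero, Fin.rev_last] at h
  constructor
  · intro h0
    have := h.2 (by lia)
    lia
  · intro h0
    have := h.1 (by lia)
    lia

theorem antipode_ne {m : ℤ} {t : KuhnFacet d} (ht : t ∈ inCube d m)
    (h : t.reflect ∉ inCube d m) : t.antipode ≠ t := by
  intro h1
  rw [reflect_mem_inCube_iff ht] at h
  apply h
  have := congrArg (fun t => t.2.2) h1
  simp only [antipode] at this
  constructor <;> intro <;> lia

theorem exists_abs_vertex_eq {m : ℤ} {t : KuhnFacet d} (ht : t ∈ inCube d m)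
    (h : t.reflect ∉ inCube d m) {j : ℕ} (hj : j ≤ d + 1) (hjk : j ≠ t.2.2) :
    ∃ i, |t.vertex j i| = m := by
  rw [reflect_mem_inCube_iff ht] at h
  obtain ⟨hx, hk⟩ := mem_inCube.1 ht
  rw [not_and_or] at h
  push Not at h
  rcases h with ⟨h0, h1⟩ | ⟨h0, h1⟩
  · refine ⟨t.2.1 0, ?_⟩
    have := hx (t.2.1 0)
    have hj0 : 0 < j := by lia
    simp only [vertex, Equiv.symm_apply_apply, Fin.val_zero, hj0, if_true]
    rw [abs_of_nonneg] <;> lia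
  · refine ⟨t.2.1 (Fin.last d), ?_⟩
    have := hx (t.2.1 (Fin.last d))
    have hj0 : ¬ d < j := by lia
    simp only [vertex, Equiv.symm_apply_apply, Fin.val_last, hj0, if_false]
    rw [abs_of_nonpos] <;> lia

/-- All proper labels occur at the vertices of a facet. -/
def IsDoor (L : (Fin (d + 1) → ℤ) → Option (Fin (d + 1))) (t : KuhnFacet d) : Prop :=
  ∀ c, ∃ j ≤ d + 1, j ≠ t.2.2 ∧ L (t.vertex j) = some c

variable {L : (Fin (d + 1) → ℤ) → Option (Fin (d + 1))}

theorem IsDoor.reflect {t : KuhnFacet d} (h : IsDoor L t) (ht : t.2.2 ≤ d + 1) :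
    IsDoor L t.reflect := by
  intro c
  obtain ⟨j, hj, hjk, hc⟩ := h c
  obtain ⟨j', hj', hjk', hv⟩ := exists_vertex_reflect_eq t ht hj hjk
  exact ⟨j', hj', hjk', hv ▸ hc⟩

theorem IsDoor.antipode {m : ℤ} {t : KuhnFacet d} (h : IsDoor L t)
    (hL : ∀ v : Fin (d + 1) → ℤ, (∀ i, |v i| ≤ m) → (∃ i, |v i| = m) → L (-v) = L v)
    (ht : t ∈ inCube d m) (htr : t.reflect ∉ inCube d m) : IsDoor L t.antipode := by
  intro c
  obtain ⟨j, hj, hjk, hc⟩ := h c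
  have := (mem_inCube.1 ht).2
  refine ⟨d + 1 - j, by lia, by simp only [KuhnFacet.antipode]; lia, ?_⟩
  rw [vertex_antipode t hj, hL _ (abs_vertex_le ht j) (exists_abs_vertex_eq ht htr hj hjk), hc]

open Classical in
theorem even_card_isDoor {m : ℤ}
    (hL : ∀ v : Fin (d + 1) → ℤ, (∀ i, |v i| ≤ m) → (∃ i, |v i| = m) → L (-v) = L v) :
    Even ((inCube d m).filter (IsDoor L)).card := by
  refine Finset.even_card_of_involution _
    (fun t _ => if t.reflect ∈ inCube d m then t.reflect else t.antipode) ?_ ?_ ?_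
  · intro t ht
    rw [Finset.mem_filter] at ht
    split_ifs with h
    · exact reflect_ne t
    · exact antipode_ne ht.1 h
  · intro t ht
    rw [Finset.mem_filter] at ht ⊢
    split_ifs with h
    · exact ⟨h, ht.2.reflect (mem_inCube.1 ht.1).2⟩
    · exact ⟨antipode_mem_inCube ht.1, ht.2.antipode hL ht.1 h⟩
  · intro t ht
    have ht' := (Finset.mem_filter.1 ht).1
    have hk := (mem_inCube.1 ht').2
    by_cases h : t.reflect ∈ inCube d m
    · simp [h, reflect_reflect t hk, ht']
    · simp [h, reflect_antipode_notMem_inCube ht' h, antipode_antipode t hk]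

theorem IsDoor.label_injOn {t : KuhnFacet d} (h : IsDoor L t) (ht : t.2.2 ≤ d + 1) :
    Set.InjOn (fun j => L (t.vertex j)) ((Finset.range (d + 2)).erase t.2.2 : Finset ℕ) := by
  classical
  apply Finset.injOn_of_card_image_eq
  refine le_antisymm Finset.card_image_le ?_
  have hsub : Finset.univ.image (some : Fin (d + 1) → _) ⊆
      ((Finset.range (d + 2)).erase t.2.2).image fun j => L (t.vertex j) := by
    intro o ho
    obtain ⟨c, -, rfl⟩ := Finset.mem_image.1 ho
    obtain ⟨j, hj, hjk, hc⟩ := h c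
    exact Finset.mem_image.2 ⟨j, by simp [hjk]; lia, hc⟩
  refine le_trans (le_of_eq ?_) (Finset.card_le_card hsub)
  rw [Finset.card_erase_of_mem (by simp; lia),
    Finset.card_image_of_injective _ (Option.some_injective _)]
  simp

theorem IsDoor.exists_label_eq {t : KuhnFacet d} (h : IsDoor L t)
    (hn : L (t.vertex t.2.2) ≠ none) :
    ∃ j ≤ d + 1, j ≠ t.2.2 ∧ L (t.vertex j) = L (t.vertex t.2.2) := by
  obtain ⟨c, hc⟩ := Option.ne_none_iff_exists'.1 hn
  rw [hc]
  exact h c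

open Classical in
theorem even_card_isDoor_label_ne_none (m : ℤ) :
    Even ((inCube d m).filter fun t => IsDoor L t ∧ L (t.vertex t.2.2) ≠ none).card := by
  have key : ∀ t ∈ (inCube d m).filter fun t => IsDoor L t ∧ L (t.vertex t.2.2) ≠ none,
      ∃ j ≤ d + 1, j ≠ t.2.2 ∧ L (t.vertex j) = L (t.vertex t.2.2) := fun t ht =>
    (Finset.mem_filter.1 ht).2.1.exists_label_eq (Finset.mem_filter.1 ht).2.2
  choose! g hg hgne hgL using key
  have hmem : ∀ t ∈ (inCube d m).filter fun t => IsDoor L t ∧ L (t.vertex t.2.2) ≠ none,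
      (t.1, t.2.1, g t) ∈
        (inCube d m).filter fun t => IsDoor L t ∧ L (t.vertex t.2.2) ≠ none := by
    intro t ht
    have ht' := ht
    rw [Finset.mem_filter, mem_inCube] at ht ⊢
    refine ⟨⟨ht.1.1, hg t ht'⟩, fun c => ?_, ?_⟩
    · obtain ⟨j, hj, hjk, hc⟩ := ht.2.1 c
      by_cases hjg : j = g t
      · exact ⟨t.2.2, ht.1.2, (hgne t ht').symm, by
          rw [← hc, hjg, hgL t ht']; rfl⟩
      · exact ⟨j, hj, hjg, hc⟩
    · have := hgL t ht'
      change L (t.vertex (g t)) ≠ none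
      rw [this]
      exact ht.2.2
  refine Finset.even_card_of_involution _ (fun t _ => (t.1, t.2.1, g t)) ?_ hmem ?_
  · intro t ht h
    exact hgne t ht (congrArg (fun t => t.2.2) h)
  · intro t ht
    have hs := hmem t ht
    have hs' := Finset.mem_filter.1 hs
    have hk := (mem_inCube.1 (Finset.mem_filter.1 ht).1).2
    have : g (t.1, t.2.1, g t) = t.2.2 := by
      refine hs'.2.1.label_injOn (hg t ht) ?_ ?_ ?_
      · have h1 := hg _ hs
        have h2 := hgne _ hs
        simp only [Finset.coe_erase, Set.mem_sdiff, Finset.mem_coe, Finset.mem_range,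
          Set.mem_singleton_iff]
        exact ⟨by lia, h2⟩
      · simp only [Finset.coe_erase, Set.mem_sdiff, Finset.mem_coe, Finset.mem_range,
          Set.mem_singleton_iff]
        exact ⟨by lia, (hgne t ht).symm⟩
      · exact (hgL _ hs).trans (hgL t ht)
    simp [this]

open Classical in
theorem even_card_isDoor_label_eq_none {m : ℤ}
    (hL : ∀ v : Fin (d + 1) → ℤ, (∀ i, |v i| ≤ m) → (∃ i, |v i| = m) → L (-v) = L v) :
    Even ((inCube d m).filter fun t => IsDoor L t ∧ L (t.vertex t.2.2) = none).card := by
  have h := even_card_isDoor hL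
  rw [← Finset.card_filter_add_card_filter_not (fun t => L (t.vertex t.2.2) = none),
    Finset.filter_filter, Finset.filter_filter, Nat.even_add] at h
  exact h.2 (even_card_isDoor_label_ne_none m)

end KuhnFacet

/-- The smallest index satisfying a predicate, if there is one. -/
noncomputable def firstIndex {n : ℕ} (p : Fin n → Prop) : Option (Fin n) :=
  open Classical in if h : ∃ i, p i then some (Fin.find p h) else none

theorem firstIndex_eq_none {n : ℕ} {p : Fin n → Prop} : firstIndex p = none ↔ ∀ i, ¬ p i := by
  simp [firstIndex]

theorem firstIndex_eq_some {n : ℕ} {p : Fin n → Prop} {c : Fin n} :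
    firstIndex p = some c ↔ p c ∧ ∀ i < c, ¬ p i := by
  classical
  unfold firstIndex
  split_ifs with h
  · rw [Option.some_inj]
    constructor
    · rintro rfl
      exact ⟨Fin.find_spec h, fun i hi => Fin.find_min h hi⟩
    · rintro ⟨h1, h2⟩
      refine le_antisymm (Fin.find_le_of_pos h h1) (not_lt.1 fun h3 => h2 _ h3 (Fin.find_spec h))
  · push Not at h
    simp [h c]

namespace KuhnFacet

variable {d : ℕ} {L : (Fin (d + 1) → ℤ) → Option (Fin (d + 1))}

/-- For the labelling of integer points by their first positive coordinate, there is exactly one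
fully labelled simplex. -/
theorem isDoor_firstIndex_iff {t : KuhnFacet d} :
    (IsDoor (fun v => firstIndex fun i => 0 < v i) t ∧
      (firstIndex fun i => 0 < t.vertex t.2.2 i) = none) ↔ t = (0, Fin.revPerm, 0) := by
  constructor
  · rintro ⟨h, hn⟩
    obtain ⟨x, π, k⟩ := t
    rw [firstIndex_eq_none] at hn
    obtain rfl : x = 0 := by
      funext i
      obtain ⟨j, -, -, hc⟩ := h i
      have h1 := (firstIndex_eq_some.1 hc).1
      have h2 := hn i
      simp only [vertex] at h1 h2
      simp only [Pi.zero_apply]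
      split_ifs at h1 h2 <;> lia
    obtain rfl : k = 0 := by
      by_contra hk
      have hn0 := hn (π 0)
      simp [vertex, Nat.pos_of_ne_zero hk] at hn0
    have hanti : StrictMono fun i => Fin.rev (π.symm i) := by
      intro i' i hi
      obtain ⟨j, -, -, hc⟩ := h i
      obtain ⟨h1, h2⟩ := firstIndex_eq_some.1 hc
      have h3 := h2 i' hi
      simp only [vertex] at h1 h3
      rw [Fin.rev_lt_rev, Fin.lt_def]
      split_ifs at h1 h3
      all_goals
        simp at h1 h3
        try lia
    have hid : ∀ i, Fin.rev (π.symm i) = i := fun i =>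
      congrFun (hanti.range_inj strictMono_id |>.1 (by
        rw [Set.range_id, Set.range_eq_univ]
        exact Fin.rev_surjective.comp π.symm.surjective)) i
    have hπ : π = Fin.revPerm := by
      ext q
      have := hid (π q)
      rw [Equiv.symm_apply_apply] at this
      simp [← this]
    rw [hπ]
  · rintro rfl
    refine ⟨fun c => ⟨d + 1 - c, by lia, by simp; lia, firstIndex_eq_some.2 ⟨?_, ?_⟩⟩,
      firstIndex_eq_none.2 fun i => ?_⟩
    · simp [vertex]
      lia
    · intro i hi
      simp [vertex]
      lia
    · simp [vertex]

/-- If a labelling of the lattice points of a cube is antipodally symmetric on the boundary and is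
given near the origin by the first positive coordinate, then some fully labelled simplex has a
vertex whose label is not given by the first positive coordinate. -/
theorem exists_isDoor_label_ne_firstIndex {m : ℤ} (hm : 1 ≤ m)
    (hL : ∀ v : Fin (d + 1) → ℤ, (∀ i, |v i| ≤ m) → (∃ i, |v i| = m) → L (-v) = L v)
    (h0 : ∀ v : Fin (d + 1) → ℤ, (∀ i, |v i| ≤ 1) → L v = firstIndex fun i => 0 < v i) :
    ∃ t ∈ inCube d m, IsDoor L t ∧ L (t.vertex t.2.2) = none ∧
      ∃ j ≤ d + 1, L (t.vertex j) ≠ firstIndex fun i => 0 < t.vertex j i := by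
  classical
  by_contra! hcon
  have heven := even_card_isDoor_label_eq_none hL
  suffices h : ((inCube d m).filter fun t => IsDoor L t ∧ L (t.vertex t.2.2) = none) =
      {(0, Fin.revPerm, 0)} by
    rw [h, Finset.card_singleton] at heven
    exact absurd heven (by decide)
  have hcongr : ∀ t : KuhnFacet d, t.2.2 ≤ d + 1 →
      (∀ j ≤ d + 1, L (t.vertex j) = firstIndex fun i => 0 < t.vertex j i) →
      ((IsDoor L t ∧ L (t.vertex t.2.2) = none) ↔ t = (0, Fin.revPerm, 0)) := by
    intro t ht hj
    rw [← isDoor_firstIndex_iff, hj _ ht]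
    refine and_congr_left fun _ => forall_congr' fun c => exists_congr fun j =>
      and_congr_right fun hjd => ?_
    rw [hj j hjd]
  ext t
  rw [Finset.mem_filter, Finset.mem_singleton]
  constructor
  · rintro ⟨ht, hd, hn⟩
    exact (hcongr t (mem_inCube.1 ht).2 (hcon t ht hd hn)).1 ⟨hd, hn⟩
  · rintro rfl
    have hmem : ∀ m' : ℤ, 1 ≤ m' → ((0, Fin.revPerm, 0) : KuhnFacet d) ∈ inCube d m' := by
      intro m' hm'
      rw [mem_inCube]
      refine ⟨fun i => ?_, by simp⟩
      simp only [Pi.zero_apply]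
      lia
    exact ⟨hmem m hm, (hcongr _ (by simp) fun j _ =>
      h0 _ fun i => abs_vertex_le (hmem 1 le_rfl) j i).2 rfl⟩

end KuhnFacet

/-- A continuous map of the cube into the ambient space which is the identity near the origin and
even on the boundary has a zero away from the origin. -/
theorem exists_eq_zero_of_even_on_sphere {d : ℕ}
    {F : (Fin (d + 1) → ℝ) → Fin (d + 1) → ℝ} (hF : Continuous F)
    (heven : ∀ x, ‖x‖ = 1 → F (-x) = F x) (hid : ∀ x, ‖x‖ ≤ 1 / 2 → F x = x) :
    ∃ x, x ≠ 0 ∧ ‖x‖ ≤ 1 ∧ F x = 0 := by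
  by_contra! hcon
  have hK : IsCompact (Metric.closedBall (0 : Fin (d + 1) → ℝ) 1 ∩ {x | 1 / 2 ≤ ‖x‖}) :=
    (isCompact_closedBall _ _).inter_right (isClosed_le continuous_const continuous_norm)
  obtain ⟨δ, hδ, hδF⟩ := hK.exists_forall_le' (f := fun x => ‖F x‖) (a := 0)
    hF.norm.continuousOn (fun x hx => by
      refine norm_pos_iff.2 (hcon x (fun h => ?_) (by simpa using hx.1))
      have := hx.2
      simp [h] at this
      norm_num at this)
  obtain ⟨η, hη, hηF⟩ := Metric.uniformContinuousOn_iff.1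
    ((isCompact_closedBall (0 : Fin (d + 1) → ℝ) 1).uniformContinuousOn_of_continuous
      hF.continuousOn) δ hδ
  obtain ⟨m, hm⟩ := exists_nat_gt (max (1 / η) 2)
  have hm2 : (2 : ℝ) < m := (le_max_right _ _).trans_lt hm
  have hm0 : (0 : ℝ) < m := by linarith
  have hmη : 1 / (m : ℝ) < η := by
    have := (le_max_left _ _).trans_lt hm
    rwa [one_div_lt hm0 hη]
  let s : (Fin (d + 1) → ℤ) → Fin (d + 1) → ℝ := fun v i => (v i : ℝ) / m
  have hsabs : ∀ v i, ‖s v i‖ = ((|v i| : ℤ) : ℝ) / m := fun v i => by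
    simp [s]
  have hsle : ∀ v, (∀ i, |v i| ≤ (m : ℤ)) → ‖s v‖ ≤ 1 := fun v hv => by
    refine (pi_norm_le_iff_of_nonneg zero_le_one).2 fun i => ?_
    rw [hsabs, div_le_one hm0]
    exact_mod_cast hv i
  have hlabel : ∀ v, ‖s v‖ ≤ 1 / 2 →
      (firstIndex fun i => 0 < F (s v) i) = firstIndex fun i => 0 < v i := fun v hv => by
    rw [hid _ hv]
    congr 1
    funext i
    simp [s, hm0]
  obtain ⟨t, ht, hdoor, hnone, j, hj, hne⟩ := KuhnFacet.exists_isDoor_label_ne_firstIndex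
    (L := fun v => firstIndex fun i => 0 < F (s v) i) (m := m)
    (by exact_mod_cast (by linarith : (1 : ℝ) ≤ m))
    (fun v hv ⟨i, hi⟩ => by
      have hneg : s (-v) = -s v := by
        funext i
        simp [s, neg_div]
      have hnorm : ‖s v‖ = 1 := by
        refine le_antisymm (hsle v hv) ?_
        have := norm_le_pi_norm (s v) i
        rwa [hsabs, hi, Int.cast_natCast, div_self hm0.ne'] at this
      simp only [hneg, heven _ hnorm])
    (fun v hv => by
      refine hlabel v ((pi_norm_le_iff_of_nonneg (by norm_num)).2 fun i => ?_)
      rw [hsabs, div_le_div_iff₀ hm0 two_pos]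
      have : ((|v i| : ℤ) : ℝ) ≤ 1 := by exact_mod_cast hv i
      linarith)
  have hclose : ∀ j j' i, |F (s (t.vertex j)) i - F (s (t.vertex j')) i| < δ := by
    intro j j' i
    rw [← Real.dist_eq]
    refine (dist_le_pi_dist _ _ i).trans_lt (hηF _ ?_ _ ?_ ?_)
    · simpa using hsle _ (KuhnFacet.abs_vertex_le ht j)
    · simpa using hsle _ (KuhnFacet.abs_vertex_le ht j')
    · refine lt_of_le_of_lt ((dist_pi_le_iff (by positivity)).2 fun i => ?_) hmη
      rw [Real.dist_eq]
      simp only [s]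
      rw [← sub_div, abs_div, abs_of_pos hm0]
      gcongr
      have : |t.vertex j i - t.vertex j' i| ≤ 1 := by
        rw [abs_le]
        simp only [KuhnFacet.vertex]
        split_ifs <;> lia
      exact_mod_cast this
  refine hne (hlabel _ (not_lt.1 fun hlt => ?_))
  refine absurd (hδF (s (t.vertex j)) ⟨by simpa using hsle _ (KuhnFacet.abs_vertex_le ht j),
    hlt.le⟩) (not_le.2 ((pi_norm_lt_iff hδ).2 fun i => ?_))
  obtain ⟨j', -, -, hj'⟩ := hdoor i
  have h1 := (firstIndex_eq_some.1 hj').1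
  have h2 := firstIndex_eq_none.1 hnone i
  have h3 := abs_lt.1 (hclose j j' i)
  have h4 := abs_lt.1 (hclose j t.2.2 i)
  rw [Real.norm_eq_abs, abs_lt]
  constructor <;> linarith

/-- Every continuous section of the orthogonal complement of the tautological line bundle over
`ℝP^{n-1}` has a zero. -/
theorem continuous_section_orthogonal_complement_has_zero (n : ℕ) (hn : 1 ≤ n)
    (f : ℙ ℝ (EuclideanSpace ℝ (Fin n)) → EuclideanSpace ℝ (Fin n))
    (hf : Continuous f)
    (hperp : ∀ L : ℙ ℝ (EuclideanSpace ℝ (Fin n)), f L ∈ L.submoduleᗮ) :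
    ∃ L : ℙ ℝ (EuclideanSpace ℝ (Fin n)), f L = 0 := by
  classical
  obtain ⟨d, rfl⟩ : ∃ d, n = d + 1 := ⟨n - 1, by lia⟩
  by_contra! hcon
  have hne : ∀ x : Fin (d + 1) → ℝ, x ≠ 0 → WithLp.toLp 2 x ≠ 0 := fun x hx => by simpa using hx
  let u : (Fin (d + 1) → ℝ) → Fin (d + 1) → ℝ := fun x =>
    if hx : x = 0 then 0 else WithLp.ofLp (f (Projectivization.mk ℝ (WithLp.toLp 2 x) (hne x hx)))
  have hu0 : ∀ x, x ≠ 0 → u x ≠ 0 := fun x hx => by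
    simpa [u, hx] using hcon _
  have hu_neg : ∀ x, u (-x) = u x := fun x => by
    by_cases hx : x = 0
    · simp [hx]
    · simp only [u, hx, neg_eq_zero, dif_neg, not_false_eq_true]
      congr 2
      rw [Projectivization.mk_eq_mk_iff']
      exact ⟨-1, by simp⟩
  have hu_perp : ∀ x, x ⬝ᵥ u x = 0 := fun x => by
    by_cases hx : x = 0
    · simp [hx]
    · have h := hperp (Projectivization.mk ℝ (WithLp.toLp 2 x) (hne x hx))
      rw [Projectivization.submodule_mk, Submodule.mem_orthogonal_singleton_iff_inner_right] at h
      simp only [u, hx, dif_neg, not_false_eq_true]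
      rw [EuclideanSpace.inner_eq_star_dotProduct] at h
      simpa [dotProduct_comm] using h
  have hu_cont : ContinuousOn u {0}ᶜ := by
    rw [continuousOn_iff_continuous_domRestrict]
    have h1 : Continuous fun x : ({0}ᶜ : Set (Fin (d + 1) → ℝ)) =>
        (⟨WithLp.toLp 2 x.1, hne _ x.2⟩ : {v : EuclideanSpace ℝ (Fin (d + 1)) // v ≠ 0}) :=
      Continuous.subtype_mk ((PiLp.continuous_toLp 2 _).comp continuous_subtype_val) _
    have h2 : Continuous (Projectivization.mk' ℝ :
        {v : EuclideanSpace ℝ (Fin (d + 1)) // v ≠ 0} → _) := continuous_coinduced_rng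
    refine ((PiLp.continuous_ofLp 2 _).comp (hf.comp (h2.comp h1))).congr fun x => ?_
    have hx : x.1 ≠ 0 := x.2
    simp [u, hx, Projectivization.mk'_eq_mk]
  let F : (Fin (d + 1) → ℝ) → Fin (d + 1) → ℝ := fun x =>
    min 1 (2 - 2 * ‖x‖) • x + max 0 (2 * ‖x‖ - 1) • u x
  have hFid : ∀ x, ‖x‖ ≤ 1 / 2 → F x = x := fun x hx => by
    simp only [F]
    rw [min_eq_left (by linarith), max_eq_left (by linarith)]
    simp
  have hF : Continuous F := by
    rw [continuous_iff_continuousAt]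
    intro x
    by_cases hx : x = 0
    · subst hx
      refine continuousAt_id.congr ?_
      filter_upwards [Metric.closedBall_mem_nhds (0 : Fin (d + 1) → ℝ)
        (by norm_num : (0 : ℝ) < 1 / 2)] with y hy
      exact (hFid y (by simpa using hy)).symm
    · have := hu_cont.continuousAt (isOpen_compl_singleton.mem_nhds hx)
      exact ((by fun_prop : ContinuousAt (fun x : Fin (d + 1) → ℝ =>
        min 1 (2 - 2 * ‖x‖) • x) x)).add
        ((by fun_prop : ContinuousAt (fun x : Fin (d + 1) → ℝ => max 0 (2 * ‖x‖ - 1)) x).smul this)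
  obtain ⟨x, hx0, hx1, hFx⟩ := exists_eq_zero_of_even_on_sphere hF
    (fun x hx => by simp [F, hu_neg, hx]) hFid
  have ha : min 1 (2 - 2 * ‖x‖) = 0 := by
    have h := congrArg (fun y => x ⬝ᵥ y) hFx
    simpa [F, dotProduct_add, dotProduct_smul, hu_perp, hx0] using h
  have hx : ‖x‖ = 1 := by
    rcases min_choice 1 (2 - 2 * ‖x‖) with h | h <;> linarith
  apply hu0 x hx0
  simpa [F, hx, show (2 : ℝ) - 1 = 1 by norm_num] using hFx
end

section
/- Let n ≥ 1 and let σ : ℝP^{n-1} → ℝ^n be a continuous map. Then there exists a line L ∈ ℝP^{n-1} through the origin such that σ(L) ∈ L. -/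
open LinearAlgebra.Projectivization

namespace KuhnTriangulation

open Finset

/-- A simplex of the Kuhn triangulation of `ℝⁿ` (lowest vertex, and the order in which the
coordinates are raised) together with the index of one of its vertices. Such a triple stands for
the facet opposite to that vertex. -/
abbrev Flag (n : ℕ) := (Fin n → ℤ) × Equiv.Perm (Fin n) × Fin (n + 1)

/-- The `k`-th vertex of the Kuhn simplex with lowest vertex `x`, in which the coordinate `i` is
raised at step `ρ i`. -/
def vertex {n : ℕ} (x : Fin n → ℤ) (ρ : Equiv.Perm (Fin n)) (k : Fin (n + 1)) : Fin n → ℤ :=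
  fun i => x i + if (ρ i : ℕ) < k then 1 else 0

/-- The vertices of the facet given by a flag. -/
def facet {n : ℕ} (t : Flag n) : Set (Fin n → ℤ) :=
  {v | ∃ j, j ≠ t.2.2 ∧ vertex t.1 t.2.1 j = v}

/-- The image of a flag under `v ↦ -v`. -/
def reflect {n : ℕ} (t : Flag n) : Flag n :=
  (fun i => -t.1 i - 1, t.2.1.trans Fin.revPerm, t.2.2.rev)

/-- The other flag with the same facet. -/
def pivot {m : ℕ} (t : Flag (m + 1)) : Flag (m + 1) :=
  if h₀ : (t.2.2 : ℕ) = 0 then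
    (fun i => t.1 i + if (t.2.1 i : ℕ) = 0 then 1 else 0,
      t.2.1.trans (finRotate (m + 1)).symm, Fin.last _)
  else if h₁ : (t.2.2 : ℕ) = m + 1 then
    (fun i => t.1 i - if (t.2.1 i : ℕ) = m then 1 else 0, t.2.1.trans (finRotate (m + 1)), 0)
  else
    (t.1, t.2.1.trans (Equiv.swap (t.2.2.pred fun h => h₀ (by simp [h]))
      (t.2.2.castPred fun h => h₁ (by simp [h]))), t.2.2)

lemma val_finRotate {m : ℕ} (a : Fin (m + 1)) :
    (finRotate (m + 1) a : ℕ) = if (a : ℕ) = m then 0 else (a : ℕ) + 1 := by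
  split_ifs with h
  · have : a = Fin.last m := Fin.ext h
    simp [this]
  · exact coe_finRotate_of_ne_last fun h' => h (by simp [h'])

lemma val_finRotate_symm {m : ℕ} (a : Fin (m + 1)) :
    ((finRotate (m + 1)).symm a : ℕ) = if (a : ℕ) = 0 then m else (a : ℕ) - 1 := by
  obtain ⟨b, rfl⟩ := (finRotate (m + 1)).surjective a
  rw [Equiv.symm_apply_apply, val_finRotate]
  split_ifs <;> simp_all

lemma val_swap {n : ℕ} (a b c : Fin n) :
    (Equiv.swap a b c : ℕ) = if (c : ℕ) = a then (b : ℕ) else if (c : ℕ) = b then a else c := by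
  simp only [Equiv.swap_apply_def, Fin.ext_iff]
  split_ifs <;> rfl

lemma flag_ext {n : ℕ} {t u : Flag n} (h₁ : ∀ i, t.1 i = u.1 i)
    (h₂ : ∀ i, (t.2.1 i : ℕ) = u.2.1 i) (h₃ : (t.2.2 : ℕ) = u.2.2) : t = u :=
  Prod.ext (funext h₁) (Prod.ext (Equiv.ext fun i => Fin.ext (h₂ i)) (Fin.ext h₃))

lemma pivot_fst {m : ℕ} (t : Flag (m + 1)) (i : Fin (m + 1)) :
    (pivot t).1 i = if (t.2.2 : ℕ) = 0 then t.1 i + (if (t.2.1 i : ℕ) = 0 then 1 else 0)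
      else if (t.2.2 : ℕ) = m + 1 then t.1 i - (if (t.2.1 i : ℕ) = m then 1 else 0)
      else t.1 i := by
  unfold pivot
  by_cases h₀ : (t.2.2 : ℕ) = 0
  · simp only [h₀, dite_true, if_true]
  by_cases h₁ : (t.2.2 : ℕ) = m + 1
  · simp only [h₁, dite_true, if_true, dite_false, if_false, Nat.add_eq_zero_iff, one_ne_zero,
      and_false]
  · simp only [h₀, h₁, dite_false, if_false]

lemma pivot_perm {m : ℕ} (t : Flag (m + 1)) (i : Fin (m + 1)) :
    ((pivot t).2.1 i : ℕ) =
      if (t.2.2 : ℕ) = 0 then (if (t.2.1 i : ℕ) = 0 then m else (t.2.1 i : ℕ) - 1)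
      else if (t.2.2 : ℕ) = m + 1 then (if (t.2.1 i : ℕ) = m then 0 else (t.2.1 i : ℕ) + 1)
      else if (t.2.1 i : ℕ) = t.2.2 - 1 then (t.2.2 : ℕ)
      else if (t.2.1 i : ℕ) = t.2.2 then (t.2.2 : ℕ) - 1 else t.2.1 i := by
  unfold pivot
  by_cases h₀ : (t.2.2 : ℕ) = 0
  · simp only [h₀, dite_true, if_true, Equiv.trans_apply, val_finRotate_symm]
  by_cases h₁ : (t.2.2 : ℕ) = m + 1
  · simp only [h₁, dite_true, if_true, dite_false, if_false, Equiv.trans_apply, val_finRotate,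
      Nat.add_eq_zero_iff, one_ne_zero, and_false]
  · simp only [h₀, h₁, dite_false, if_false, Equiv.trans_apply, val_swap, Fin.val_pred,
      Fin.coe_castPred]
    rfl

lemma pivot_index {m : ℕ} (t : Flag (m + 1)) :
    ((pivot t).2.2 : ℕ) = if (t.2.2 : ℕ) = 0 then m + 1
      else if (t.2.2 : ℕ) = m + 1 then 0 else t.2.2 := by
  unfold pivot
  split_ifs <;> simp

lemma reflect_fst {n : ℕ} (t : Flag n) (i : Fin n) : (reflect t).1 i = -t.1 i - 1 := rfl

lemma reflect_perm {n : ℕ} (t : Flag n) (i : Fin n) :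
    ((reflect t).2.1 i : ℕ) = n - 1 - t.2.1 i := by
  simp [reflect, Fin.val_rev]; omega

lemma reflect_index {n : ℕ} (t : Flag n) : ((reflect t).2.2 : ℕ) = n - t.2.2 := by
  simp [reflect, Fin.val_rev]

lemma pivot_pivot {m : ℕ} (t : Flag (m + 1)) : pivot (pivot t) = t := by
  have hk := t.2.2.isLt
  refine flag_ext (fun i => ?_) (fun i => ?_) ?_
  · have := (t.2.1 i).isLt
    simp only [pivot_fst, pivot_perm, pivot_index]
    grind
  · have := (t.2.1 i).isLt
    simp only [pivot_perm, pivot_index]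
    grind
  · simp only [pivot_index]
    grind

lemma reflect_reflect {n : ℕ} (t : Flag n) : reflect (reflect t) = t := by
  refine flag_ext (fun i => ?_) (fun i => ?_) ?_
  · simp only [reflect_fst]; ring
  · have := (t.2.1 i).isLt
    simp only [reflect_perm]; omega
  · have := t.2.2.isLt
    simp only [reflect_index]; omega

lemma pivot_reflect {m : ℕ} (t : Flag (m + 1)) : pivot (reflect t) = reflect (pivot t) := by
  have hk := t.2.2.isLt
  refine flag_ext (fun i => ?_) (fun i => ?_) ?_
  · have := (t.2.1 i).isLt
    simp only [pivot_fst, reflect_fst, reflect_perm, reflect_index]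
    grind
  · have := (t.2.1 i).isLt
    simp only [pivot_perm, reflect_perm, reflect_index]
    grind
  · simp only [pivot_index, reflect_index]
    grind

lemma pivot_ne {m : ℕ} (t : Flag (m + 1)) : pivot t ≠ t := by
  intro h
  have hk := t.2.2.isLt
  have h₁ := pivot_index t
  rw [h] at h₁
  have h₀ : (t.2.2 : ℕ) ≠ 0 := by intro h0; simp [h0] at h₁
  have h₀' : (t.2.2 : ℕ) ≠ m + 1 := by intro h0; simp [h0] at h₁
  have h₂ := pivot_perm t (t.2.1.symm ⟨t.2.2, by omega⟩)
  rw [h] at h₂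
  simp only [Equiv.apply_symm_apply] at h₂
  grind

lemma facet_subset_facet_pivot {m : ℕ} (t : Flag (m + 1)) : facet t ⊆ facet (pivot t) := by
  rintro v ⟨j, hj, rfl⟩
  have hk := t.2.2.isLt
  have hj' := j.isLt
  rw [Ne, Fin.ext_iff] at hj
  let l : ℕ := if (t.2.2 : ℕ) = 0 then j - 1 else if (t.2.2 : ℕ) = m + 1 then j + 1 else j
  refine ⟨⟨l, by grind⟩, ?_, funext fun i => ?_⟩
  · rw [Ne, Fin.ext_iff, pivot_index]
    grind
  · have := (t.2.1 i).isLt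
    simp only [vertex, pivot_fst, pivot_perm]
    grind

lemma facet_pivot {m : ℕ} (t : Flag (m + 1)) : facet (pivot t) = facet t :=
  (by simpa [pivot_pivot] using facet_subset_facet_pivot (pivot t) :
    facet (pivot t) ⊆ facet t).antisymm (facet_subset_facet_pivot t)

lemma neg_mem_facet_reflect {n : ℕ} {t : Flag n} {v : Fin n → ℤ} (hv : v ∈ facet t) :
    -v ∈ facet (reflect t) := by
  obtain ⟨j, hj, rfl⟩ := hv
  refine ⟨j.rev, by simpa [reflect] using hj, funext fun i => ?_⟩
  have := (t.2.1 i).isLt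
  have := j.isLt
  simp only [vertex, reflect_fst, reflect_perm, Fin.val_rev, Pi.neg_apply]
  grind

/-- The lowest vertices of the Kuhn simplices that triangulate the cube `[-N, N]ⁿ`. -/
noncomputable def cube (n N : ℕ) : Finset (Fin n → ℤ) :=
  Fintype.piFinset fun _ => Finset.Ico (-(N : ℤ)) N

lemma mem_cube {n N : ℕ} {x : Fin n → ℤ} : x ∈ cube n N ↔ ∀ i, -(N : ℤ) ≤ x i ∧ x i < N := by
  simp [cube]

lemma reflect_mem_cube {n N : ℕ} {t : Flag n} :
    (reflect t).1 ∈ cube n N ↔ t.1 ∈ cube n N := by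
  simp only [mem_cube, reflect_fst]
  exact forall_congr' fun i => by omega

lemma abs_eq_of_pivot_notMem_cube {m N : ℕ} {t : Flag (m + 1)} (ht : t.1 ∈ cube (m + 1) N)
    (hp : (pivot t).1 ∉ cube (m + 1) N) :
    ((t.2.2 : ℕ) = 0 ∨ (t.2.2 : ℕ) = m + 1) ∧ ∀ v ∈ facet t, ∃ i, |v i| = N := by
  simp only [mem_cube] at ht hp
  push Not at hp
  obtain ⟨i, hi⟩ := hp
  have hti := ht i
  rw [pivot_fst] at hi
  refine ⟨by grind, ?_⟩
  rintro v ⟨j, hj, rfl⟩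
  rw [Ne, Fin.ext_iff] at hj
  have := j.isLt
  refine ⟨i, ?_⟩
  rw [vertex, abs_eq (by positivity)]
  grind

lemma reflect_ne {m : ℕ} {t : Flag (m + 1)} (h : (t.2.2 : ℕ) = 0 ∨ (t.2.2 : ℕ) = m + 1) :
    reflect t ≠ t := by
  intro h'
  have := reflect_index t
  rw [h'] at this
  omega

/-- The labels of the given vertices include every label other than the last one. -/
def IsDoor {n : ℕ} (l : (Fin n → ℤ) → Fin (n + 1)) (s : Set (Fin n → ℤ)) : Prop :=
  ∀ c : Fin n, ∃ v ∈ s, l v = c.castSucc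

open Classical in
lemma sum_isDoor_eq_zero {m N : ℕ} (l : (Fin (m + 1) → ℤ) → Fin (m + 2))
    (hl : ∀ v, (∃ i, |v i| = (N : ℤ)) → l (-v) = l v) :
    ∑ t ∈ cube (m + 1) N ×ˢ (univ : Finset (Equiv.Perm (Fin (m + 1)) × Fin (m + 2))),
      (if IsDoor l (facet t) then 1 else 0 : ZMod 2) = 0 := by
  have door_reflect : ∀ t : Flag (m + 1), (∀ v ∈ facet t, ∃ i, |v i| = N) →
      IsDoor l (facet t) → IsDoor l (facet (reflect t)) := fun t ht h c => by
    obtain ⟨v, hv, hc⟩ := h c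
    exact ⟨-v, neg_mem_facet_reflect hv, (hl v (ht v hv)).trans hc⟩
  have boundary_reflect : ∀ t : Flag (m + 1), (∀ v ∈ facet t, ∃ i, |v i| = N) →
      ∀ v ∈ facet (reflect t), ∃ i, |v i| = N := fun t ht v hv => by
    obtain ⟨i, hi⟩ := ht (-v) (by simpa [reflect_reflect] using neg_mem_facet_reflect hv)
    exact ⟨i, by simpa using hi⟩
  refine sum_involution
    (fun t _ => if (pivot t).1 ∈ cube (m + 1) N then pivot t else reflect t) ?_ ?_ ?_ ?_
  · intro t ht
    have key : IsDoor l (facet (if (pivot t).1 ∈ cube (m + 1) N then pivot t else reflect t)) ↔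
        IsDoor l (facet t) := by
      split_ifs with h
      · rw [facet_pivot]
      · have hb := (abs_eq_of_pivot_notMem_cube (by simpa using ht) h).2
        exact ⟨fun h' => by
          simpa [reflect_reflect] using door_reflect _ (boundary_reflect t hb) h',
          door_reflect t hb⟩
    simp only [key]
    exact CharTwo.add_self_eq_zero _
  · intro t ht _
    split_ifs with h
    · exact pivot_ne t
    · exact reflect_ne (abs_eq_of_pivot_notMem_cube (by simpa using ht) h).1
  · intro t ht
    have ht' : t.1 ∈ cube (m + 1) N := by simpa using ht
    split_ifs with h
    · simpa using h
    · simpa using reflect_mem_cube.2 ht'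
  · intro t ht
    have ht' : t.1 ∈ cube (m + 1) N := by simpa using ht
    by_cases h : (pivot t).1 ∈ cube (m + 1) N
    · simp [h, pivot_pivot, ht']
    · simp [h, pivot_reflect, reflect_mem_cube, reflect_reflect]

/-- Among the facets of a simplex whose vertices are labelled by `f`, the number of doors is odd
exactly when all labels occur. -/
lemma sum_door_eq {n : ℕ} (f : Fin (n + 1) → Fin (n + 1))
    [∀ k, Decidable (∀ c : Fin n, ∃ j, j ≠ k ∧ f j = c.castSucc)]
    [Decidable (Function.Surjective f)] :
    ∑ k, (if ∀ c : Fin n, ∃ j, j ≠ k ∧ f j = c.castSucc then 1 else 0 : ZMod 2) =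
      if Function.Surjective f then 1 else 0 := by
  classical
  split_ifs with hf
  · have hinj : Function.Injective f := Finite.injective_iff_surjective.2 hf
    obtain ⟨k₀, hk₀⟩ := hf (Fin.last n)
    have : ∀ k, (∀ c : Fin n, ∃ j, j ≠ k ∧ f j = c.castSucc) ↔ k = k₀ := by
      intro k
      constructor
      · intro h
        by_contra hne
        have hlast : f k ≠ Fin.last n := fun h' => hne (hinj (h'.trans hk₀.symm))
        obtain ⟨j, hj, hj'⟩ := h ((f k).castPred hlast)
        exact hj (hinj (by simpa using hj'))
      · rintro rfl c
        obtain ⟨j, hj⟩ := hf c.castSucc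
        refine ⟨j, ?_, hj⟩
        rintro rfl
        exact Fin.castSucc_ne_last c (hj.symm.trans hk₀)
    simp [this]
  · by_cases hd : ∃ k, ∀ c : Fin n, ∃ j, j ≠ k ∧ f j = c.castSucc
    · obtain ⟨k, hk⟩ := hd
      have hlast : f k ≠ Fin.last n := by
        intro h
        refine hf fun c => ?_
        induction c using Fin.lastCases with
        | last => exact ⟨k, h⟩
        | cast c => exact (hk c).imp fun j hj => hj.2
      obtain ⟨a, hak, ha⟩ := hk ((f k).castPred hlast)
      rw [Fin.castSucc_castPred] at ha
      have hinj : ∀ j₁ j₂, j₁ ≠ k → j₂ ≠ k → f j₁ = f j₂ → j₁ = j₂ := by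
        choose g hgk hg using hk
        have ginj : Function.Injective fun c => (⟨g c, hgk c⟩ : {j // j ≠ k}) := by
          intro c c' h
          have h' : g c = g c' := congrArg Subtype.val h
          exact Fin.castSucc_injective n ((hg c).symm.trans ((congrArg f h').trans (hg c')))
        have gsurj := ((Fintype.bijective_iff_injective_and_card _).2 ⟨ginj, by simp⟩).2
        intro j₁ j₂ h₁ h₂ h
        obtain ⟨c₁, hc₁⟩ := gsurj ⟨j₁, h₁⟩
        obtain ⟨c₂, hc₂⟩ := gsurj ⟨j₂, h₂⟩
        obtain rfl : g c₁ = j₁ := congrArg Subtype.val hc₁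
        obtain rfl : g c₂ = j₂ := congrArg Subtype.val hc₂
        rw [hg, hg] at h
        rw [Fin.castSucc_injective n h]
      have : ∀ k', (∀ c : Fin n, ∃ j, j ≠ k' ∧ f j = c.castSucc) ↔ k' ∈ ({a, k} : Finset _) := by
        intro k'
        rw [mem_insert, mem_singleton]
        constructor
        · intro h
          by_contra! hne
          have hlast' : f k' ≠ Fin.last n := by
            intro h'
            refine hf fun c => ?_
            induction c using Fin.lastCases with
            | last => exact ⟨k', h'⟩
            | cast c => exact (h c).imp fun j hj => hj.2
          obtain ⟨j, hj, hj'⟩ := h ((f k').castPred hlast')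
          rw [Fin.castSucc_castPred] at hj'
          by_cases hjk : j = k
          · subst hjk
            exact hne.1 (hinj _ _ hne.2 hak (by rw [ha, hj']))
          · exact hj (hinj _ _ hjk hne.2 hj')
        · rintro (rfl | rfl)
          · intro c
            obtain ⟨j, hj, hj'⟩ := hk c
            by_cases hja : j = k'
            · exact ⟨k, hak.symm, by rw [← ha, ← hja, hj']⟩
            · exact ⟨j, hja, hj'⟩
          · exact hk
      simp only [this, sum_ite_mem, univ_inter, sum_const, card_pair hak]
      rfl
    · push Not at hd
      refine sum_eq_zero fun k _ => if_neg ?_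
      push Not
      exact hd k

open Classical in
/-- A labelling of the cube `[-N, N]ⁿ` that is even on the boundary has an even number of
fully labelled Kuhn simplices. -/
theorem even_card_surjective {m N : ℕ} (l : (Fin (m + 1) → ℤ) → Fin (m + 2))
    (hl : ∀ v, (∃ i, |v i| = (N : ℤ)) → l (-v) = l v) :
    Even #{s ∈ cube (m + 1) N ×ˢ (univ : Finset (Equiv.Perm (Fin (m + 1)))) |
      Function.Surjective fun k => l (vertex s.1 s.2 k)} := by
  rw [← ZMod.natCast_eq_zero_iff_even, ← sum_boole]
  refine Eq.trans ?_ (sum_isDoor_eq_zero l hl)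
  rw [sum_product, sum_product]
  refine sum_congr rfl fun x _ => ?_
  rw [← univ_product_univ, sum_product]
  refine sum_congr rfl fun ρ _ => ?_
  refine (sum_door_eq fun k => l (vertex x ρ k)).symm.trans (sum_congr rfl fun k _ => ?_)
  simp [IsDoor, facet]

lemma existsUnique_signLabel {n : ℕ} (v : Fin n → ℝ) :
    ∃! c : Fin (n + 1), (∀ i : Fin n, i.castSucc < c → v i ≤ 0) ∧
      ∀ i : Fin n, i.castSucc = c → 0 < v i := by
  refine existsUnique_of_exists_of_unique ?_ fun c c' hc hc' => ?_
  · obtain ⟨c, hc, hmin⟩ := WellFounded.has_min (wellFounded_lt (α := Fin (n + 1)))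
      {c | ∀ i : Fin n, i.castSucc = c → 0 < v i}
      ⟨Fin.last n, fun i hi => (Fin.castSucc_ne_last i hi).elim⟩
    refine ⟨c, fun i hi => ?_, hc⟩
    by_contra! hpos
    exact hmin i.castSucc (fun j hj => by rwa [Fin.castSucc_injective n hj]) hi
  · by_contra hne
    wlog hlt : c < c' generalizing c c'
    · exact this c' c hc' hc (Ne.symm hne) (lt_of_le_of_ne (not_lt.1 hlt) (Ne.symm hne))
    have h := Fin.ne_last_of_lt hlt
    have h₁ := hc.2 (c.castPred h) (by simp)
    have h₂ := hc'.1 (c.castPred h) (by simpa using hlt)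
    exact h₁.not_ge h₂

/-- The index of the first positive coordinate of a vector, or `Fin.last n` if there is none. -/
noncomputable def signLabel {n : ℕ} (v : Fin n → ℝ) : Fin (n + 1) :=
  (existsUnique_signLabel v).choose

lemma signLabel_eq_iff {n : ℕ} {v : Fin n → ℝ} {c : Fin (n + 1)} :
    signLabel v = c ↔ (∀ i : Fin n, i.castSucc < c → v i ≤ 0) ∧
      ∀ i : Fin n, i.castSucc = c → 0 < v i := by
  have h := (existsUnique_signLabel v).choose_spec
  exact ⟨fun hc => hc ▸ h.1, fun hc => (h.2 c hc).symm⟩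

lemma pos_of_signLabel_eq {n : ℕ} {v : Fin n → ℝ} {i : Fin n} (h : signLabel v = i.castSucc) :
    0 < v i :=
  (signLabel_eq_iff.1 h).2 i rfl

lemma nonpos_of_signLabel_eq_last {n : ℕ} {v : Fin n → ℝ} (h : signLabel v = Fin.last n)
    (i : Fin n) : v i ≤ 0 :=
  (signLabel_eq_iff.1 h).1 i (Fin.castSucc_lt_last i)

/-- With respect to the labelling by `signLabel`, there is exactly one fully labelled simplex. -/
lemma surjective_signLabel_iff {n : ℕ} {x : Fin n → ℤ} {ρ : Equiv.Perm (Fin n)} {r : ℝ}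
    (hr : 0 < r) :
    (Function.Surjective fun k => signLabel fun i => (vertex x ρ k i : ℝ) / r) ↔
      x = 0 ∧ ρ = Fin.revPerm := by
  have pos_iff : ∀ a : ℤ, 0 < (a : ℝ) / r ↔ 0 < a := fun a => by
    rw [div_pos_iff_of_pos_right hr, Int.cast_pos]
  have nonpos_iff : ∀ a : ℤ, (a : ℝ) / r ≤ 0 ↔ a ≤ 0 := fun a => by
    rw [← not_lt, pos_iff, not_lt]
  constructor
  · intro h
    obtain ⟨k₀, hk₀⟩ := h (Fin.last n)
    have hx : x = 0 := by
      funext i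
      obtain ⟨k, hk⟩ := h i.castSucc
      have h₁ := (nonpos_iff _).1 (nonpos_of_signLabel_eq_last hk₀ i)
      have h₂ := (pos_iff _).1 (pos_of_signLabel_eq hk)
      simp only [vertex, Pi.zero_apply] at h₁ h₂ ⊢
      grind
    refine ⟨hx, ?_⟩
    have hanti : StrictAnti ρ := by
      intro i' i hi
      obtain ⟨k, hk⟩ := h i.castSucc
      have h₁ := (nonpos_iff _).1 ((signLabel_eq_iff.1 hk).1 i' (by simpa using hi))
      have h₂ := (pos_iff _).1 (pos_of_signLabel_eq hk)
      simp only [vertex, hx, Pi.zero_apply] at h₁ h₂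
      rw [Fin.lt_def]
      grind
    have hmono : StrictMono (ρ.trans Fin.revPerm) := fun i j hij => by
      simpa using hanti hij
    ext i
    have := congrFun hmono.eq_id i
    simp only [Equiv.trans_apply, Fin.revPerm_apply, id_eq] at this
    rw [Fin.revPerm_apply, ← Fin.rev_rev (ρ i), this]
  · rintro ⟨rfl, rfl⟩ c
    refine ⟨c.rev, signLabel_eq_iff.2 ⟨fun i hi => ?_, fun i hi => ?_⟩⟩
    · rw [nonpos_iff]
      rw [Fin.lt_def, Fin.val_castSucc] at hi
      simp only [vertex, Fin.revPerm_apply, Fin.val_rev, Pi.zero_apply]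
      grind
    · rw [pos_iff]
      rw [Fin.ext_iff, Fin.val_castSucc] at hi
      simp only [vertex, Fin.revPerm_apply, Fin.val_rev, Pi.zero_apply]
      grind

lemma abs_vertex_sub_le {n : ℕ} (x : Fin n → ℤ) (ρ : Equiv.Perm (Fin n)) (j k : Fin (n + 1))
    (i : Fin n) : |vertex x ρ j i - vertex x ρ k i| ≤ 1 := by
  simp only [vertex, abs_le]
  grind

lemma abs_vertex_le {n N : ℕ} {x : Fin n → ℤ} (hx : x ∈ cube n N) (ρ : Equiv.Perm (Fin n))
    (k : Fin (n + 1)) (i : Fin n) : |vertex x ρ k i| ≤ N := by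
  have := mem_cube.1 hx i
  simp only [vertex, abs_le]
  grind

end KuhnTriangulation

open KuhnTriangulation in
/-- A continuous self-map of `ℝⁿ` that is the identity near the origin and even outside the open
unit ball has a zero other than the origin. -/
theorem exists_ne_zero_eq_zero_of_even {m : ℕ} {F : (Fin (m + 1) → ℝ) → Fin (m + 1) → ℝ}
    (hF : Continuous F) (hid : ∀ y, ‖y‖ ≤ 1 / 2 → F y = y)
    (heven : ∀ y, 1 ≤ ‖y‖ → F (-y) = F y) : ∃ y, y ≠ 0 ∧ F y = 0 := by
  classical
  by_contra! hne
  obtain ⟨ε, hε, hbound⟩ := ((isCompact_closedBall (0 : Fin (m + 1) → ℝ) 1).inter_right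
    (isClosed_le continuous_const continuous_norm : IsClosed {y | 1 / 2 ≤ ‖y‖})).exists_forall_le'
    hF.norm.continuousOn (a := 0) fun y hy =>
      norm_pos_iff.2 (hne y (norm_pos_iff.1 (one_half_pos.trans_le hy.2)))
  obtain ⟨δ, hδ, hunif⟩ := Metric.uniformContinuousOn_iff.1
    ((isCompact_closedBall (0 : Fin (m + 1) → ℝ) 1).uniformContinuousOn_of_continuous
      hF.continuousOn) ε hε
  obtain ⟨N, hN⟩ := exists_nat_gt (max (1 / δ) 2)
  obtain ⟨hNδ, hN2⟩ := max_lt_iff.1 hN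
  have hN0 : (0 : ℝ) < N := two_pos.trans hN2
  have hNδ' : 1 / (N : ℝ) < δ := by rwa [one_div_lt hN0 hδ]
  let point : (Fin (m + 1) → ℤ) → Fin (m + 1) → ℝ := fun v i => (v i : ℝ) / N
  have norm_point_le : ∀ {v : Fin (m + 1) → ℤ} {a : ℕ}, (∀ i, |v i| ≤ a) →
      ‖point v‖ ≤ a / N := fun {v a} h => by
    refine (pi_norm_le_iff_of_nonneg (by positivity)).2 fun i => ?_
    rw [Real.norm_eq_abs, abs_div, abs_of_pos hN0]
    gcongr
    exact_mod_cast h i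
  have even_label : ∀ v : Fin (m + 1) → ℤ, (∃ i, |v i| = (N : ℤ)) →
      signLabel (F (point (-v))) = signLabel (F (point v)) := by
    rintro v ⟨i, hi⟩
    have hneg : point (-v) = -point v := by
      funext i
      simp [point, neg_div]
    rw [hneg, heven]
    refine le_trans (le_of_eq ?_) (norm_le_pi_norm (point v) i)
    rw [Real.norm_eq_abs, abs_div, abs_of_pos hN0, eq_div_iff hN0.ne', one_mul]
    exact_mod_cast hi.symm
  have label_eq : ∀ v, ‖point v‖ ≤ 1 / 2 →
      signLabel (F (point v)) = signLabel fun i => (v i : ℝ) / N := fun v hv => by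
    rw [hid _ hv]
  have full_iff : ∀ x ∈ cube (m + 1) N, ∀ ρ : Equiv.Perm (Fin (m + 1)),
      (Function.Surjective fun k => signLabel (F (point (vertex x ρ k)))) ↔
        x = 0 ∧ ρ = Fin.revPerm := by
    intro x hx ρ
    rw [← surjective_signLabel_iff hN0]
    have mem_ball : ∀ k, point (vertex x ρ k) ∈ Metric.closedBall 0 1 := fun k => by
      rw [mem_closedBall_zero_iff]
      simpa [hN0.ne'] using norm_point_le (abs_vertex_le hx ρ k)
    have dist_lt : ∀ j k, dist (F (point (vertex x ρ j))) (F (point (vertex x ρ k))) < ε := by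
      intro j k
      refine hunif _ (mem_ball j) _ (mem_ball k) (lt_of_le_of_lt ?_ hNδ')
      have hsub : point (vertex x ρ j) - point (vertex x ρ k) =
          point (vertex x ρ j - vertex x ρ k) := by
        funext i
        simp [point, sub_div]
      rw [dist_eq_norm, hsub]
      simpa using norm_point_le (a := 1) (by simpa using abs_vertex_sub_le x ρ j k)
    constructor
    · intro h
      have small : ∀ k, ‖point (vertex x ρ k)‖ ≤ 1 / 2 := by
        intro k
        by_contra! hk
        refine (hbound _ ⟨mem_ball k, hk.le⟩).not_gt ((pi_norm_lt_iff hε).2 fun i => ?_)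
        obtain ⟨j₁, hj₁⟩ := h i.castSucc
        obtain ⟨j₂, hj₂⟩ := h (Fin.last _)
        have h₁ := pos_of_signLabel_eq hj₁
        have h₂ := nonpos_of_signLabel_eq_last hj₂ i
        have h₃ := abs_lt.1 ((dist_le_pi_dist _ _ i).trans_lt (dist_lt k j₁))
        have h₄ := abs_lt.1 ((dist_le_pi_dist _ _ i).trans_lt (dist_lt k j₂))
        rw [Real.norm_eq_abs, abs_lt]
        constructor <;> linarith [h₃.1, h₄.2]
      simpa only [label_eq _ (small _)] using h
    · intro h
      obtain ⟨rfl, rfl⟩ := (surjective_signLabel_iff hN0).1 h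
      have small : ∀ k, ‖point (vertex 0 Fin.revPerm k)‖ ≤ 1 / 2 := fun k => by
        refine (norm_point_le (a := 1) fun i => ?_).trans ?_
        · simp only [vertex, abs_le, Pi.zero_apply]
          grind
        · rw [Nat.cast_one]
          exact one_div_le_one_div_of_le two_pos hN2.le
      simpa only [label_eq _ (small _)] using h
  have hcard := even_card_surjective (N := N) (fun v => signLabel (F (point v))) even_label
  have hsingle : {s ∈ cube (m + 1) N ×ˢ (Finset.univ : Finset (Equiv.Perm (Fin (m + 1)))) |
      Function.Surjective fun k => signLabel (F (point (vertex s.1 s.2 k)))} =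
      {(0, Fin.revPerm)} := by
    ext ⟨x, ρ⟩
    simp only [Finset.mem_filter, Finset.mem_product, Finset.mem_univ, and_true,
      Finset.mem_singleton, Prod.mk.injEq]
    constructor
    · rintro ⟨hx, h⟩
      exact (full_iff x hx ρ).1 h
    · intro h
      have hx : x ∈ cube (m + 1) N := by
        rw [h.1, mem_cube]
        intro i
        have : 0 < N := by exact_mod_cast hN0
        simpa using this
      exact ⟨hx, (full_iff x hx ρ).2 h⟩
  rw [hsingle, Finset.card_singleton] at hcard
  exact absurd hcard (by decide)

/-- An even continuous map `ℝⁿ ∖ {0} → ℝⁿ` sends some vector to a multiple of itself. -/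
theorem exists_eq_smul_of_even {m : ℕ} {g : (Fin (m + 1) → ℝ) → Fin (m + 1) → ℝ}
    (hg : ContinuousOn g {0}ᶜ) (heven : ∀ y, g (-y) = g y) :
    ∃ y, y ≠ 0 ∧ ∃ c : ℝ, c • y = g y := by
  let s : (Fin (m + 1) → ℝ) → ℝ := fun y => min 1 (max 0 (2 * ‖y‖ - 1))
  have hs : Continuous s := by fun_prop
  have hs0 : ∀ y, ‖y‖ ≤ 1 / 2 → s y = 0 := fun y hy => by
    have : max 0 (2 * ‖y‖ - 1) = 0 := max_eq_left (by linarith)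
    simp [s, this]
  have hs1 : ∀ y, 1 ≤ ‖y‖ → s y = 1 := fun y hy =>
    min_eq_left (le_max_of_le_right (by linarith))
  let F : (Fin (m + 1) → ℝ) → Fin (m + 1) → ℝ := fun y => (1 - s y) • y + s y • g y
  have hid : ∀ y, ‖y‖ ≤ 1 / 2 → F y = y := fun y hy => by simp [F, hs0 y hy]
  have hF : Continuous F := by
    rw [continuous_iff_continuousAt]
    intro y
    by_cases hy : y = 0
    · refine continuousAt_id.congr ?_
      filter_upwards [Metric.ball_mem_nhds y (one_half_pos (α := ℝ))] with z hz
      rw [hy, mem_ball_zero_iff] at hz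
      exact (hid z hz.le).symm
    · have hgy : ContinuousAt g y := hg.continuousAt (isOpen_compl_singleton.mem_nhds hy)
      exact ((continuousAt_const.sub hs.continuousAt).smul continuousAt_id).add
        (hs.continuousAt.smul hgy)
  obtain ⟨y, hy, hFy⟩ := exists_ne_zero_eq_zero_of_even hF hid fun y hy => by
    simp [F, hs1 y hy, hs1 (-y) (by simpa using hy), heven]
  have hsy : s y ≠ 0 := by
    intro h
    exact hy (by simpa [F, h] using hFy)
  refine ⟨y, hy, -((s y)⁻¹ * (1 - s y)), ?_⟩
  rw [neg_smul, mul_smul, eq_neg_of_add_eq_zero_left hFy, smul_neg, neg_neg, inv_smul_smul₀ hsy]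

/-- For any continuous map `σ : ℝP^{n-1} → ℝ^n` there is a line `L` through the origin with
`σ(L) ∈ L`. -/
theorem exists_line_mem_of_continuous (n : ℕ) (hn : 1 ≤ n)
    (σ : ℙ ℝ (EuclideanSpace ℝ (Fin n)) → EuclideanSpace ℝ (Fin n))
    (hσ : Continuous σ) :
    ∃ L : ℙ ℝ (EuclideanSpace ℝ (Fin n)), σ L ∈ L.submodule := by
  classical
  obtain ⟨m, rfl⟩ := Nat.exists_eq_add_of_le' hn
  have ne_zero : ∀ {y : Fin (m + 1) → ℝ}, y ≠ 0 → WithLp.toLp 2 y ≠ 0 := fun hy h =>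
    hy ((WithLp.toLp_eq_zero 2).1 h)
  let g : (Fin (m + 1) → ℝ) → Fin (m + 1) → ℝ := fun y =>
    if h : y ≠ 0 then (σ (Projectivization.mk ℝ (WithLp.toLp 2 y) (ne_zero h))).ofLp else 0
  have hg : ContinuousOn g {0}ᶜ := by
    rw [continuousOn_iff_continuous_domRestrict]
    have hmk : Continuous (Projectivization.mk' ℝ : {v : EuclideanSpace ℝ (Fin (m + 1)) // v ≠ 0} →
        ℙ ℝ (EuclideanSpace ℝ (Fin (m + 1)))) := continuous_quotient_mk'
    have hcont : Continuous fun y : ({0}ᶜ : Set (Fin (m + 1) → ℝ)) =>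
        (σ (Projectivization.mk' ℝ ⟨WithLp.toLp 2 y.1, ne_zero y.2⟩)).ofLp :=
      (PiLp.continuous_ofLp 2 _).comp (hσ.comp (hmk.comp
        (((PiLp.continuous_toLp 2 _).comp continuous_subtype_val).subtype_mk _)))
    refine hcont.congr fun y => ?_
    have hy : (y : Fin (m + 1) → ℝ) ≠ 0 := y.2
    simp [g, hy]
  have heven : ∀ y, g (-y) = g y := fun y => by
    by_cases hy : y = 0
    · simp [hy]
    · have hmk : Projectivization.mk ℝ (WithLp.toLp 2 (-y)) (ne_zero (neg_ne_zero.2 hy)) =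
          Projectivization.mk ℝ (WithLp.toLp 2 y) (ne_zero hy) :=
        (Projectivization.mk_eq_mk_iff' ℝ _ _ _ _).2 ⟨-1, by simp⟩
      simp only [g, ne_eq, neg_eq_zero, hy, not_false_eq_true, dite_true, hmk]
  obtain ⟨y, hy, c, hc⟩ := exists_eq_smul_of_even hg heven
  refine ⟨Projectivization.mk ℝ (WithLp.toLp 2 y) (ne_zero hy), ?_⟩
  rw [Projectivization.submodule_mk, Submodule.mem_span_singleton]
  refine ⟨c, ?_⟩
  rw [← WithLp.toLp_smul, hc]
  simp [g, hy]
end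

section
/- Let n ≥ 1 and let σ : ℝP^{n-1} → ℝ^n be a continuous unoriented Kakeya line configuration. Then the origin 0 of ℝ^n belongs to the underlying space |σ| = ⋃_{L ∈ ℝP^{n-1}} (σ(L) + L). -/
open LinearAlgebra.Projectivization

section

open Set Filter Topology MeasureTheory

variable {E : Type*} [NormedAddCommGroup E] [NormedSpace ℝ E] [FiniteDimensional ℝ E]

theorem LipschitzWith.bijective_smul_add {A : E → E} {K : NNReal} (hA : LipschitzWith K A)
    {s : ℝ} (hs : K < s) : Function.Bijective fun x ↦ s • x + A x := by
  have hs0 : 0 < s := lt_of_le_of_lt K.2 hs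
  let e : E ≃L[ℝ] E := ContinuousLinearEquiv.smulLeft (Units.mk0 s hs0.ne')
  have key : ApproximatesLinearOn (fun x ↦ s • x + A x) (e : E →L[ℝ] E) univ K := by
    rw [ApproximatesLinearOn.approximatesLinearOn_iff_lipschitzOnWith, lipschitzOnWith_univ]
    convert hA using 1
    ext x
    simp [e, Units.smul_def]
  have hc : Subsingleton E ∨ K < ‖(e.symm : E →L[ℝ] E)‖₊⁻¹ := by
    rcases subsingleton_or_nontrivial E with h | h
    · exact Or.inl h
    · right
      have h1 : ‖(e.symm : E →L[ℝ] E)‖ ≤ s⁻¹ := by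
        refine ContinuousLinearMap.opNorm_le_bound _ (by positivity) fun x ↦ ?_
        have : e.symm x = s⁻¹ • x := by
          rw [ContinuousLinearEquiv.symm_apply_eq]
          simp [e, Units.smul_def, hs0.ne']
        rw [ContinuousLinearEquiv.coe_coe, this, norm_smul, norm_inv, Real.norm_of_nonneg hs0.le]
      have h2 : 0 < ‖(e.symm : E →L[ℝ] E)‖ := e.norm_symm_pos
      rw [← NNReal.coe_lt_coe, NNReal.coe_inv, coe_nnnorm]
      exact hs.trans_le ((le_inv_comm₀ hs0 h2).2 h1)
  exact ⟨injOn_univ.1 (injOn_iff_injective.2 (key.injective hc)), key.surjective hc⟩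

theorem eventually_det_smul_id_add_pos (K : ℝ) :
    ∀ᶠ s : ℝ in atTop, ∀ M : E →L[ℝ] E, ‖M‖ ≤ K →
      0 < (s • ContinuousLinearMap.id ℝ E + M).det := by
  have h1 : ∀ᶠ L : E →L[ℝ] E in 𝓝 (ContinuousLinearMap.id ℝ E), 0 < L.det :=
    ContinuousLinearMap.continuous_det.continuousAt.eventually_const_lt
      (by simp [ContinuousLinearMap.det])
  obtain ⟨δ, hδ, h⟩ := Metric.eventually_nhds_iff.1 h1
  filter_upwards [eventually_gt_atTop 0, eventually_gt_atTop (K / δ)] with s hs hsK M hM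
  have h2 : s • ContinuousLinearMap.id ℝ E + M
      = s • (ContinuousLinearMap.id ℝ E + s⁻¹ • M) := by
    rw [smul_add, smul_inv_smul₀ hs.ne']
  have h3 : 0 < (ContinuousLinearMap.id ℝ E + s⁻¹ • M).det := by
    apply h
    rw [dist_eq_norm, add_sub_cancel_left, norm_smul, norm_inv, Real.norm_of_nonneg hs.le,
      inv_mul_lt_iff₀ hs]
    rw [div_lt_iff₀ hδ] at hsK
    linarith
  rw [h2]
  simp only [ContinuousLinearMap.det, ContinuousLinearMap.toLinearMap_smul, LinearMap.det_smul]
    at h3 ⊢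
  positivity

/-- The determinant of `M` is a fixed linear combination of the determinants of `s • 1 + M` for
finitely many large `s`, by Lagrange interpolation. -/
theorem exists_det_eq_sum_det_smul_id_add {p : ℝ → Prop} (hp : ∀ᶠ s in atTop, p s) :
    ∃ (t : Finset ℝ) (c : ℝ → ℝ), (∀ s ∈ t, p s) ∧ ∀ M : E →L[ℝ] E,
      M.det = ∑ s ∈ t, c s * (s • ContinuousLinearMap.id ℝ E + M).det := by
  have hinf : {s | p s}.Infinite := by
    obtain ⟨a, ha⟩ := eventually_atTop.1 hp
    exact (Ici_infinite a).mono ha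
  obtain ⟨t, ht, hcard⟩ := hinf.exists_subset_card_eq (Module.finrank ℝ E + 1)
  refine ⟨t, fun s ↦ (Lagrange.basis t id s).eval 0, ht, fun M ↦ ?_⟩
  have hdeg : (-(M : E →ₗ[ℝ] E)).charpoly.degree < t.card := by
    rw [Polynomial.degree_eq_natDegree (LinearMap.charpoly_monic _).ne_zero,
      LinearMap.charpoly_natDegree, hcard]
    exact_mod_cast Nat.lt_succ_self _
  have hev : ∀ s : ℝ, (-(M : E →ₗ[ℝ] E)).charpoly.eval s
      = (s • ContinuousLinearMap.id ℝ E + M).det := by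
    intro s
    rw [LinearMap.eval_charpoly, ContinuousLinearMap.det]
    congr 1
    ext x
    simp [Module.algebraMap_end_apply]
  have h := congrArg (Polynomial.eval 0)
    (Lagrange.eq_interpolate (s := t) (v := id) (injOn_id _) hdeg)
  rw [Lagrange.interpolate_apply, Polynomial.eval_finsetSum] at h
  simp only [hev, Polynomial.eval_mul, Polynomial.eval_C, zero_smul, zero_add, id] at h
  rw [h]
  exact Finset.sum_congr rfl fun _ _ ↦ mul_comm _ _

/-- The integral of the Jacobian determinant only depends on the boundary values: the determinant
is a null Lagrangian. -/
theorem setIntegral_det_fderiv_eq_of_eqOn_compl [MeasurableSpace E] [BorelSpace E]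
    (μ : Measure E) [μ.IsAddHaarMeasure] {A B : E → E} {K K' : NNReal}
    (hA : ContDiff ℝ 1 A) (hB : ContDiff ℝ 1 B) (hAK : LipschitzWith K A)
    (hBK : LipschitzWith K' B) {Q : Set E} (hQ : IsCompact Q) (h : EqOn A B Qᶜ) :
    ∫ x in Q, (fderiv ℝ A x).det ∂μ = ∫ x in Q, (fderiv ℝ B x).det ∂μ := by
  have hint : ∀ C : E → E, ContDiff ℝ 1 C → ∀ s : ℝ, IntegrableOn
      (fun x ↦ (s • ContinuousLinearMap.id ℝ E + fderiv ℝ C x).det) Q μ := by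
    intro C hC s
    exact (ContinuousLinearMap.continuous_det.comp (continuous_const.add
      (hC.continuous_fderiv one_ne_zero))).continuousOn.integrableOn_compact hQ
  have hvol : ∀ (C : E → E) (L : NNReal), ContDiff ℝ 1 C → LipschitzWith L C → ∀ s : ℝ, L < s →
      (∀ M : E →L[ℝ] E, ‖M‖ ≤ L → 0 < (s • ContinuousLinearMap.id ℝ E + M).det) →
      ∫ x in Q, (s • ContinuousLinearMap.id ℝ E + fderiv ℝ C x).det ∂μ
        = μ.real ((fun x ↦ s • x + C x) '' Q) := by
    intro C L hC hL s hs hpos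
    have h1 := integral_image_eq_integral_abs_det_fderiv_smul μ hQ.measurableSet
      (f := fun x ↦ s • x + C x)
      (f' := fun x ↦ s • ContinuousLinearMap.id ℝ E + fderiv ℝ C x)
      (fun x _ ↦ (((hasFDerivAt_id x).const_smul s).add
        (hC.differentiable one_ne_zero x).hasFDerivAt).hasFDerivWithinAt)
      (hL.bijective_smul_add hs).injective.injOn (fun _ ↦ (1 : ℝ))
    rw [setIntegral_const, smul_eq_mul, mul_one] at h1
    rw [h1]
    refine setIntegral_congr_fun hQ.measurableSet fun x _ ↦ ?_
    simp only [smul_eq_mul, mul_one]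
    exact (abs_of_pos (hpos _ (norm_fderiv_le_of_lipschitz ℝ hL))).symm
  obtain ⟨t, c, ht, hdet⟩ := exists_det_eq_sum_det_smul_id_add (E := E)
    ((eventually_gt_atTop (K : ℝ)).and <| (eventually_gt_atTop (K' : ℝ)).and <|
      (eventually_det_smul_id_add_pos (E := E) K).and (eventually_det_smul_id_add_pos (E := E) K'))
  rw [funext fun x ↦ hdet (fderiv ℝ A x), funext fun x ↦ hdet (fderiv ℝ B x)]
  rw [integral_finsetSum _ fun s _ ↦ (hint A hA s).const_mul _,
    integral_finsetSum _ fun s _ ↦ (hint B hB s).const_mul _]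
  refine Finset.sum_congr rfl fun s hs ↦ ?_
  obtain ⟨h1, h2, h3, h4⟩ := ht s hs
  rw [integral_const_mul, integral_const_mul, hvol A K hA hAK s h1 h3, hvol B K' hB hBK s h2 h4]
  congr 2
  rw [← compl_inj_iff, ← image_compl_eq (hAK.bijective_smul_add h1),
    ← image_compl_eq (hBK.bijective_smul_add h2)]
  exact image_congr fun x hx ↦ by rw [h hx]

/-- Near a regular value `y`, the integral of `φ ∘ G` against the Jacobian determinant is the
signed count of the preimages of `y` times the integral of `φ`. -/
theorem exists_nhds_integral_comp_mul_det_fderiv [MeasurableSpace E] [BorelSpace E]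
    (μ : Measure E) [μ.IsAddHaarMeasure] {G : E → E} (hG : ContDiff ℝ 1 G) (hGp : IsProperMap G)
    {y : E} (hy : ∀ x, G x = y → (fderiv ℝ G x).det ≠ 0) :
    ∃ (S : Finset E) (ε : E → ℤ), (∀ x, x ∈ S ↔ G x = y) ∧ (∀ x, ε x = 1 ∨ ε x = -1) ∧
      ∃ V ∈ 𝓝 y, ∀ φ : E → ℝ, Continuous φ → HasCompactSupport φ → Function.support φ ⊆ V →
        ∫ x, φ (G x) * (fderiv ℝ G x).det ∂μ = (∑ x ∈ S, ε x : ℤ) * ∫ z, φ z ∂μ := by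
  have hGd : Differentiable ℝ G := hG.differentiable one_ne_zero
  have hdetc : Continuous fun x ↦ (fderiv ℝ G x).det :=
    ContinuousLinearMap.continuous_det.comp (hG.continuous_fderiv one_ne_zero)
  have hstrict : ∀ x, (hx : G x = y) → HasStrictFDerivAt G
      (((fderiv ℝ G x).toContinuousLinearEquivOfDetNeZero (hy x hx) : E ≃L[ℝ] E) : E →L[ℝ] E) x :=
    fun x hx ↦ by simpa using hG.contDiffAt.hasStrictFDerivAt one_ne_zero
  have hloc : ∀ x, G x = y → ∃ U, IsOpen U ∧ x ∈ U ∧ InjOn G U ∧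
      ∀ z ∈ U, 0 < (fderiv ℝ G x).det * (fderiv ℝ G z).det := by
    intro x hx
    have h1 : IsOpen {z | 0 < (fderiv ℝ G x).det * (fderiv ℝ G z).det} :=
      isOpen_lt continuous_const (continuous_const.mul hdetc)
    refine ⟨((hstrict x hx).toOpenPartialHomeomorph G).source ∩ _,
      ((hstrict x hx).toOpenPartialHomeomorph G).open_source.inter h1,
      ⟨(hstrict x hx).mem_toOpenPartialHomeomorph_source, ?_⟩,
      ((hstrict x hx).toOpenPartialHomeomorph G).injOn.mono inter_subset_left,
      fun z hz ↦ hz.2⟩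
    exact mul_self_pos.2 (hy x hx)
  have hfin : (G ⁻¹' {y}).Finite := by
    refine (hGp.isCompact_preimage isCompact_singleton).finite ?_
    rw [isDiscrete_iff_forall_mem_exists_isOpen]
    intro x hx
    obtain ⟨U, hU, hxU, hinj, -⟩ := hloc x hx
    refine ⟨U, hU, ?_⟩
    ext z
    simp only [mem_inter_iff, mem_preimage, mem_singleton_iff]
    exact ⟨fun hz ↦ hinj hz.1 hxU (hz.2.trans hx.symm), fun hz ↦ hz ▸ ⟨hxU, hx⟩⟩
  obtain ⟨W, hW, hWd⟩ := hfin.t2_separation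
  choose! U hUo hxU hinj hpos using hloc
  set S := hfin.toFinset with hS
  have hmem : ∀ x, x ∈ S ↔ G x = y := fun x ↦ by simp [hS]
  set T : E → Set E := fun x ↦ U x ∩ W x
  have hTo : ∀ x ∈ S, IsOpen (T x) := fun x hx ↦ (hUo x ((hmem x).1 hx)).inter (hW x).2
  have hTx : ∀ x ∈ S, x ∈ T x := fun x hx ↦ ⟨hxU x ((hmem x).1 hx), (hW x).1⟩
  have hTd : (S : Set E).PairwiseDisjoint T := fun a ha b hb hab ↦
    (hWd (by simpa [hS] using ha) (by simpa [hS] using hb) hab).mono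
      inter_subset_right inter_subset_right
  refine ⟨S, fun x ↦ if 0 < (fderiv ℝ G x).det then 1 else -1, hmem,
    fun x ↦ by dsimp only; split_ifs <;> simp,
    (⋂ x ∈ S, G '' T x) ∩ {z | ∀ x, G x = z → x ∈ ⋃ a ∈ S, T a}, ?_, ?_⟩
  · refine inter_mem ((biInter_finset_mem S).2 fun x hx ↦ ?_) ?_
    · have h1 := (hstrict x ((hmem x).1 hx)).map_nhds_eq_of_equiv
      rw [(hmem x).1 hx] at h1
      rw [← h1]
      exact image_mem_map ((hTo x hx).mem_nhds (hTx x hx))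
    · refine hGp.isClosedMap.eventually_nhds_fiber y fun x hx ↦ ?_
      have hx' : x ∈ S := (hmem x).2 hx
      exact mem_of_superset ((hTo x hx').mem_nhds (hTx x hx')) (subset_biUnion_of_mem (u := T) hx')
  · intro φ hφ hφc hφV
    have hint : Integrable (fun x ↦ φ (G x) * (fderiv ℝ G x).det) μ := by
      refine Continuous.integrable_of_hasCompactSupport ((hφ.comp hG.continuous).mul hdetc) ?_
      refine HasCompactSupport.intro (hGp.isCompact_preimage hφc) fun x hx ↦ ?_
      rw [image_eq_zero_of_notMem_tsupport hx, zero_mul]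
    rw [← setIntegral_eq_integral_of_forall_compl_eq_zero (s := ⋃ a ∈ S, T a),
      integral_biUnion_finset S (fun x hx ↦ (hTo x hx).measurableSet) hTd
        fun _ _ ↦ hint.integrableOn]
    · push_cast
      rw [Finset.sum_mul]
      refine Finset.sum_congr rfl fun x hx ↦ ?_
      have hx' := (hmem x).1 hx
      have h1 := integral_image_eq_integral_abs_det_fderiv_smul μ (hTo x hx).measurableSet
        (fun z _ ↦ (hGd z).hasFDerivAt.hasFDerivWithinAt)
        ((hinj x hx').mono inter_subset_left) φ
      rw [setIntegral_eq_integral_of_forall_compl_eq_zero] at h1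
      · rw [h1, ← integral_const_mul]
        refine setIntegral_congr_fun (hTo x hx).measurableSet fun z hz ↦ ?_
        have h2 := hpos x hx' z hz.1
        simp only [smul_eq_mul]
        split_ifs with h3
        · rw [abs_of_pos ((mul_pos_iff_of_pos_left h3).1 h2)]
          ring
        · have h4 : (fderiv ℝ G z).det < 0 := by
            by_contra h5
            exact absurd h2 (not_lt.2 (mul_nonpos_of_nonpos_of_nonneg (not_lt.1 h3) (not_lt.1 h5)))
          rw [abs_of_neg h4]
          ring
      · intro z hz
        by_contra h2
        exact hz (mem_iInter₂.1 (hφV h2).1 x hx)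
    · intro x hx
      by_contra h2
      exact hx ((hφV (left_ne_zero_of_mul h2)).2 x rfl)

/-- There are Lipschitz `C¹` maps whose Jacobian determinant has positive integral and support in a
given neighbourhood of a point. -/
theorem exists_lipschitzWith_det_fderiv_support_subset {n : ℕ} (y : EuclideanSpace ℝ (Fin n))
    {V : Set (EuclideanSpace ℝ (Fin n))} (hV : V ∈ 𝓝 y) :
    ∃ (H : EuclideanSpace ℝ (Fin n) → EuclideanSpace ℝ (Fin n)) (K : NNReal),
      ContDiff ℝ 1 H ∧ LipschitzWith K H ∧ HasCompactSupport (fun x ↦ (fderiv ℝ H x).det) ∧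
      Function.support (fun x ↦ (fderiv ℝ H x).det) ⊆ V ∧ 0 < ∫ x, (fderiv ℝ H x).det := by
  have hcont : Continuous (WithLp.toLp 2 : (Fin n → ℝ) → EuclideanSpace ℝ (Fin n)) :=
    PiLp.continuous_toLp 2 _
  obtain ⟨δ, hδ, hball⟩ := Metric.mem_nhds_iff.1
    (hcont.continuousAt.preimage_mem_nhds (x := WithLp.ofLp y) hV)
  let β : Fin n → ℝ → ℝ := fun i t ↦ max 0 (δ - |t - y i|)
  have hβ : ∀ i, Continuous (β i) := fun i ↦ by fun_prop
  let ψ : Fin n → ℝ → ℝ := fun i t ↦ ∫ u in (0 : ℝ)..t, β i u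
  have hψ : ∀ i t, HasDerivAt (ψ i) (β i t) t := fun i t ↦
    ((hβ i).integral_hasStrictDerivAt 0 t).hasDerivAt
  have hψC : ∀ i, ContDiff ℝ 1 (ψ i) := fun i ↦ contDiff_one_iff_deriv.2
    ⟨fun t ↦ (hψ i t).differentiableAt, by rw [funext fun t ↦ (hψ i t).deriv]; exact hβ i⟩
  have hψL : ∀ i, LipschitzWith δ.toNNReal (ψ i) := fun i ↦ by
    refine lipschitzWith_of_nnnorm_deriv_le (fun t ↦ (hψ i t).differentiableAt) fun t ↦ ?_
    rw [(hψ i t).deriv, ← NNReal.coe_le_coe, coe_nnnorm, Real.coe_toNNReal _ hδ.le,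
      Real.norm_of_nonneg (le_max_left _ _)]
    exact max_le hδ.le (by linarith [abs_nonneg (t - y i)])
  let H : EuclideanSpace ℝ (Fin n) → EuclideanSpace ℝ (Fin n) :=
    fun x ↦ WithLp.toLp 2 fun i ↦ ψ i (x i)
  have hHC : ContDiff ℝ 1 H := contDiff_euclidean.2 fun i ↦ (hψC i).comp (by fun_prop)
  have hdet : ∀ x, (fderiv ℝ H x).det = ∏ i, β i (x i) := fun x ↦ by
    have h1 : ∀ i v, (fderiv ℝ H x v) i = β i (x i) * v i := fun i v ↦ by
      have h2 := (hasStrictFDerivAt_euclidean.1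
        (hHC.contDiffAt.hasStrictFDerivAt one_ne_zero (x := x)) i).hasFDerivAt
      have h3 := (hψ i (x i)).comp_hasFDerivAt x
        (EuclideanSpace.proj (𝕜 := ℝ) i).hasFDerivAt
      simpa using congrArg (fun L ↦ L v) (h2.unique h3)
    rw [ContinuousLinearMap.det,
      ← LinearMap.det_toMatrix (EuclideanSpace.basisFun (Fin n) ℝ).toBasis, ← Matrix.det_diagonal]
    congr 1
    ext i j
    simp [LinearMap.toMatrix_apply, h1, Matrix.diagonal_apply]
  have hsupp : ∀ x : EuclideanSpace ℝ (Fin n), (fderiv ℝ H x).det ≠ 0 →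
      WithLp.ofLp x ∈ Metric.ball (WithLp.ofLp y) δ := fun x hx ↦ by
    rw [hdet, Finset.prod_ne_zero_iff] at hx
    rw [Metric.mem_ball, dist_pi_lt_iff hδ]
    intro i
    by_contra h1
    exact hx i (Finset.mem_univ i) (max_eq_left (sub_nonpos.2 (not_lt.1 h1)))
  have hcomp : HasCompactSupport (fun x ↦ (fderiv ℝ H x).det) :=
    HasCompactSupport.intro ((isCompact_closedBall (WithLp.ofLp y) δ).image hcont) fun x hx ↦ by
      by_contra h1
      exact hx ⟨WithLp.ofLp x, Metric.ball_subset_closedBall (hsupp x h1), rfl⟩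
  have hHL : LipschitzWith δ.toNNReal fun (x : EuclideanSpace ℝ (Fin n)) i ↦ ψ i (x i) := by
    refine LipschitzWith.of_dist_le_mul fun x z ↦ (dist_pi_le_iff (by positivity)).2 fun i ↦ ?_
    refine ((hψL i).dist_le_mul _ _).trans (mul_le_mul_of_nonneg_left ?_ (by positivity))
    rw [dist_eq_norm, dist_eq_norm]
    exact PiLp.norm_apply_le (x - z) i
  refine ⟨H, _, hHC, (PiLp.lipschitzWith_toLp 2 fun _ : Fin n ↦ ℝ).comp hHL, hcomp,
    fun x hx ↦ hball (hsupp x hx), ?_⟩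
  refine Continuous.integral_pos_of_hasCompactSupport_nonneg_nonzero (x := y) ?_ hcomp ?_ ?_
  · exact ContinuousLinearMap.continuous_det.comp (hHC.continuous_fderiv one_ne_zero)
  · intro x
    simp only [hdet]
    exact Finset.prod_nonneg fun i _ ↦ le_max_left _ _
  · simp [hdet, β, hδ.le, hδ.ne']

/-- A `C¹` self-map of `ℝⁿ` which is the identity near infinity and has no zero outside the open
unit ball is not even on the closed unit ball: its degree at a regular value near `0` is one, while
evenness would pair up the preimages. -/
theorem exists_norm_le_one_apply_neg_ne {n : ℕ} (hn : 1 ≤ n)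
    {G : EuclideanSpace ℝ (Fin n) → EuclideanSpace ℝ (Fin n)} (hG : ContDiff ℝ 1 G) {R : ℝ}
    (hGid : ∀ x, R ≤ ‖x‖ → G x = x) (hG0 : ∀ x, 1 ≤ ‖x‖ → G x ≠ 0) :
    ∃ x, ‖x‖ ≤ 1 ∧ G (-x) ≠ G x := by
  by_contra! heven
  have : Nonempty (Fin n) := ⟨⟨0, hn⟩⟩
  have hGd : Differentiable ℝ G := hG.differentiable one_ne_zero
  have hGprop : IsProperMap G := by
    refine isProperMap_iff_tendsto_cocompact.2 ⟨hG.continuous, tendsto_id.congr' ?_⟩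
    filter_upwards [tendsto_norm_cocompact_atTop.eventually_ge_atTop R] with x hx
    exact (hGid x hx).symm
  have hGsub : HasCompactSupport fun x ↦ G x - x :=
    HasCompactSupport.intro (isCompact_closedBall 0 R) fun x hx ↦ by
      rw [hGid x (by simpa using (not_le.1 (mt mem_closedBall_zero_iff.2 hx)).le), sub_self]
  obtain ⟨K, hK⟩ := (hG.sub contDiff_id).lipschitzWith_of_hasCompactSupport hGsub one_ne_zero
  have hGL : LipschitzWith (K + 1) G := by
    simpa using hK.add LipschitzWith.id
  -- By the Sard theorem there is a regular value `y` close to `0`.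
  set V₀ : Set (EuclideanSpace ℝ (Fin n)) := (G '' {x | 1 ≤ ‖x‖})ᶜ
  have hV₀ : IsOpen V₀ :=
    (hGprop.isClosedMap _ (isClosed_le continuous_const continuous_norm)).isOpen_compl
  have h0V₀ : (0 : EuclideanSpace ℝ (Fin n)) ∈ V₀ := fun ⟨x, hx, hx0⟩ ↦ hG0 x hx hx0
  have hnull : volume (G '' {x | (fderiv ℝ G x).det = 0} ∪ {G 0}) = 0 := by
    refine measure_union_null ?_ (measure_singleton _)
    exact addHaar_image_eq_zero_of_det_fderivWithin_eq_zero volume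
      (fun x _ ↦ (hGd x).hasFDerivAt.hasFDerivWithinAt) fun x hx ↦ hx
  obtain ⟨y, hyV₀, hy⟩ : ∃ y ∈ V₀, y ∉ G '' {x | (fderiv ℝ G x).det = 0} ∪ {G 0} := by
    by_contra! h
    exact (hV₀.measure_pos volume ⟨0, h0V₀⟩).ne' (measure_mono_null h hnull)
  obtain ⟨S, ε, hS, hε, V, hV, hint⟩ := exists_nhds_integral_comp_mul_det_fderiv volume hG hGprop
    (y := y) fun x hx hx0 ↦ hy (Or.inl ⟨x, hx0, hx⟩)
  obtain ⟨H, L, hH, hHL, hHc, hHV, hHpos⟩ := exists_lipschitzWith_det_fderiv_support_subset y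
    (inter_mem hV (hV₀.mem_nhds hyV₀))
  have hHd : Continuous fun x ↦ (fderiv ℝ H x).det :=
    ContinuousLinearMap.continuous_det.comp (hH.continuous_fderiv one_ne_zero)
  have hdeg := hint _ hHd hHc (hHV.trans inter_subset_left)
  -- The degree is one.
  obtain ⟨R', hR'⟩ := hHc.isCompact.isBounded.subset_closedBall 0
  have hR'0 : ∀ x, max R (max 1 R') < ‖x‖ → (fderiv ℝ H x).det = 0 := fun x hx ↦
    image_eq_zero_of_notMem_tsupport (f := fun x ↦ (fderiv ℝ H x).det) fun h ↦ by
      have h1 := mem_closedBall_zero_iff.1 (hR' h)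
      simp only [max_lt_iff] at hx
      linarith
  have hcomp : ∀ x, (fderiv ℝ (H ∘ G) x).det = (fderiv ℝ H (G x)).det * (fderiv ℝ G x).det := by
    intro x
    rw [fderiv_comp x (hH.differentiable one_ne_zero _) (hGd x)]
    exact LinearMap.det_comp _ _
  have hone := setIntegral_det_fderiv_eq_of_eqOn_compl volume (hH.comp hG) hH (hHL.comp hGL) hHL
    (isCompact_closedBall 0 (max R (max 1 R'))) fun x hx ↦ by
      rw [mem_compl_iff, mem_closedBall_zero_iff, not_le] at hx
      rw [Function.comp_apply, hGid x ((le_max_left _ _).trans hx.le)]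
  rw [setIntegral_eq_integral_of_forall_compl_eq_zero,
    setIntegral_eq_integral_of_forall_compl_eq_zero, funext hcomp, hdeg] at hone
  rotate_left
  · intro x hx
    rw [mem_closedBall_zero_iff, not_le] at hx
    exact hR'0 x hx
  · intro x hx
    rw [mem_closedBall_zero_iff, not_le] at hx
    rw [hcomp, hGid x ((le_max_left _ _).trans hx.le), hR'0 x hx, zero_mul]
  have hsum : ∑ x ∈ S, ε x = 1 := by
    have := mul_right_cancel₀ hHpos.ne' (hone.trans (one_mul _).symm)
    exact_mod_cast this
  -- The degree is even.
  have hSball : ∀ x ∈ S, ‖x‖ ≤ 1 := fun x hx ↦ by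
    by_contra h
    exact hyV₀ ⟨x, (not_le.1 h).le, (hS x).1 hx⟩
  have hcast : ∀ x, (ε x : ZMod 2) = 1 := fun x ↦ by
    rcases hε x with h | h <;> rw [h] <;> decide
  have hpar : ∑ x ∈ S, (ε x : ZMod 2) = 0 := by
    refine Finset.sum_involution (fun x _ ↦ -x) (fun x _ ↦ ?_) (fun x hx _ h ↦ ?_)
      (fun x hx ↦ ?_) fun x _ ↦ neg_neg x
    · rw [hcast, hcast]; decide
    · have hx0 : x = 0 := by
        refine (smul_eq_zero_iff_right (two_ne_zero (α := ℝ))).1 ?_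
        rw [two_smul]
        nth_rw 1 [← h]
        exact neg_add_cancel x
      exact hy (Or.inr (by rw [mem_singleton_iff, ← (hS x).1 hx, hx0]))
    · rw [hS, heven x (hSball x hx), (hS x).1 hx]
  have h := congrArg (Int.cast : ℤ → ZMod 2) hsum
  rw [Int.cast_sum, hpar] at h
  exact absurd h (by decide)

/-- An even continuous vector field on `ℝⁿ` is radial somewhere outside the open unit ball. -/
theorem exists_one_le_norm_mem_span_of_even {n : ℕ} (hn : 1 ≤ n)
    {F : EuclideanSpace ℝ (Fin n) → EuclideanSpace ℝ (Fin n)} (hF : Continuous F)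
    (heven : ∀ x, F (-x) = F x) : ∃ x, 1 ≤ ‖x‖ ∧ F x ∈ Submodule.span ℝ {x} := by
  by_contra! hrad
  let P : EuclideanSpace ℝ (Fin n) → EuclideanSpace ℝ (Fin n) → EuclideanSpace ℝ (Fin n) :=
    fun x v ↦ ‖x‖ ^ 2 • v - inner ℝ x v • x
  have hP0 : ∀ x, 1 ≤ ‖x‖ → P x (F x) ≠ 0 := fun x hx h ↦ by
    refine hrad x hx (Submodule.mem_span_singleton.2 ⟨(‖x‖ ^ 2)⁻¹ * inner ℝ x (F x), ?_⟩)
    rw [mul_smul, ← sub_eq_zero.1 h, inv_smul_smul₀ (by positivity)]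
  have hPsmul : ∀ x (c : ℝ), P x (c • x) = 0 := fun x c ↦ by
    simp only [P, inner_smul_right, real_inner_self_eq_norm_sq, smul_smul]
    rw [mul_comm, sub_self]
  have hPsub : ∀ x v w, P x (v - w) = P x v - P x w := fun x v w ↦ by
    simp only [P, inner_sub_right]; module
  have hPle : ∀ x v, ‖P x v‖ ≤ 2 * ‖x‖ ^ 2 * ‖v‖ := fun x v ↦ by
    refine (norm_sub_le _ _).trans ?_
    rw [norm_smul, norm_smul, norm_pow, norm_norm]
    nlinarith [norm_inner_le_norm (𝕜 := ℝ) x v, norm_nonneg x]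
  let ε : EuclideanSpace ℝ (Fin n) → ℝ :=
    fun x ↦ ‖P x (F x)‖ / (4 * (1 + ‖x‖ ^ 2)) + max 0 (1 - ‖x‖)
  have hPc : Continuous fun x ↦ P x (F x) := by fun_prop
  have hεc : Continuous ε := by
    refine (hPc.norm.div (by fun_prop) fun x ↦ by positivity).add (by fun_prop)
  have hεpos : ∀ x, 0 < ε x := fun x ↦ by
    rcases lt_or_ge ‖x‖ 1 with h | h
    · exact add_pos_of_nonneg_of_pos (by positivity) (lt_max_of_lt_right (sub_pos.2 h))
    · exact add_pos_of_pos_of_nonneg (div_pos (norm_pos_iff.2 (hP0 x h)) (by positivity))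
        (le_max_left _ _)
  have hεeven : ∀ x, ε (-x) = ε x := fun x ↦ by
    simp only [ε, P, heven, norm_neg, inner_neg_left, neg_smul, smul_neg, neg_neg]
  obtain ⟨f₀, hf₀, hf₀F, -⟩ := hF.exists_contDiff_approx 1 hεc hεpos
  let f : EuclideanSpace ℝ (Fin n) → EuclideanSpace ℝ (Fin n) :=
    fun x ↦ (2 : ℝ)⁻¹ • (f₀ x + f₀ (-x))
  have hf : ContDiff ℝ 1 f := (hf₀.add (hf₀.comp contDiff_neg)).const_smul (2 : ℝ)⁻¹
  have hfeven : ∀ x, f (-x) = f x := fun x ↦ by simp only [f, neg_neg, add_comm]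
  have hfF : ∀ x, ‖F x - f x‖ < ε x := fun x ↦ by
    have h1 := hf₀F x
    have h2 := hf₀F (-x)
    rw [hεeven, heven] at h2
    rw [dist_comm, dist_eq_norm] at h1 h2
    have h3 : F x - f x = (2 : ℝ)⁻¹ • ((F x - f₀ x) + (F x - f₀ (-x))) := by
      simp only [f]; module
    rw [h3, norm_smul, Real.norm_of_nonneg (by norm_num)]
    linarith [norm_add_le (F x - f₀ x) (F x - f₀ (-x))]
  have hPf : ∀ x, 1 ≤ ‖x‖ → P x (f x) ≠ 0 := fun x hx h ↦ by
    have h1 := hPle x (F x - f x)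
    have h2 := hfF x
    rw [hPsub, h, sub_zero] at h1
    simp only [ε, max_eq_left (sub_nonpos.2 hx), add_zero] at h2
    rw [lt_div_iff₀ (by positivity)] at h2
    nlinarith [norm_nonneg (F x - f x), sq_nonneg ‖x‖]
  let b : ContDiffBump (0 : EuclideanSpace ℝ (Fin n)) := ⟨1, 2, one_pos, one_lt_two⟩
  obtain ⟨x, hx, hne⟩ := exists_norm_le_one_apply_neg_ne hn
    (G := fun x ↦ b x • f x + (1 - b x) • x) (R := 2)
    ((b.contDiff.smul hf).add ((contDiff_const.sub b.contDiff).smul contDiff_id))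
    (fun x hx ↦ by simp [b.zero_of_le_dist (x := x) (by simpa using hx)])
    fun x hx h ↦ by
      by_cases hb : b x = 0
      · rw [hb, zero_smul, zero_add, sub_zero, one_smul] at h
        rw [h, norm_zero] at hx
        linarith
      · refine hPf x hx ?_
        have h1 : f x = (-((b x)⁻¹ * (1 - b x))) • x := by
          rw [neg_smul, mul_smul, eq_neg_iff_add_eq_zero, ← smul_right_injective _ hb |>.eq_iff]
          simp only [smul_add, smul_inv_smul₀ hb, smul_zero, h]
        rw [h1, hPsmul]
  refine hne ?_
  have hb : ∀ z : EuclideanSpace ℝ (Fin n), ‖z‖ ≤ 1 → b z = 1 := fun z hz ↦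
    b.one_of_mem_closedBall (by simpa using hz)
  simp only [hb x hx, hb (-x) (by rwa [norm_neg]), hfeven, sub_self, zero_smul]

end

/-- The underlying space of a continuous unoriented Kakeya line configuration in `ℝ^n` contains
the origin. -/
theorem zero_mem_underlying_space (n : ℕ) (hn : 1 ≤ n)
    (σ : ℙ ℝ (EuclideanSpace ℝ (Fin n)) → EuclideanSpace ℝ (Fin n))
    (hσ : Continuous σ) :
    (0 : EuclideanSpace ℝ (Fin n)) ∈
      ⋃ L : ℙ ℝ (EuclideanSpace ℝ (Fin n)),
        {y : EuclideanSpace ℝ (Fin n) | ∃ x ∈ L.submodule, y = σ L + x} := by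
  let E := EuclideanSpace ℝ (Fin n)
  suffices h : ∃ L : ℙ ℝ E, σ L ∈ L.submodule by
    obtain ⟨L, hL⟩ := h
    exact Set.mem_iUnion.2 ⟨L, -σ L, L.submodule.neg_mem hL, (add_neg_cancel _).symm⟩
  classical
  let F₀ : E → E := fun x ↦ if hx : x = 0 then 0 else σ (Projectivization.mk ℝ x hx)
  have hF₀ : ContinuousOn F₀ {0}ᶜ := by
    rw [continuousOn_iff_continuous_domRestrict]
    have h1 : Continuous fun x : {x : E // x ≠ 0} ↦ σ (Projectivization.mk' ℝ x) :=
      hσ.comp continuous_quotient_mk'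
    exact h1.congr fun x ↦
      show σ (Projectivization.mk ℝ x x.2) = F₀ x by
        have hx : (x : E) ≠ 0 := x.2
        simp only [F₀, dif_neg hx]
  let F : E → E := fun x ↦ max 0 (‖x‖ - 1 / 2) • F₀ x
  have hF : Continuous F := by
    refine continuous_iff_continuousAt.2 fun x ↦ ?_
    rcases eq_or_ne x 0 with rfl | hx
    · refine (continuousAt_const (y := (0 : E))).congr ?_
      filter_upwards [Metric.ball_mem_nhds (0 : E) one_half_pos] with z hz
      rw [mem_ball_zero_iff] at hz
      simp only [F, max_eq_left (sub_nonpos.2 hz.le), zero_smul]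
    · exact ContinuousAt.smul (f := fun x ↦ max 0 (‖x‖ - 1 / 2)) (by fun_prop)
        (hF₀.continuousAt (isOpen_compl_singleton.mem_nhds hx))
  have heven : ∀ x, F (-x) = F x := fun x ↦ by
    rcases eq_or_ne x 0 with rfl | hx
    · rw [neg_zero]
    · have h1 : Projectivization.mk ℝ (-x) (neg_ne_zero.2 hx) = Projectivization.mk ℝ x hx :=
        (Projectivization.mk_eq_mk_iff' ℝ _ _ _ _).2 ⟨-1, by simp⟩
      simp only [F, F₀, norm_neg, dif_neg hx, dif_neg (neg_ne_zero.2 hx), h1]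
  obtain ⟨x, hx1, hx⟩ := exists_one_le_norm_mem_span_of_even hn hF heven
  have hx0 : x ≠ 0 := norm_pos_iff.1 (one_pos.trans_le hx1)
  refine ⟨Projectivization.mk ℝ x hx0, ?_⟩
  rw [Projectivization.submodule_mk]
  have hpos : max 0 (‖x‖ - 1 / 2) ≠ 0 := (lt_max_of_lt_right (by linarith)).ne'
  simpa only [F, F₀, dif_neg hx0, Submodule.smul_mem_iff _ hpos] using hx
end

section
/- Let n ≥ 1 and let σ : ℝP^{n-1} → ℝ^n be a continuous unoriented Kakeya line configuration. Then its underlying space is all of ℝ^n, i.e., ⋃_{L ∈ ℝP^{n-1}} (σ(L) + L) = ℝ^n. -/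
open LinearAlgebra.Projectivization

section KuhnTriangulation

/-- The `k`-th vertex of the simplex of the Kuhn triangulation with least vertex `p`, in which the
coordinate `i` is raised at step `τ i`. -/
def kuhnVertex {n : ℕ} (p : Fin n → ℕ) (τ : Equiv.Perm (Fin n)) (k : ℕ) : Fin n → ℕ :=
  fun i => p i + if (τ i : ℕ) < k then 1 else 0

/-- The mod 2 determinant detecting whether all labels `0, …, n` occur on a Kuhn simplex. -/
def kuhnDet {n : ℕ} (l : (Fin n → ℕ) → ℕ) (p : Fin n → ℕ) (τ : Equiv.Perm (Fin n)) : ZMod 2 :=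
  (Matrix.of fun i k : Fin (n + 1) =>
    if (i : ℕ) ≤ l (kuhnVertex p τ k) then (1 : ZMod 2) else 0).det

/-- The mod 2 determinant detecting whether all labels `1, …, n` occur on the facet opposite to
the `j`-th vertex of a Kuhn simplex. -/
def kuhnFacetDet {n : ℕ} (l : (Fin n → ℕ) → ℕ) (p : Fin n → ℕ) (τ : Equiv.Perm (Fin n))
    (j : Fin (n + 1)) : ZMod 2 :=
  (Matrix.of fun i k : Fin n =>
    if (i : ℕ) + 1 ≤ l (kuhnVertex p τ (j.succAbove k)) then (1 : ZMod 2) else 0).det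

lemma kuhnDet_eq_sum_kuhnFacetDet {n : ℕ} (l : (Fin n → ℕ) → ℕ) (p : Fin n → ℕ)
    (τ : Equiv.Perm (Fin n)) : kuhnDet l p τ = ∑ j, kuhnFacetDet l p τ j := by
  unfold kuhnDet
  rw [Matrix.det_succ_row_zero]
  refine Finset.sum_congr rfl fun j _ => ?_
  have h : (-1 : ZMod 2) = 1 := by decide
  simp [h, kuhnFacetDet]
  rfl

lemma sum_kuhnFacetDet_middle {n : ℕ} (l : (Fin (n + 1) → ℕ) → ℕ) (p : Fin (n + 1) → ℕ)
    (k : Fin n) :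
    ∑ τ : Equiv.Perm (Fin (n + 1)), kuhnFacetDet l p τ k.succ.castSucc = 0 := by
  have hne : k.castSucc ≠ k.succ := by simp [Fin.ext_iff]
  refine Finset.sum_involution (fun τ _ => Equiv.swap k.castSucc k.succ * τ) ?_ ?_ ?_ ?_
  · intro τ _
    have : kuhnFacetDet l p (Equiv.swap k.castSucc k.succ * τ) k.succ.castSucc
        = kuhnFacetDet l p τ k.succ.castSucc := by
      unfold kuhnFacetDet
      congr! 7 with i c
      ext i
      have hc : ((k.succ.castSucc.succAbove c : Fin (n + 2)) : ℕ) ≠ k + 1 := fun h =>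
        Fin.succAbove_ne k.succ.castSucc c (Fin.ext (by simpa using h))
      generalize ((k.succ.castSucc.succAbove c : Fin (n + 2)) : ℕ) = K at hc
      have : ((Equiv.swap k.castSucc k.succ (τ i) : Fin (n + 1)) : ℕ) < K ↔ (τ i : ℕ) < K := by
        rw [Equiv.swap_apply_def]
        split_ifs with h1 h2
        · simp [h1]; omega
        · simp [h2]; omega
        · rfl
      simp only [kuhnVertex, Equiv.Perm.mul_apply, this]
    rw [this]
    exact CharTwo.add_self_eq_zero _
  · intro τ _ _ h
    have := mul_eq_right.mp h
    exact hne (Equiv.swap_eq_one_iff.mp this)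
  · intro τ _; exact Finset.mem_univ _
  · intro τ _; simp [← mul_assoc]

lemma kuhnFacetDet_zero {n : ℕ} (l : (Fin (n + 1) → ℕ) → ℕ) (p : Fin (n + 1) → ℕ)
    (τ : Equiv.Perm (Fin (n + 1))) :
    kuhnFacetDet l p (finRotate (n + 1) * τ) 0 =
      kuhnFacetDet l (p + Pi.single (τ.symm (Fin.last n)) 1) τ (Fin.last (n + 1)) := by
  unfold kuhnFacetDet
  congr! 7 with i c
  ext i
  have hc := c.2
  have hrot : ((finRotate (n + 1) (τ i) : Fin (n + 1)) : ℕ) < (c : ℕ) + 1 ↔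
      τ i = Fin.last n ∨ (τ i : ℕ) < c := by
    rcases eq_or_ne (τ i) (Fin.last n) with h | h
    · rw [h, finRotate_last]; simp
    · rw [coe_finRotate_of_ne_last h]; simp [h]
  have hsymm : τ i = Fin.last n ↔ i = τ.symm (Fin.last n) := (Equiv.eq_symm_apply τ).symm
  simp only [kuhnVertex, Fin.succAbove_zero, Fin.succAbove_last, Equiv.Perm.mul_apply, Fin.val_succ,
    Fin.val_castSucc, Pi.add_apply, hrot, Pi.single_apply, ← hsymm]
  by_cases h : τ i = Fin.last n
  · simp [h]
    omega
  · simp [h]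

lemma kuhnFacetDet_last_of_coord_eq_zero {n : ℕ} (l : (Fin (n + 1) → ℕ) → ℕ)
    (h0 : ∀ x (i : Fin (n + 1)), x i = 0 → l x ≤ (i : ℕ)) (p : Fin (n + 1) → ℕ)
    (τ : Equiv.Perm (Fin (n + 1))) (hp : p (τ.symm (Fin.last n)) = 0) :
    kuhnFacetDet l p τ (Fin.last (n + 1)) = 0 := by
  refine Matrix.det_eq_zero_of_row_eq_zero (τ.symm (Fin.last n)) fun k => ?_
  have := h0 (kuhnVertex p τ ((Fin.last (n + 1)).succAbove k)) (τ.symm (Fin.last n))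
    (by simp [kuhnVertex, hp]; omega)
  simp only [Matrix.of_apply]
  rw [if_neg (by omega)]

lemma kuhnFacetDet_last_of_coord_eq_top {n N : ℕ} (l : (Fin (n + 1) → ℕ) → ℕ)
    (h1 : ∀ x (i : Fin (n + 1)), x i = N → l x ≠ (i : ℕ)) (p : Fin (n + 1) → ℕ)
    (τ : Equiv.Perm (Fin (n + 1))) (hp : p (τ.symm (Fin.last n)) = N)
    (hτ : τ.symm (Fin.last n) ≠ 0) :
    kuhnFacetDet l p τ (Fin.last (n + 1)) = 0 := by
  obtain ⟨i, hi⟩ := Fin.exists_succ_eq.mpr hτ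
  have hne : i.castSucc ≠ i.succ := by simp [Fin.ext_iff]
  refine Matrix.det_zero_of_row_eq hne ?_
  ext k
  have := h1 (kuhnVertex p τ ((Fin.last (n + 1)).succAbove k)) (τ.symm (Fin.last n))
    (by simp [kuhnVertex, hp]; omega)
  rw [← hi] at this
  simp only [Matrix.of_apply, Fin.val_castSucc, Fin.val_succ] at this ⊢
  congr 1
  simp only [eq_iff_iff]
  omega

/-- Extend a permutation of `Fin n` to one of `Fin (n + 1)` sending `0` to the last element. -/
def permConsLast {n : ℕ} (τ : Equiv.Perm (Fin n)) : Equiv.Perm (Fin (n + 1)) :=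
  (finRotate (n + 1)).symm * Equiv.Perm.decomposeFin.symm (0, τ)

lemma permConsLast_zero {n : ℕ} (τ : Equiv.Perm (Fin n)) : permConsLast τ 0 = Fin.last n := by
  rw [permConsLast, Equiv.Perm.mul_apply, Equiv.symm_apply_eq]
  simp

lemma permConsLast_succ {n : ℕ} (τ : Equiv.Perm (Fin n)) (i : Fin n) :
    permConsLast τ i.succ = (τ i).castSucc := by
  rw [permConsLast, Equiv.Perm.mul_apply, Equiv.symm_apply_eq]
  simp

lemma permConsLast_injective {n : ℕ} : Function.Injective (permConsLast (n := n)) := by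
  intro a b h
  simpa [permConsLast] using h

lemma exists_permConsLast_eq {n : ℕ} (τ : Equiv.Perm (Fin (n + 1))) (h : τ 0 = Fin.last n) :
    ∃ τ', permConsLast τ' = τ := by
  refine ⟨(Equiv.Perm.decomposeFin (finRotate (n + 1) * τ)).2, ?_⟩
  have : (Equiv.Perm.decomposeFin (finRotate (n + 1) * τ)).1 = 0 := by
    simp [Equiv.Perm.decomposeFin, h]
  rw [permConsLast, ← this, Prod.mk.eta, Equiv.symm_apply_apply]
  ext; simp

lemma kuhnFacetDet_permConsLast {n N : ℕ} (l : (Fin (n + 1) → ℕ) → ℕ)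
    (h1 : ∀ x (i : Fin (n + 1)), x i = N → l x ≠ (i : ℕ)) (p : Fin n → ℕ) (τ : Equiv.Perm (Fin n)) :
    kuhnFacetDet l (Fin.cons N p) (permConsLast τ) (Fin.last (n + 1)) =
      kuhnDet (fun x => l (Fin.cons N x) - 1) p τ := by
  unfold kuhnFacetDet kuhnDet
  congr 2
  ext i k
  have : kuhnVertex (Fin.cons N p) (permConsLast τ) ((Fin.last (n + 1)).succAbove k) =
      (Fin.cons N (kuhnVertex p τ k) : Fin (n + 1) → ℕ) := by
    ext i
    have hk := k.2
    refine Fin.cases ?_ (fun i => ?_) i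
    · simp [kuhnVertex, permConsLast_zero]; omega
    · simp [kuhnVertex, permConsLast_succ]
  rw [this]
  have := h1 (Fin.cons N (kuhnVertex p τ k)) 0 rfl
  congr 1
  simp at this ⊢
  omega

/-- Sum of `kuhnDet` over all simplices of the Kuhn triangulation of the cube `[0, N]^n`. -/
def kuhnSum {n : ℕ} (N : ℕ) (l : (Fin n → ℕ) → ℕ) : ZMod 2 :=
  ∑ p : Fin n → Fin N, ∑ τ : Equiv.Perm (Fin n), kuhnDet l (fun i => p i) τ

lemma sum_add_single_add {n N : ℕ} (i : Fin (n + 1)) (H : (Fin (n + 1) → ℕ) → ZMod 2) :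
    ∑ p : Fin (n + 1) → Fin N, (H ((fun i => (p i : ℕ)) + Pi.single i 1) + H (fun i => p i)) =
      ∑ p : Fin n → Fin N, (H (i.insertNth N fun i => (p i : ℕ)) +
        H (i.insertNth 0 fun i => (p i : ℕ))) := by
  rw [← (Fin.insertNthEquiv (fun _ => Fin N) i).sum_comp, Fintype.sum_prod_type_right]
  refine Finset.sum_congr rfl fun p _ => ?_
  have e1 : ∀ a : Fin N, (fun j => ((Fin.insertNthEquiv (fun _ => Fin N) i (a, p) j : Fin N) : ℕ))
      = i.insertNth (a : ℕ) fun j => (p j : ℕ) := by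
    intro a
    ext j
    refine Fin.succAboveCases i ?_ (fun j => ?_) j <;> simp
  have e2 : ∀ a : ℕ, (i.insertNth a fun j => (p j : ℕ) : Fin (n + 1) → ℕ) + Pi.single i 1
      = i.insertNth (a + 1) fun j => (p j : ℕ) := by
    intro a
    ext j
    refine Fin.succAboveCases i ?_ (fun j => ?_) j <;> simp
  simp only [e1, e2]
  rw [Fin.sum_univ_eq_sum_range (fun a => H (i.insertNth (a + 1) fun j => (p j : ℕ)) +
    H (i.insertNth a fun j => (p j : ℕ)))]
  simp only [← CharTwo.sub_eq_add]
  rw [Finset.sum_range_sub (fun a => H (i.insertNth a fun j => (p j : ℕ)))]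

lemma kuhnSum_succ {n N : ℕ} (l : (Fin (n + 1) → ℕ) → ℕ)
    (h0 : ∀ x (i : Fin (n + 1)), x i = 0 → l x ≤ (i : ℕ))
    (h1 : ∀ x (i : Fin (n + 1)), x i = N → l x ≠ (i : ℕ)) :
    kuhnSum N l = kuhnSum N fun x : Fin n → ℕ => l (Fin.cons N x) - 1 := by
  have key : ∀ p : Fin (n + 1) → ℕ, ∑ τ, kuhnDet l p τ =
      ∑ τ : Equiv.Perm (Fin (n + 1)),
        (kuhnFacetDet l (p + Pi.single (τ.symm (Fin.last n)) 1) τ (Fin.last (n + 1)) +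
          kuhnFacetDet l p τ (Fin.last (n + 1))) := by
    intro p
    simp only [kuhnDet_eq_sum_kuhnFacetDet, Fin.sum_univ_castSucc (n := n + 1),
      Fin.sum_univ_succ (n := n), Finset.sum_add_distrib]
    congr 1
    rw [Finset.sum_comm, Finset.sum_eq_zero fun k _ => sum_kuhnFacetDet_middle l p k, add_zero]
    rw [← Equiv.sum_comp (Equiv.mulLeft (finRotate (n + 1)))
      fun τ => kuhnFacetDet l p τ (Fin.castSucc 0)]
    exact Finset.sum_congr rfl fun τ _ => kuhnFacetDet_zero l p τ
  unfold kuhnSum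
  simp only [key]
  rw [Finset.sum_comm]
  rw [Finset.sum_congr rfl fun τ _ => sum_add_single_add (N := N) (τ.symm (Fin.last n))
    fun p => kuhnFacetDet l p τ (Fin.last (n + 1))]
  rw [Finset.sum_comm (s := (Finset.univ : Finset (Fin n → Fin N)))]
  symm
  refine Finset.sum_of_injOn permConsLast permConsLast_injective.injOn (by simp) ?_ ?_
  · intro τ _ hτ
    refine Finset.sum_eq_zero fun p _ => ?_
    rw [kuhnFacetDet_last_of_coord_eq_zero l h0 (Fin.insertNth _ 0 _) τ (by simp),
      kuhnFacetDet_last_of_coord_eq_top l h1 (Fin.insertNth _ N _) τ (by simp), add_zero]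
    intro h
    rw [Equiv.symm_apply_eq] at h
    obtain ⟨τ', hτ'⟩ := exists_permConsLast_eq τ h.symm
    exact hτ ⟨τ', by simp, hτ'⟩
  · intro τ _
    refine Finset.sum_congr rfl fun p _ => ?_
    have : (permConsLast τ).symm (Fin.last n) = 0 := by
      rw [Equiv.symm_apply_eq, permConsLast_zero]
    rw [kuhnFacetDet_last_of_coord_eq_zero l h0 (Fin.insertNth _ 0 _) _ (by simp),
      this, add_zero, ← kuhnFacetDet_permConsLast l h1, Fin.insertNth_zero]
    rfl

/-- A mod 2 form of Sperner's lemma for the cube. -/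
theorem kuhnSum_eq_one {n N : ℕ} (l : (Fin n → ℕ) → ℕ)
    (h0 : ∀ x (i : Fin n), x i = 0 → l x ≤ (i : ℕ))
    (h1 : ∀ x (i : Fin n), x i = N → l x ≠ (i : ℕ)) :
    kuhnSum N l = 1 := by
  induction n with
  | zero => simp [kuhnSum, kuhnDet]
  | succ n ih =>
    rw [kuhnSum_succ l h0 h1]
    refine ih _ (fun x i hx => ?_) (fun x i hx => ?_)
    · have := h0 (Fin.cons N x) i.succ (by simpa using hx)
      simp at this
      omega
    · have := h1 (Fin.cons N x) i.succ (by simpa using hx)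
      have h' := h1 (Fin.cons N x) 0 (by simp)
      simp at this h'
      omega

lemma kuhnVertex_rev {n N : ℕ} (p : Fin n → Fin N) (τ : Equiv.Perm (Fin n)) (k : Fin (n + 1))
    (i : Fin n) :
    kuhnVertex (fun i => ((p i).rev : ℕ)) (Fin.revPerm * τ) k i =
      N - kuhnVertex (fun i => (p i : ℕ)) τ k.rev i := by
  have := (p i).2
  have := (τ i).2
  have := k.2
  simp only [kuhnVertex, Fin.val_rev, Equiv.Perm.mul_apply, Fin.revPerm_apply]
  split_ifs <;> omega

lemma kuhnDet_rev {n N : ℕ} (l : (Fin n → ℕ) → ℕ) (p : Fin n → Fin N) (τ : Equiv.Perm (Fin n))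
    (hl : ∀ k : Fin (n + 1), l (fun i => N - kuhnVertex (fun i => (p i : ℕ)) τ k i) =
      l (kuhnVertex (fun i => (p i : ℕ)) τ k)) :
    kuhnDet l (fun i => ((p i).rev : ℕ)) (Fin.revPerm * τ) = kuhnDet l (fun i => p i) τ := by
  have h : ∀ u : ℤˣ, ((u : ℤ) : ZMod 2) = 1 := by decide
  have := Matrix.det_permute' Fin.revPerm (Matrix.of fun i k : Fin (n + 1) =>
    if (i : ℕ) ≤ l (kuhnVertex (fun i => (p i : ℕ)) τ k) then (1 : ZMod 2) else 0)
  rw [h, one_mul] at this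
  unfold kuhnDet
  rw [← this]
  congr 1
  ext i k
  have e := funext (kuhnVertex_rev p τ k)
  simp only [Matrix.of_apply, Matrix.submatrix_apply, id_eq, Fin.revPerm_apply, e, hl]

/-- If the labelling is symmetric on a symmetric region `S` of the cube, then some simplex not
contained in `S` has nonzero determinant. -/
theorem exists_kuhnDet_ne_zero {n m : ℕ} (hn : n ≠ 0) (l : (Fin n → ℕ) → ℕ)
    (h0 : ∀ x (i : Fin n), x i = 0 → l x ≤ (i : ℕ))
    (h1 : ∀ x (i : Fin n), x i = 2 * m → l x ≠ (i : ℕ))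
    (S : Set (Fin n → ℕ)) (hS : ∀ x ∈ S, (∀ i, x i ≤ 2 * m) → (fun i => 2 * m - x i) ∈ S)
    (hl : ∀ x ∈ S, (∀ i, x i ≤ 2 * m) → l (fun i => 2 * m - x i) = l x) :
    ∃ (p : Fin n → Fin (2 * m)) (τ : Equiv.Perm (Fin n)), kuhnDet l (fun i => p i) τ ≠ 0 ∧
      ∃ k : Fin (n + 1), kuhnVertex (fun i => (p i : ℕ)) τ k ∉ S := by
  classical
  by_contra! hcon
  have hsum := kuhnSum_eq_one l h0 h1
  have hle : ∀ (p : Fin n → Fin (2 * m)) (τ : Equiv.Perm (Fin n)) (k : ℕ) i,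
      kuhnVertex (fun i => (p i : ℕ)) τ k i ≤ 2 * m := by
    intro p τ k i
    have := (p i).2
    simp only [kuhnVertex]
    split_ifs <;> omega
  have hinner : ∑ s ∈ Finset.univ.filter (fun s : (Fin n → Fin (2 * m)) × Equiv.Perm (Fin n) =>
      ∀ k : Fin (n + 1), kuhnVertex (fun i => (s.1 i : ℕ)) s.2 k ∈ S),
      kuhnDet l (fun i => s.1 i) s.2 = 0 := by
    refine Finset.sum_involution (fun s _ => (fun i => (s.1 i).rev, Fin.revPerm * s.2)) ?_ ?_ ?_ ?_
    · rintro ⟨p, τ⟩ hs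
      simp only [Finset.mem_filter, Finset.mem_univ, true_and] at hs
      rw [kuhnDet_rev l p τ fun k => hl _ (hs k) (hle p τ k)]
      exact CharTwo.add_self_eq_zero _
    · rintro ⟨p, τ⟩ _ _ h
      have := congrFun (congrArg Prod.fst h) ⟨0, Nat.pos_of_ne_zero hn⟩
      have h2 := congrArg Fin.val this
      simp only [Fin.val_rev] at h2
      omega
    · rintro ⟨p, τ⟩ hs
      simp only [Finset.mem_filter, Finset.mem_univ, true_and] at hs ⊢
      intro k
      rw [funext (kuhnVertex_rev p τ k)]
      exact hS _ (hs _) (hle p τ _)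
    · rintro ⟨p, τ⟩ _
      ext <;> simp
  rw [Finset.sum_filter_of_ne (fun s _ hs k => hcon s.1 s.2 hs k), Fintype.sum_prod_type] at hinner
  exact one_ne_zero (hsum.symm.trans hinner)

lemma exists_label_of_kuhnDet_ne_zero {n : ℕ} {l : (Fin n → ℕ) → ℕ} {p : Fin n → ℕ}
    {τ : Equiv.Perm (Fin n)} (h : kuhnDet l p τ ≠ 0) (i : Fin n) :
    (∃ k : Fin (n + 1), l (kuhnVertex p τ k) = i) ∧
      ∃ k : Fin (n + 1), (i : ℕ) < l (kuhnVertex p τ k) := by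
  constructor
  · by_contra! hk
    have hne : i.castSucc ≠ i.succ := by simp [Fin.ext_iff]
    refine h (Matrix.det_zero_of_row_eq hne ?_)
    ext k
    have := hk k
    simp only [Matrix.of_apply, Fin.val_castSucc, Fin.val_succ]
    congr 1
    simp only [eq_iff_iff]
    omega
  · by_contra! hk
    refine h (Matrix.det_eq_zero_of_row_eq_zero i.succ fun k => ?_)
    have := hk k
    simp only [Matrix.of_apply, Fin.val_succ]
    rw [if_neg (by omega)]

end KuhnTriangulation

section EvenMaps

open Filter Topology

lemma dist_kuhnVertex_le {n m : ℕ} (hm : 0 < m) (p : Fin n → ℕ) (τ : Equiv.Perm (Fin n))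
    (j k : ℕ) :
    dist (fun i => 2 * ((kuhnVertex p τ j i : ℝ) - m) / m)
      (fun i => 2 * ((kuhnVertex p τ k i : ℝ) - m) / m) ≤ 2 / m := by
  have hm' : (0 : ℝ) < m := by exact_mod_cast hm
  refine (dist_pi_le_iff (by positivity)).mpr fun i => ?_
  rw [Real.dist_eq, ← sub_div, abs_div, abs_of_pos hm']
  gcongr
  simp only [kuhnVertex]
  split_ifs <;> norm_num <;> rw [abs_le] <;> constructor <;> linarith

/-- A vector field on `ℝ^n` which is even on the open unit ball and points outwards on the boundary
of the cube `[-2, 2]^n` has a zero outside the open unit ball. -/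
theorem exists_zero_of_even_of_outward {n : ℕ} (hn : n ≠ 0) (F : (Fin n → ℝ) → Fin n → ℝ)
    (hF : ∀ z, 1 ≤ ‖z‖ → ContinuousAt F z) (heven : ∀ z, ‖z‖ < 1 → F (-z) = F z)
    (hneg : ∀ z i, z i = -2 → F z i ≤ 0) (hpos : ∀ z i, z i = 2 → 0 < F z i) :
    ∃ z, 1 ≤ ‖z‖ ∧ F z = 0 := by
  classical
  have step : ∀ m : ℕ, ∃ w : Fin n → ℝ, ∃ a b : Fin n → Fin n → ℝ, 1 ≤ ‖w‖ ∧ ‖w‖ ≤ 2 ∧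
      ∀ i, dist (a i) w ≤ 2 / ((m + 1 : ℕ) : ℝ) ∧ dist (b i) w ≤ 2 / ((m + 1 : ℕ) : ℝ) ∧
        F (a i) i ≤ 0 ∧ 0 < F (b i) i := by
    intro m
    generalize hM : m + 1 = M
    have hM0 : 0 < M := by omega
    have hM' : (0 : ℝ) < M := by exact_mod_cast hM0
    let X : (Fin n → ℕ) → Fin n → ℝ := fun x i => 2 * ((x i : ℝ) - M) / M
    have hex : ∀ x : Fin n → ℕ, ∃ k : ℕ, ∀ h : k < n, F (X x) ⟨k, h⟩ ≤ 0 :=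
      fun x => ⟨n, fun h => absurd h (lt_irrefl n)⟩
    let l : (Fin n → ℕ) → ℕ := fun x => Nat.find (hex x)
    have hl_eq : ∀ x (i : Fin n), l x = i → F (X x) i ≤ 0 := by
      intro x i h
      have := Nat.find_spec (hex x)
      change ∀ h : l x < n, F (X x) ⟨l x, h⟩ ≤ 0 at this
      simp only [h] at this
      exact this i.2
    have hl_lt : ∀ x (i : Fin n), (i : ℕ) < l x → 0 < F (X x) i := by
      intro x i h
      have := Nat.find_min (hex x) h
      push Not at this
      exact this.2
    have hXneg : ∀ x : Fin n → ℕ, (∀ i, x i ≤ 2 * M) → X (fun i => 2 * M - x i) = -X x := by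
      intro x hx
      ext i
      simp only [X, Pi.neg_apply]
      rw [Nat.cast_sub (hx i)]
      push_cast
      ring
    have key := exists_kuhnDet_ne_zero (m := M) hn l ?_ ?_ {x | ‖X x‖ < 1} ?_ ?_
    · obtain ⟨p, τ, hdet, k₀, hk₀⟩ := key
      have hw : ‖X (kuhnVertex (fun i => (p i : ℕ)) τ k₀)‖ ≤ 2 := by
        refine (pi_norm_le_iff_of_nonneg (by norm_num)).mpr fun i => ?_
        have h1 : kuhnVertex (fun i => (p i : ℕ)) τ k₀ i ≤ 2 * M := by
          have := (p i).2
          simp only [kuhnVertex]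
          split_ifs <;> omega
        have h2 : (kuhnVertex (fun i => (p i : ℕ)) τ k₀ i : ℝ) ≤ 2 * M := by exact_mod_cast h1
        have h3 : (0 : ℝ) ≤ kuhnVertex (fun i => (p i : ℕ)) τ k₀ i := Nat.cast_nonneg _
        simp only [X]
        rw [Real.norm_eq_abs, abs_div, abs_of_pos hM', div_le_iff₀ hM', abs_le]
        constructor <;> linarith
      choose ka hka using fun i => (exists_label_of_kuhnDet_ne_zero hdet i).1
      choose kb hkb using fun i => (exists_label_of_kuhnDet_ne_zero hdet i).2
      exact ⟨X (kuhnVertex (fun i => (p i : ℕ)) τ k₀),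
        fun i => X (kuhnVertex (fun i => (p i : ℕ)) τ (ka i)),
        fun i => X (kuhnVertex (fun i => (p i : ℕ)) τ (kb i)), not_lt.mp hk₀, hw,
        fun i => ⟨dist_kuhnVertex_le hM0 _ _ _ _, dist_kuhnVertex_le hM0 _ _ _ _,
          hl_eq _ _ (hka i), hl_lt _ _ (hkb i)⟩⟩
    · intro x i hx
      refine Nat.find_min' (hex x) fun _ => hneg _ _ ?_
      simp only [X, hx]
      field_simp
      simp
    · intro x i hx h
      refine absurd (hl_eq x i h) (not_le.mpr (hpos _ _ ?_))
      simp only [X, hx]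
      field_simp
      push_cast
      ring
    · intro x hx hle
      simpa [hXneg x hle] using hx
    · intro x hx hle
      simp only [l, hXneg x hle, heven _ hx]
  choose w a b hw1 hw2 hab using step
  obtain ⟨z, -, φ, hφ, hz⟩ := (isCompact_closedBall (0 : Fin n → ℝ) 2).tendsto_subseq
    (x := w) (fun m => by simpa using hw2 m)
  have hsmall : Tendsto (fun m => 2 / ((φ m + 1 : ℕ) : ℝ)) atTop (𝓝 0) :=
    (tendsto_const_div_atTop_nhds_zero_nat 2).comp
      ((tendsto_add_atTop_nat 1).comp hφ.tendsto_atTop)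
  have hz1 : 1 ≤ ‖z‖ := ge_of_tendsto' hz.norm fun m => hw1 _
  have hlim : ∀ u : ℕ → Fin n → ℝ, (∀ m, dist (u m) (w m) ≤ 2 / ((m + 1 : ℕ) : ℝ)) → ∀ i,
      Tendsto (fun m => F (u (φ m)) i) atTop (𝓝 (F z i)) := by
    intro u hu i
    have hd : Tendsto (fun m => dist (w (φ m)) (u (φ m))) atTop (𝓝 0) :=
      squeeze_zero (fun _ => dist_nonneg) (fun m => by rw [dist_comm]; exact hu _) hsmall
    have : Tendsto (fun m => u (φ m)) atTop (𝓝 z) := (tendsto_iff_of_dist hd).mp hz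
    exact (tendsto_pi_nhds.mp ((hF z hz1).tendsto.comp this)) i
  refine ⟨z, hz1, funext fun i => le_antisymm ?_ ?_⟩
  · exact le_of_tendsto' (hlim (fun m => a m i) (fun m => (hab m i).1) i)
      fun m => (hab _ i).2.2.1
  · exact ge_of_tendsto' (hlim (fun m => b m i) (fun m => (hab m i).2.1) i)
      fun m => (hab _ i).2.2.2.le

/-- A continuous map on the nonzero vectors of `ℝ^n` which is even takes some vector to a multiple
of itself. -/
theorem exists_eq_smul_of_even_s3 {n : ℕ} (hn : n ≠ 0) (f : (Fin n → ℝ) → Fin n → ℝ)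
    (hf : ∀ z, z ≠ 0 → ContinuousAt f z) (heven : ∀ z, f (-z) = f z) :
    ∃ z, z ≠ 0 ∧ ∃ t : ℝ, f z = t • z := by
  have key := exists_zero_of_even_of_outward hn
    (fun z => max (‖z‖ - 1) 0 • z - max (2 - ‖z‖) 0 • f z) ?_ ?_ ?_ ?_
  · obtain ⟨z, hz1, hz⟩ := key
    have hz0 : z ≠ 0 := by
      rintro rfl
      norm_num at hz1
    rw [sub_eq_zero, max_eq_left (by linarith)] at hz
    rcases lt_or_ge ‖z‖ 2 with h | h
    · refine ⟨z, hz0, (2 - ‖z‖)⁻¹ * (‖z‖ - 1), ?_⟩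
      rw [max_eq_left (by linarith)] at hz
      rw [mul_smul, hz, inv_smul_smul₀ (by linarith)]
    · rw [max_eq_right (by linarith), zero_smul] at hz
      rcases smul_eq_zero.mp hz with h' | h'
      · linarith
      · exact absurd h' hz0
  · intro z hz1
    have hz0 : z ≠ 0 := by
      rintro rfl
      norm_num at hz1
    have := hf z hz0
    fun_prop
  · intro z hz
    simp [heven, max_eq_right (by linarith : ‖z‖ - 1 ≤ 0)]
  all_goals
    intro z i hi
    have h2 : 2 ≤ ‖z‖ := by simpa [hi] using norm_le_pi_norm z i
    have h1 : max (‖z‖ - 1) 0 = ‖z‖ - 1 := max_eq_left (by linarith)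
    have h0 : max (2 - ‖z‖) 0 = 0 := max_eq_right (by linarith)
    simp only [h1, h0, zero_smul, sub_zero, Pi.smul_apply, smul_eq_mul, hi]
    linarith

end EvenMaps

/-- The underlying space of a continuous unoriented Kakeya line configuration in `ℝ^n` is all
of `ℝ^n`. -/
theorem underlying_space_eq_univ (n : ℕ) (hn : 1 ≤ n)
    (σ : ℙ ℝ (EuclideanSpace ℝ (Fin n)) → EuclideanSpace ℝ (Fin n))
    (hσ : Continuous σ) :
    (⋃ L : ℙ ℝ (EuclideanSpace ℝ (Fin n)),
        {y : EuclideanSpace ℝ (Fin n) | ∃ x ∈ L.submodule, y = σ L + x}) = Set.univ := by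
  classical
  refine Set.eq_univ_of_forall fun y => Set.mem_iUnion.mpr ?_
  let e := EuclideanSpace.equiv (Fin n) ℝ
  have he : ∀ z, z ≠ 0 → e.symm z ≠ 0 := fun z hz => by simpa using hz
  let f : (Fin n → ℝ) → Fin n → ℝ := fun z =>
    if hz : z ≠ 0 then e (y - σ (Projectivization.mk ℝ (e.symm z) (he z hz))) else 0
  have key := exists_eq_smul_of_even_s3 (by omega : n ≠ 0) f ?_ ?_
  · obtain ⟨z, hz, t, ht⟩ := key
    refine ⟨Projectivization.mk ℝ (e.symm z) (he z hz), t • e.symm z, ?_, ?_⟩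
    · rw [Projectivization.submodule_mk]
      exact Submodule.smul_mem _ _ (Submodule.mem_span_singleton_self _)
    · simp only [f, dif_pos hz] at ht
      have := congrArg e.symm ht
      rw [ContinuousLinearEquiv.symm_apply_apply, map_smul] at this
      rw [← this]
      abel
  · intro z hz
    have hU : IsOpen {z : Fin n → ℝ | z ≠ 0} := isOpen_ne
    refine ContinuousOn.continuousAt (s := {z | z ≠ 0}) ?_ (hU.mem_nhds hz)
    rw [continuousOn_iff_continuous_domRestrict]
    have hmk : Continuous fun v : {v : EuclideanSpace ℝ (Fin n) // v ≠ 0} =>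
        Projectivization.mk ℝ v.1 v.2 := continuous_quotient_mk'
    have hsub : Continuous fun z : {z : Fin n → ℝ | z ≠ 0} =>
        (⟨e.symm z.1, he z.1 z.2⟩ : {v : EuclideanSpace ℝ (Fin n) // v ≠ 0}) :=
      (e.symm.continuous.comp continuous_subtype_val).subtype_mk _
    refine (e.continuous.comp ((continuous_const (y := y)).sub (hσ.comp (hmk.comp hsub)))).congr
      fun z => ?_
    have hz : z.1 ≠ 0 := z.2
    simp [f, Set.domRestrict, hz]
  · intro z
    by_cases hz : z = 0
    · simp [hz]
    · have hz' : -z ≠ 0 := neg_ne_zero.mpr hz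
      simp only [f, dif_pos hz', dif_pos (show z ≠ 0 from hz)]
      have : Projectivization.mk ℝ (e.symm (-z)) (he _ hz') =
          Projectivization.mk ℝ (e.symm z) (he z hz) := by
        rw [Projectivization.mk_eq_mk_iff']
        exact ⟨-1, by simp⟩
      rw [this]
end

section
/- Let n ≥ 1 and let σ : ℝP^{n-1} → ℝ^n be a continuous unoriented Kakeya line configuration. Then there exists a real number R ≥ 1 such that the R-elongation of the associated Kakeya needle set, namely ⋃_{L ∈ ℝP^{n-1}} {σ(L) + x : x ∈ L, ‖x‖ ≤ R/2}, has positive Lebesgue measure. -/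
open LinearAlgebra.Projectivization MeasureTheory

section

open MeasureTheory Set Function Topology
open scoped ENNReal NNReal

theorem differentiable_integral_of_continuous {X P : Type*} [MeasurableSpace X] {μ : Measure X}
    [IsFiniteMeasure μ] [TopologicalSpace P] [LocallyCompactSpace P] [MeasurableSpace P]
    [OpensMeasurableSpace P]
    {H : P → ℂ → ℂ} (hc : Continuous (uncurry H)) (hd : ∀ q, Differentiable ℂ (H q))
    {p : X → P} (hp : Measurable p) {K : Set P} (hK : IsCompact K) (hpK : ∀ᵐ x ∂μ, p x ∈ K) :
    Differentiable ℂ fun z => ∫ x, H (p x) z ∂μ := by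
  intro z₀
  obtain ⟨C, hC⟩ := (hK.prod (isCompact_closedBall z₀ 2)).exists_bound_of_continuousOn
    hc.continuousOn
  have hmeas : ∀ z, AEStronglyMeasurable (fun x => H (p x) z) μ := fun z =>
    (((hc.comp (Continuous.prodMk_left z)).measurable).comp hp).aestronglyMeasurable
  refine (hasDerivAt_integral_of_dominated_loc_of_deriv_le (F := fun z x => H (p x) z)
    (F' := fun z x => deriv (H (p x)) z) (bound := fun _ => C)
    (Metric.ball_mem_nhds z₀ one_pos) (.of_forall hmeas) ?_ ?_ ?_ (integrable_const C)
    ?_).2.differentiableAt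
  · refine (integrable_const C).mono' (hmeas z₀) ?_
    filter_upwards [hpK] with x hx
    exact hC (p x, z₀) ⟨hx, by simp⟩
  · exact ((measurable_deriv_with_param hc).comp
      (hp.prodMk measurable_const)).aestronglyMeasurable
  · filter_upwards [hpK] with x hx z hz
    have := Complex.norm_deriv_le_of_forall_mem_sphere_norm_le one_pos
      ((hd (p x)).diffContOnCl (s := Metric.ball z 1)) (C := C) (fun w hw => by
        refine hC (p x, w) ⟨hx, ?_⟩
        rw [Metric.mem_closedBall]
        have h1 := Metric.mem_sphere.1 hw
        have h2 := Metric.mem_ball.1 hz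
        linarith [dist_triangle w z z₀])
    simpa using this
  · exact .of_forall fun x z _ => (hd (p x) z).hasDerivAt

section

variable {E : Type*} [NormedAddCommGroup E] [NormedSpace ℝ E] [FiniteDimensional ℝ E]

theorem exists_injOn_of_approximatesLinearOn (A : E →L[ℝ] E) :
    ∃ r : ℝ≥0, r ≠ 0 ∧ (A.det ≠ 0 → ∀ (f : E → E) (s : Set E),
      ApproximatesLinearOn f A s r → InjOn f s) := by
  by_cases hA : A.det = 0
  · exact ⟨1, one_ne_zero, fun h => absurd hA h⟩
  set A' := A.toContinuousLinearEquivOfDetNeZero hA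
  have hAA : (A' : E →L[ℝ] E) = A := by ext; rfl
  rcases A'.subsingleton_or_nnnorm_symm_pos with hE | hpos
  · exact ⟨1, one_ne_zero, fun _ f s _ x _ y _ _ => Subsingleton.elim _ _⟩
  · have hpos' := inv_pos.2 hpos
    refine ⟨‖(A'.symm : E →L[ℝ] E)‖₊⁻¹ / 2, (half_pos hpos').ne', fun _ f s hf => ?_⟩
    rw [← hAA] at hf
    exact hf.injOn (.inr (half_lt_self hpos'))

variable [MeasurableSpace E] [BorelSpace E] (μ : Measure E) [μ.IsAddHaarMeasure]

theorem exists_setLIntegral_abs_det_eq_setLIntegral_encard {f : E → E} (hf : Measurable f)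
    {f' : E → E →L[ℝ] E} {S : Set E} (hS : MeasurableSet S)
    (hf' : ∀ x ∈ S, HasFDerivWithinAt f (f' x) S x) (hdet : ∀ x ∈ S, (f' x).det ≠ 0) :
    ∃ m : E → ℕ∞, Measurable (fun y => (m y : ℝ≥0∞)) ∧ ∀ T, MeasurableSet T →
      ∫⁻ x in S ∩ f ⁻¹' T, ENNReal.ofReal |(f' x).det| ∂μ = ∫⁻ y in T, (m y : ℝ≥0∞) ∂μ := by
  choose r hr0 hr using exists_injOn_of_approximatesLinearOn (E := E)
  obtain ⟨t, A, htd, htm, hSt, happ, hA⟩ :=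
    exists_partition_approximatesLinearOn_of_hasFDerivWithinAt f S f' hf' r hr0
  have hinj : ∀ i, InjOn f (S ∩ t i) := fun i => by
    rcases S.eq_empty_or_nonempty with rfl | hne
    · simp
    · obtain ⟨y, hy, hAy⟩ := hA hne i
      exact hr (A i) (hAy ▸ hdet y hy) f _ (happ i)
  have himg : ∀ i, MeasurableSet (f '' (S ∩ t i)) := fun i =>
    measurable_image_of_fderivWithin (hS.inter (htm i))
      (fun x hx => (hf' x hx.1).mono inter_subset_left) (hinj i)
  have hm : ∀ y, (({i | y ∈ f '' (S ∩ t i)}.encard : ℕ∞) : ℝ≥0∞)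
      = ∑' i, (f '' (S ∩ t i)).indicator 1 y := fun y => by
    rw [← ENNReal.tsum_set_one, tsum_subtype {i | y ∈ f '' (S ∩ t i)} fun _ => (1 : ℝ≥0∞)]
    rfl
  refine ⟨fun y => {i | y ∈ f '' (S ∩ t i)}.encard, ?_, fun T hT => ?_⟩
  · simp_rw [hm]
    exact Measurable.tsum fun i => measurable_one.indicator (himg i)
  · have hunion : S ∩ f ⁻¹' T = ⋃ i, S ∩ t i ∩ f ⁻¹' T := by
      rw [← iUnion_inter, ← inter_iUnion, inter_eq_left.2 hSt]
    have hmeas : ∀ i, MeasurableSet (S ∩ t i ∩ f ⁻¹' T) := fun i =>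
      (hS.inter (htm i)).inter (hf hT)
    simp_rw [hm]
    rw [hunion, lintegral_iUnion hmeas, lintegral_tsum fun i =>
      (measurable_one.indicator (himg i)).aemeasurable]
    · refine tsum_congr fun i => ?_
      rw [lintegral_abs_det_fderiv_eq_addHaar_image μ (hmeas i)
        (fun x hx => (hf' x hx.1.1).mono fun y hy => hy.1.1) ((hinj i).mono inter_subset_left),
        image_inter_preimage, lintegral_indicator_one (himg i), Measure.restrict_apply (himg i)]
    · intro i j hij
      exact (htd hij).mono (fun x hx => hx.1.2) (fun x hx => hx.1.2)

theorem LipschitzWith.addHaar_image_eq_zero {f : E → E} {K : ℝ≥0} (hf : LipschitzWith K f)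
    {s : Set E} (hs : μ s = 0) : μ (f '' s) = 0 := by
  have h1 : Measure.hausdorffMeasure (Module.finrank ℝ E) ≪ μ :=
    Measure.absolutelyContinuous_isAddHaarMeasure _ _
  have h2 : μ ≪ Measure.hausdorffMeasure (Module.finrank ℝ E) :=
    Measure.absolutelyContinuous_isAddHaarMeasure _ _
  refine h2 (le_antisymm ?_ bot_le)
  refine (hf.hausdorffMeasure_image_le (by positivity) s).trans ?_
  rw [h1 hs, mul_zero]

end

theorem lipschitzWith_norm_smul_comp_inv_norm_smul {E : Type*} [NormedAddCommGroup E]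
    [NormedSpace ℝ E] {u : E → E} {K : ℝ≥0}
    (hu : LipschitzOnWith K u (Metric.sphere 0 1)) (hu1 : ∀ x ∈ Metric.sphere 0 1, ‖u x‖ = 1) :
    LipschitzWith (1 + 2 * K) fun x => ‖x‖ • u (‖x‖⁻¹ • x) := by
  have hsph : ∀ x : E, x ≠ 0 → ‖x‖⁻¹ • x ∈ Metric.sphere (0 : E) 1 := fun x hx => by
    simpa using norm_smul_inv_norm (𝕜 := ℝ) hx
  have hn : ∀ x : E, ‖‖x‖ • u (‖x‖⁻¹ • x)‖ = ‖x‖ := fun x => by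
    rcases eq_or_ne x 0 with rfl | hx
    · simp
    · simp [norm_smul, hu1 _ (hsph x hx)]
  refine LipschitzWith.of_dist_le_mul fun x y => ?_
  rw [dist_eq_norm, dist_eq_norm]
  push_cast
  have hK : (0 : ℝ) ≤ K := K.2
  rcases eq_or_ne x 0 with rfl | hx
  · have := hn y
    simp only [norm_zero, zero_smul, zero_sub, norm_neg, this]
    nlinarith [norm_nonneg y]
  rcases eq_or_ne y 0 with rfl | hy
  · have := hn x
    simp only [norm_zero, zero_smul, sub_zero, this]
    nlinarith [norm_nonneg x]
  have h1 : ‖y‖ * ‖‖x‖⁻¹ • x - ‖y‖⁻¹ • y‖ ≤ 2 * ‖x - y‖ := by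
    have hx' : ‖x‖ ≠ 0 := norm_ne_zero_iff.2 hx
    have hy' : ‖y‖ ≠ 0 := norm_ne_zero_iff.2 hy
    have h2 : ‖y‖ • (‖x‖⁻¹ • x - ‖y‖⁻¹ • y) = (‖y‖ - ‖x‖) • (‖x‖⁻¹ • x) + (x - y) := by
      rw [smul_sub, smul_smul ‖y‖ ‖y‖⁻¹, mul_inv_cancel₀ hy', sub_smul, smul_smul ‖x‖ ‖x‖⁻¹,
        mul_inv_cancel₀ hx', one_smul, one_smul]
      abel
    calc ‖y‖ * ‖‖x‖⁻¹ • x - ‖y‖⁻¹ • y‖ = ‖‖y‖ • (‖x‖⁻¹ • x - ‖y‖⁻¹ • y)‖ := by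
          rw [norm_smul, norm_norm]
      _ ≤ |‖y‖ - ‖x‖| * 1 + ‖x - y‖ := by
          rw [h2]
          refine (norm_add_le _ _).trans ?_
          rw [norm_smul, Real.norm_eq_abs, mem_sphere_zero_iff_norm.1 (hsph x hx)]
      _ ≤ 2 * ‖x - y‖ := by
          have := abs_norm_sub_norm_le y x
          rw [norm_sub_rev y x] at this
          linarith
  have h3 : ‖u (‖x‖⁻¹ • x) - u (‖y‖⁻¹ • y)‖ ≤ K * ‖‖x‖⁻¹ • x - ‖y‖⁻¹ • y‖ := by
    simpa [dist_eq_norm] using hu.dist_le_mul _ (hsph x hx) _ (hsph y hy)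
  have h4 : ‖x‖ • u (‖x‖⁻¹ • x) - ‖y‖ • u (‖y‖⁻¹ • y) =
      (‖x‖ - ‖y‖) • u (‖x‖⁻¹ • x) + ‖y‖ • (u (‖x‖⁻¹ • x) - u (‖y‖⁻¹ • y)) := by
    rw [sub_smul, smul_sub]
    abel
  rw [h4]
  refine (norm_add_le _ _).trans ?_
  rw [norm_smul, norm_smul, hu1 _ (hsph x hx), Real.norm_eq_abs, norm_norm]
  have h5 := abs_norm_sub_norm_le x y
  have h6 := mul_le_mul_of_nonneg_left h3 (norm_nonneg y)
  have h7 := mul_le_mul_of_nonneg_left h1 hK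
  linarith

section

open Real
open scoped InnerProductSpace

variable {E : Type*} [NormedAddCommGroup E] [InnerProductSpace ℝ E] [FiniteDimensional ℝ E]
  [MeasurableSpace E] [BorelSpace E] (μ : Measure E) [μ.IsAddHaarMeasure]

theorem eventually_setIntegral_det_rotation_eq {v : E → E} {K : ℝ≥0} (hv : LipschitzWith K v)
    (horth : ∀ x, ⟪x, v x⟫_ℝ = 0) (hnorm : ∀ x, ‖v x‖ = ‖x‖) :
    ∀ᶠ t : ℝ in 𝓝 0, ∀ g : E → ℂ,
      ∫ x in Metric.closedBall (0 : E) 1,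
        (cos t • ContinuousLinearMap.id ℝ E + sin t • fderiv ℝ v x).det •
          g (cos t • x + sin t • v x) ∂μ = ∫ x in Metric.closedBall (0 : E) 1, g x ∂μ := by
  have hdetpos : ∀ᶠ A in 𝓝 (ContinuousLinearMap.id ℝ E), 0 < A.det :=
    ContinuousLinearMap.continuous_det.continuousAt.eventually_const_lt
      (by simp [ContinuousLinearMap.det])
  obtain ⟨δ, hδ, hball⟩ := Metric.eventually_nhds_iff.1 hdetpos
  have hsmall : Filter.Tendsto (fun t : ℝ => |cos t - 1| + |sin t| * K) (𝓝 0) (𝓝 0) := by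
    have : Continuous fun t : ℝ => |cos t - 1| + |sin t| * K := by fun_prop
    simpa using this.tendsto 0
  filter_upwards [hsmall.eventually_lt_const hδ, hsmall.eventually_lt_const one_pos]
    with t htδ ht1 g
  set G : E → E := fun x => cos t • x + sin t • v x with hG
  set c : ℝ≥0 := ⟨|cos t - 1| + |sin t| * K, by positivity⟩ with hc
  have happ : ApproximatesLinearOn G (ContinuousLinearEquiv.refl ℝ E : E →L[ℝ] E) univ c := by
    intro x _ y _
    have h1 : G x - G y - (x - y) = (cos t - 1) • (x - y) + sin t • (v x - v y) := by
      simp only [hG]; module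
    have h2 := hv.norm_sub_le x y
    calc ‖G x - G y - (x - y)‖ ≤ |cos t - 1| * ‖x - y‖ + |sin t| * ‖v x - v y‖ := by
          rw [h1]
          exact (norm_add_le _ _).trans_eq (by simp [norm_smul])
      _ ≤ |cos t - 1| * ‖x - y‖ + |sin t| * (K * ‖x - y‖) := by gcongr
      _ = (|cos t - 1| + |sin t| * K) * ‖x - y‖ := by ring
  have hc' : Subsingleton E ∨ c < ‖((ContinuousLinearEquiv.refl ℝ E).symm : E →L[ℝ] E)‖₊⁻¹ := by
    rcases subsingleton_or_nontrivial E with h | h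
    · exact .inl h
    · refine .inr ?_
      have : ‖((ContinuousLinearEquiv.refl ℝ E).symm : E →L[ℝ] E)‖₊ = 1 :=
        NNReal.eq (ContinuousLinearMap.norm_id (𝕜 := ℝ) (E := E))
      rw [this, inv_one]
      exact ht1
  have hGinj : Injective G := fun x y hxy => happ.injOn hc' (mem_univ x) (mem_univ y) hxy
  have hGsurj : Surjective G := happ.surjective hc'
  have hGnorm : ∀ x, ‖G x‖ = ‖x‖ := fun x => by
    have h1 : ‖G x‖ ^ 2 = ‖x‖ ^ 2 := by
      rw [hG, norm_add_sq_real, norm_smul, norm_smul, inner_smul_left, inner_smul_right, horth,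
        hnorm, mul_pow, mul_pow, norm_eq_abs, norm_eq_abs, sq_abs, sq_abs]
      simp only [mul_zero, add_zero]
      rw [← add_mul, cos_sq_add_sin_sq, one_mul]
    exact (sq_eq_sq₀ (norm_nonneg _) (norm_nonneg _)).1 h1
  have hGlip : LipschitzWith (‖cos t‖₊ + ‖sin t‖₊ * K) G := by
    refine LipschitzWith.of_dist_le_mul fun x y => ?_
    have h2 := hv.norm_sub_le x y
    have h1 : G x - G y = cos t • (x - y) + sin t • (v x - v y) := by
      simp only [hG]; module
    rw [dist_eq_norm, dist_eq_norm, h1]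
    calc _ ≤ ‖cos t‖ * ‖x - y‖ + ‖sin t‖ * ‖v x - v y‖ := by
          exact (norm_add_le _ _).trans_eq (by simp [norm_smul])
      _ ≤ ‖cos t‖ * ‖x - y‖ + ‖sin t‖ * (K * ‖x - y‖) := by gcongr
      _ = _ := by push_cast; ring
  set B := Metric.closedBall (0 : E) 1 with hB
  set D := {x | DifferentiableAt ℝ v x} with hD
  have hDm : MeasurableSet D := measurableSet_of_differentiableAt ℝ v
  have hDnull : μ Dᶜ = 0 := hv.ae_differentiableAt
  have hBD : (B ∩ D : Set E) =ᵐ[μ] B :=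
    inter_ae_eq_left_of_ae_eq_univ (ae_eq_univ.2 hDnull)
  have hGBD : (G '' (B ∩ D) : Set E) =ᵐ[μ] B := by
    have hGB : G '' B = B := by
      ext y
      constructor
      · rintro ⟨x, hx, rfl⟩
        simpa [hB, hGnorm] using hx
      · intro hy
        obtain ⟨x, rfl⟩ := hGsurj y
        exact ⟨x, by simpa [hB, hGnorm] using hy, rfl⟩
    rw [image_inter hGinj, hGB]
    refine inter_ae_eq_left_of_ae_eq_univ (ae_eq_univ.2 ?_)
    rw [← image_compl_eq ⟨hGinj, hGsurj⟩]
    exact hGlip.addHaar_image_eq_zero μ hDnull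
  symm
  rw [← setIntegral_congr_set (f := g) hGBD,
    integral_image_eq_integral_abs_det_fderiv_smul μ (measurableSet_closedBall.inter hDm)
      (f' := fun x => cos t • ContinuousLinearMap.id ℝ E + sin t • fderiv ℝ v x)
      (fun x hx => ?_) hGinj.injOn, ← setIntegral_congr_set hBD]
  · refine setIntegral_congr_fun (measurableSet_closedBall.inter hDm) fun x hx => ?_
    have hpos : 0 < (cos t • ContinuousLinearMap.id ℝ E + sin t • fderiv ℝ v x).det := by
      refine hball ?_
      rw [dist_eq_norm]
      refine lt_of_le_of_lt ?_ htδ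
      have h1 : cos t • ContinuousLinearMap.id ℝ E + sin t • fderiv ℝ v x -
          ContinuousLinearMap.id ℝ E =
          (cos t - 1) • ContinuousLinearMap.id ℝ E + sin t • fderiv ℝ v x := by module
      rw [h1]
      refine (norm_add_le _ _).trans ?_
      rw [norm_smul, norm_smul, norm_eq_abs, norm_eq_abs]
      gcongr
      · exact mul_le_of_le_one_right (abs_nonneg _) ContinuousLinearMap.norm_id_le
      · exact norm_fderiv_le_of_lipschitz ℝ hv
    simp only [abs_of_pos hpos, hG]
  · exact (((hasFDerivAt_id x).const_smul (cos t)).add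
      ((DifferentiableAt.hasFDerivAt hx.2).const_smul (sin t))).hasFDerivWithinAt

/-- The change of variables formula for the maps `x ↦ cos t • x + sin t • v x`, valid for small `t`,
extends to `t = π / 2` by analyticity in `t` when the integrand is an exponential. -/
theorem setIntegral_det_fderiv_mul_exp_eq {v : E → E} {K : ℝ≥0} (hv : LipschitzWith K v)
    (horth : ∀ x, ⟪x, v x⟫_ℝ = 0) (hnorm : ∀ x, ‖v x‖ = ‖x‖) (ξ : E) :
    ∫ x in Metric.closedBall (0 : E) 1,
        (fderiv ℝ v x).det • Complex.exp (⟪v x, ξ⟫_ℝ * Complex.I) ∂μ =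
      ∫ x in Metric.closedBall (0 : E) 1, Complex.exp (⟪x, ξ⟫_ℝ * Complex.I) ∂μ := by
  let b := Module.finBasis ℝ E
  let T : (E →L[ℝ] E) → Matrix (Fin (Module.finrank ℝ E)) (Fin (Module.finrank ℝ E)) ℝ :=
    fun A => LinearMap.toMatrix b b (A : E →ₗ[ℝ] E)
  have hT : Continuous T :=
    (((LinearMap.toMatrix b b).toLinearMap ∘ₗ
      ContinuousLinearMap.coeLM ℝ).continuous_of_finiteDimensional : _)
  let H : E × E × (E →L[ℝ] E) → ℂ → ℂ := fun q z =>
    (Complex.cos z • (1 : Matrix (Fin (Module.finrank ℝ E)) (Fin (Module.finrank ℝ E)) ℂ) +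
      Complex.sin z • (T q.2.2).map Complex.ofReal).det *
      Complex.exp ((Complex.cos z * ⟪q.1, ξ⟫_ℝ + Complex.sin z * ⟪q.2.1, ξ⟫_ℝ) * Complex.I)
  have hHc : Continuous (uncurry H) := by
    have h1 : Continuous fun q : (E × E × (E →L[ℝ] E)) × ℂ => (T q.1.2.2).map Complex.ofReal :=
      (hT.comp (continuous_snd.comp (continuous_snd.comp continuous_fst))).matrix_map
        Complex.continuous_ofReal
    simp only [H, uncurry_def]
    refine Continuous.mul (Continuous.matrix_det ?_) (by fun_prop)
    exact ((Complex.continuous_cos.comp continuous_snd).smul continuous_const).add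
      ((Complex.continuous_sin.comp continuous_snd).smul h1)
  have hHd : ∀ q, Differentiable ℂ (H q) := fun q => by
    simp only [H, Matrix.det_apply, Matrix.add_apply, Matrix.smul_apply, smul_eq_mul]
    fun_prop
  have hHreal : ∀ (q : E × E × (E →L[ℝ] E)) (t : ℝ), H q t =
      (cos t • ContinuousLinearMap.id ℝ E + sin t • q.2.2).det •
        Complex.exp (⟪cos t • q.1 + sin t • q.2.1, ξ⟫_ℝ * Complex.I) := fun q t => by
    have hdet : (cos t • ContinuousLinearMap.id ℝ E + sin t • q.2.2).det =
        (cos t • (1 : Matrix (Fin (Module.finrank ℝ E)) (Fin (Module.finrank ℝ E)) ℝ) +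
          sin t • T q.2.2).det := by
      rw [ContinuousLinearMap.det, ← LinearMap.det_toMatrix b]
      simp [T, map_add, map_smul]
    have hmap : (Complex.cos t • (1 : Matrix (Fin (Module.finrank ℝ E)) _ ℂ) +
        Complex.sin t • (T q.2.2).map Complex.ofReal) =
        Complex.ofRealHom.mapMatrix (cos t • 1 + sin t • T q.2.2) := by
      ext i j
      by_cases hij : i = j <;> simp [hij]
    simp only [H]
    rw [hmap, ← RingHom.map_det, hdet, inner_add_left, inner_smul_left, inner_smul_left]
    simp
  let p : E → E × E × (E →L[ℝ] E) := fun x => (x, v x, fderiv ℝ v x)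
  have hp : Measurable p :=
    measurable_id.prodMk (hv.continuous.measurable.prodMk (measurable_fderiv ℝ v))
  have : IsFiniteMeasure (μ.restrict (Metric.closedBall (0 : E) 1)) :=
    ⟨by simpa using measure_closedBall_lt_top⟩
  have hΦ := differentiable_integral_of_continuous (μ := μ.restrict (Metric.closedBall (0 : E) 1))
    hHc hHd hp
    (K := Metric.closedBall 0 1 ×ˢ Metric.closedBall 0 1 ×ˢ Metric.closedBall 0 K)
    ((isCompact_closedBall _ _).prod ((isCompact_closedBall _ _).prod (isCompact_closedBall _ _)))
    (by
      filter_upwards [ae_restrict_mem measurableSet_closedBall] with x hx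
      refine ⟨hx, ?_, ?_⟩
      · simpa [p, hnorm] using hx
      · simpa [p] using norm_fderiv_le_of_lipschitz ℝ hv)
  have hΦ0 : ∀ᶠ t : ℝ in 𝓝 0, ∫ x in Metric.closedBall (0 : E) 1, H (p x) t ∂μ =
      ∫ x in Metric.closedBall (0 : E) 1, Complex.exp (⟪x, ξ⟫_ℝ * Complex.I) ∂μ := by
    filter_upwards [eventually_setIntegral_det_rotation_eq μ hv horth hnorm] with t ht
    simp only [hHreal, p]
    exact ht fun y => Complex.exp (⟪y, ξ⟫_ℝ * Complex.I)
  have hconst := AnalyticOnNhd.eq_of_frequently_eq (z₀ := 0)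
    (hΦ.differentiableOn.analyticOnNhd isOpen_univ)
    (analyticOnNhd_const (v := ∫ x in Metric.closedBall (0 : E) 1,
      Complex.exp (⟪x, ξ⟫_ℝ * Complex.I) ∂μ)) (by
      have h1 : Filter.Tendsto (fun t : ℝ => (t : ℂ)) (𝓝[≠] 0) (𝓝[≠] 0) := by
        refine tendsto_nhdsWithin_iff.2 ⟨?_, ?_⟩
        · exact (Complex.continuous_ofReal.tendsto' 0 0 rfl).mono_left nhdsWithin_le_nhds
        · filter_upwards [self_mem_nhdsWithin] with t ht
          simpa using ht
      exact h1.frequently (hΦ0.filter_mono nhdsWithin_le_nhds).frequently)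
  have := congrFun hconst ((π / 2 : ℝ) : ℂ)
  simp only [hHreal, p, cos_pi_div_two, sin_pi_div_two, zero_smul, one_smul, zero_add] at this
  exact this

theorem exists_map_withDensity_ofReal_eq {v : E → E} (hv : Measurable v) {J : E → ℝ}
    (hJ : Measurable J) (hdiff : ∀ x, 0 < J x → DifferentiableAt ℝ v x)
    (hJabs : ∀ x, |J x| = |(fderiv ℝ v x).det|) {A : Set E} (hA : MeasurableSet A) :
    ∃ m : E → ℕ∞, Measurable (fun y => (m y : ℝ≥0∞)) ∧
      ((μ.restrict A).withDensity fun x => ENNReal.ofReal (J x)).map v =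
        μ.withDensity fun y => (m y : ℝ≥0∞) := by
  have hP : MeasurableSet {x | 0 < J x} := measurableSet_lt measurable_const hJ
  obtain ⟨m, hm, hmT⟩ := exists_setLIntegral_abs_det_eq_setLIntegral_encard μ hv
    (f' := fderiv ℝ v) (S := {x | 0 < J x} ∩ A) (hP.inter hA)
    (fun x hx => (hdiff x hx.1).hasFDerivAt.hasFDerivWithinAt)
    (fun x hx => by
      rw [← abs_pos, ← hJabs]
      exact abs_pos.2 (ne_of_gt hx.1))
  refine ⟨m, hm, Measure.ext fun T hT => ?_⟩
  rw [Measure.map_apply hv hT, withDensity_apply _ (hv hT), withDensity_apply _ hT, ← hmT T hT,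
    Measure.restrict_restrict (hv hT), inter_assoc, ← Measure.restrict_restrict hP,
    ← lintegral_indicator hP, inter_comm A]
  refine lintegral_congr fun x => ?_
  by_cases hx : 0 < J x
  · rw [indicator_of_mem (by exact hx), ← hJabs, abs_of_pos hx]
  · rw [indicator_of_notMem (by exact hx), ENNReal.ofReal_of_nonpos (not_lt.1 hx)]

theorem setIntegral_closedBall_eq_mul_setIntegral_half {g : E → ℂ} {s : ℂ} {e : E} (he : e ≠ 0)
    (hg : ∀ x, g (-x) = s * g x) (hint : IntegrableOn g (Metric.closedBall 0 1) μ) :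
    ∫ x in Metric.closedBall 0 1, g x ∂μ =
      (1 + s) * ∫ x in Metric.closedBall 0 1 ∩ {x | 0 < ⟪e, x⟫_ℝ}, g x ∂μ := by
  have hH : MeasurableSet {x : E | 0 < ⟪e, x⟫_ℝ} :=
    measurableSet_lt measurable_const (by fun_prop)
  have hnull : μ {x : E | ⟪e, x⟫_ℝ = 0} = 0 := by
    have := Measure.addHaar_submodule μ (ℝ ∙ e)ᗮ (fun h => he (by
      have : e ∈ (ℝ ∙ e)ᗮ := h ▸ Submodule.mem_top
      rw [Submodule.mem_orthogonal_singleton_iff_inner_right] at this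
      exact inner_self_eq_zero.1 this))
    convert this using 2
    ext x
    simp [Submodule.mem_orthogonal_singleton_iff_inner_right]
  have hae : (Metric.closedBall 0 1 ∩ {x : E | 0 < ⟪e, x⟫_ℝ}ᶜ : Set E) =ᵐ[μ]
      (Neg.neg ⁻¹' (Metric.closedBall 0 1 ∩ {x : E | 0 < ⟪e, x⟫_ℝ}) : Set E) := by
    have h0 : ∀ᵐ x ∂μ, ⟪e, x⟫_ℝ ≠ 0 := by
      rw [ae_iff]
      simpa using hnull
    filter_upwards [h0] with x hx
    refine propext ?_
    change (x ∈ Metric.closedBall 0 1 ∧ ¬ 0 < ⟪e, x⟫_ℝ) ↔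
      (-x ∈ Metric.closedBall 0 1 ∧ 0 < ⟪e, -x⟫_ℝ)
    rw [inner_neg_right, mem_closedBall_zero_iff, mem_closedBall_zero_iff, norm_neg, not_lt,
      Left.neg_pos_iff]
    exact and_congr_right fun _ => ⟨fun h => lt_of_le_of_ne h hx, le_of_lt⟩
  have hneg := (Measure.measurePreserving_neg μ).setIntegral_preimage_emb
    (Homeomorph.neg E).measurableEmbedding (fun x => g (-x))
    (Metric.closedBall 0 1 ∩ {x : E | 0 < ⟪e, x⟫_ℝ})
  simp only [neg_neg] at hneg
  rw [← integral_inter_add_sdiff hH hint, sdiff_eq, setIntegral_congr_set hae, hneg]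
  simp only [hg, integral_const_mul]
  ring

/-- There is no Lipschitz even map assigning to each vector an orthogonal vector of the same
norm. -/
theorem not_exists_lipschitz_even_tangent [Nontrivial E] {v : E → E} {K : ℝ≥0}
    (hv : LipschitzWith K v) (horth : ∀ x, ⟪x, v x⟫_ℝ = 0) (hnorm : ∀ x, ‖v x‖ = ‖x‖)
    (heven : ∀ x, v (-x) = v x) : False := by
  obtain ⟨e, he⟩ := exists_ne (0 : E)
  set μ : Measure E := Measure.addHaar
  set d := Module.finrank ℝ E with hd
  have hd0 : d ≠ 0 := Module.finrank_pos.ne'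
  set J : E → ℝ := fun x => (fderiv ℝ v x).det with hJdef
  have hJ : Measurable J :=
    ContinuousLinearMap.continuous_det.measurable.comp (measurable_fderiv ℝ v)
  have hJneg : ∀ x, J (-x) = (-1) ^ d * J x := fun x => by
    have h1 := fderiv_comp_smul (𝕜 := ℝ) (f := v) (x := x) (-1)
    simp only [neg_smul, one_smul] at h1
    have h2 : (fun x => v (-x)) = v := funext heven
    rw [h2] at h1
    have h3 : fderiv ℝ v (-x) = (-1 : ℝ) • fderiv ℝ v x := by rw [h1]; simp
    simp only [hJdef, h3, ContinuousLinearMap.det]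
    exact LinearMap.det_smul _ _
  have hdiff : ∀ x, J x ≠ 0 → DifferentiableAt ℝ v x := fun x hx => by
    by_contra h
    refine hx ?_
    simp only [hJdef, fderiv_zero_of_not_differentiableAt h, ContinuousLinearMap.det]
    exact LinearMap.det_zero.trans (zero_pow hd0)
  obtain ⟨C, hC⟩ : ∃ C, ∀ x, |J x| ≤ C := by
    obtain ⟨C, hC⟩ := (isCompact_closedBall (0 : E →L[ℝ] E) K).exists_bound_of_continuousOn
      ContinuousLinearMap.continuous_det.continuousOn
    exact ⟨C, fun x => hC _ (by simpa using norm_fderiv_le_of_lipschitz ℝ hv)⟩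
  set B : Set E := Metric.closedBall 0 1 with hB
  have hBm : MeasurableSet B := measurableSet_closedBall
  set A : Set E := B ∩ {x | 0 < ⟪e, x⟫_ℝ} with hAdef
  have hA : MeasurableSet A := hBm.inter (measurableSet_lt measurable_const (by fun_prop))
  have hBfin : IsFiniteMeasure (μ.restrict B) := ⟨by simpa [hB] using measure_closedBall_lt_top⟩
  have hAfin : IsFiniteMeasure (μ.restrict A) :=
    ⟨by simpa using (measure_mono inter_subset_left).trans_lt measure_closedBall_lt_top⟩
  obtain ⟨m₁, hm₁, hN₁⟩ := exists_map_withDensity_ofReal_eq μ hv.continuous.measurable hJ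
    (fun x hx => hdiff x hx.ne') (fun x => rfl) hA
  obtain ⟨m₂, hm₂, hN₂⟩ := exists_map_withDensity_ofReal_eq μ hv.continuous.measurable
    (J := fun x => - J x) hJ.neg (fun x hx => hdiff x (by linarith [hx])) (fun x => abs_neg _) hA
  obtain ⟨j, hj⟩ : ∃ j : ℕ, (1 + (-1) ^ d : ℂ) = 2 * j := by
    rcases d.even_or_odd with h | h
    · exact ⟨1, by rw [h.neg_one_pow]; norm_num⟩
    · exact ⟨0, by rw [h.neg_one_pow]; norm_num⟩
  have hfin : ∀ F : E → ℝ, (∀ x, |F x| ≤ C) →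
      IsFiniteMeasure ((μ.restrict A).withDensity fun x => ENNReal.ofReal (F x)) := fun F hF => by
    refine isFiniteMeasure_withDensity (ne_of_lt ?_)
    refine (lintegral_mono fun x =>
      ENNReal.ofReal_le_ofReal ((le_abs_self _).trans (hF x))).trans_lt ?_
    rw [lintegral_const]
    exact ENNReal.mul_lt_top ENNReal.ofReal_lt_top (measure_lt_top _ _)
  have hfin₁ := hfin J hC
  have hfin₂ := hfin (fun x => - J x) (fun x => by simpa using hC x)
  set N₁ := ((μ.restrict A).withDensity fun x => ENNReal.ofReal (J x)).map v with hN₁def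
  set N₂ := ((μ.restrict A).withDensity fun x => ENNReal.ofReal (- J x)).map v with hN₂def
  have hN₁fin : IsFiniteMeasure N₁ := Measure.isFiniteMeasure_map _ _
  have hN₂fin : IsFiniteMeasure N₂ := Measure.isFiniteMeasure_map _ _
  have hexp : ∀ (ν : Measure E) [IsFiniteMeasure ν] (ξ : E),
      Integrable (fun x => Complex.exp (⟪x, ξ⟫_ℝ * Complex.I)) ν := fun ν _ ξ =>
    (integrable_const (1 : ℝ)).mono' (by fun_prop)
      (.of_forall fun x => (Complex.norm_exp_ofReal_mul_I _).le)
  have hchar : ∀ (F : E → ℝ), Measurable F → ∀ ξ,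
      charFun (((μ.restrict A).withDensity fun x => ENNReal.ofReal (F x)).map v) ξ =
        ∫ x in A, max (F x) 0 • Complex.exp (⟪v x, ξ⟫_ℝ * Complex.I) ∂μ := fun F hF ξ => by
    rw [charFun_apply, integral_map hv.continuous.measurable.aemeasurable (by fun_prop),
      integral_withDensity_eq_integral_toReal_smul hF.ennreal_ofReal (by simp)]
    simp only [ENNReal.toReal_ofReal']
  have hint : ∀ (F : E → ℝ) (S : Set E) [IsFiniteMeasure (μ.restrict S)] (ξ : E), Measurable F →
      (∀ x, |F x| ≤ C) →
      IntegrableOn (fun x => F x • Complex.exp (⟪v x, ξ⟫_ℝ * Complex.I)) S μ :=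
    fun F S _ ξ hF hFC => by
    have := hv.continuous
    refine (integrable_const C).mono' (by fun_prop) (.of_forall fun x => ?_)
    rw [norm_smul, Complex.norm_exp_ofReal_mul_I, mul_one]
    exact hFC x
  have hC0 : 0 ≤ C := (abs_nonneg _).trans (hC 0)
  have hmeas : ((2 * j : ℕ) : ℝ≥0) • N₁ = ((2 * j : ℕ) : ℝ≥0) • N₂ + μ.restrict B := by
    refine Measure.ext_of_charFun (funext fun ξ => ?_)
    have h1 := setIntegral_det_fderiv_mul_exp_eq μ hv horth hnorm ξ
    rw [setIntegral_closedBall_eq_mul_setIntegral_half μ (s := (-1) ^ d) he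
      (fun x => by simp [heven, hJneg, mul_assoc]) (hint J B ξ hJ hC), hj] at h1
    have h2 : ∫ x in A, J x • Complex.exp (⟪v x, ξ⟫_ℝ * Complex.I) ∂μ =
        charFun N₁ ξ - charFun N₂ ξ := by
      rw [hN₁def, hN₂def, hchar _ hJ, hchar (fun x => - J x) hJ.neg, ← integral_sub
        (hint (fun x => max (J x) 0) A ξ (by fun_prop) fun x => ?_)
        (hint (fun x => max (- J x) 0) A ξ (by fun_prop) fun x => ?_)]
      · refine integral_congr_ae (.of_forall fun x => ?_)
        simp only [← sub_smul]
        rw [max_zero_sub_max_neg_zero_eq_self]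
      · rw [abs_of_nonneg (le_max_right _ _)]
        exact max_le ((le_abs_self _).trans (hC x)) hC0
      · rw [abs_of_nonneg (le_max_right _ _)]
        exact max_le ((neg_le_abs _).trans (hC x)) hC0
    rw [h2] at h1
    have h3 : charFun (((2 * j : ℕ) : ℝ≥0) • N₂ + μ.restrict B) ξ =
        (2 * j) * charFun N₂ ξ + ∫ x in B, Complex.exp (⟪x, ξ⟫_ℝ * Complex.I) ∂μ := by
      rw [charFun_apply, integral_add_measure (hexp _ ξ) (hexp _ ξ), integral_smul_nnreal_measure,
        charFun_apply]
      simp [NNReal.smul_def]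
    rw [h3, ← h1, charFun_apply, integral_smul_nnreal_measure, ← charFun_apply]
    simp [NNReal.smul_def]
    ring
  have hdens : (fun y => ((2 * j : ℕ) : ℝ≥0∞) * (m₁ y : ℝ≥0∞)) =ᵐ[μ]
      fun y => ((2 * j : ℕ) : ℝ≥0∞) * (m₂ y : ℝ≥0∞) + B.indicator 1 y := by
    refine (withDensity_eq_iff_of_sigmaFinite (hm₁.const_mul _).aemeasurable
      ((hm₂.const_mul _).add (measurable_one.indicator hBm)).aemeasurable).1 ?_
    have h1 := withDensity_smul (μ := μ) ((2 * j : ℕ) : ℝ≥0∞) hm₁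
    have h2 := withDensity_smul (μ := μ) ((2 * j : ℕ) : ℝ≥0∞) hm₂
    have h3 := withDensity_add_left (μ := μ) (hm₂.const_mul ((2 * j : ℕ) : ℝ≥0∞)) (B.indicator 1)
    rw [withDensity_indicator_one hBm] at h3
    refine Eq.trans ?_ h3.symm
    refine h1.trans (Eq.trans ?_ (congrArg (· + μ.restrict B) h2.symm))
    rw [← hN₁, ← hN₂]
    ext T hT
    have := congrArg (· T) hmeas
    simpa [ENNReal.smul_def] using this
  have hfinite : ∀ (m : E → ℕ∞), Measurable (fun y => (m y : ℝ≥0∞)) → ∀ N : Measure E,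
      IsFiniteMeasure N → N = μ.withDensity (fun y => (m y : ℝ≥0∞)) → ∀ᵐ y ∂μ, m y ≠ ⊤ :=
    fun m hm N _ hN => by
    have h1 : ∫⁻ y, (m y : ℝ≥0∞) ∂μ ≠ ∞ := by
      rw [← setLIntegral_univ, ← withDensity_apply _ MeasurableSet.univ, ← hN]
      exact measure_ne_top _ _
    filter_upwards [ae_lt_top hm h1] with y hy hy'
    simp [hy'] at hy
  have hBpos : μ B ≠ 0 := (Metric.measure_closedBall_pos μ 0 one_pos).ne'
  obtain ⟨y, hyB, hy, hy₁, hy₂⟩ : ∃ y ∈ B, ((2 * j : ℕ) : ℝ≥0∞) * (m₁ y : ℝ≥0∞) =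
      ((2 * j : ℕ) : ℝ≥0∞) * (m₂ y : ℝ≥0∞) + B.indicator 1 y ∧ m₁ y ≠ ⊤ ∧ m₂ y ≠ ⊤ := by
    by_contra! hcon
    refine hBpos (measure_mono_null (t := {y | ¬ (((2 * j : ℕ) : ℝ≥0∞) * (m₁ y : ℝ≥0∞) =
      ((2 * j : ℕ) : ℝ≥0∞) * (m₂ y : ℝ≥0∞) + B.indicator 1 y ∧ m₁ y ≠ ⊤ ∧ m₂ y ≠ ⊤)}) ?_ ?_)
    · exact fun y hy h => h.2.2 (hcon y hy h.1 h.2.1)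
    · exact ae_iff.1 (hdens.and ((hfinite m₁ hm₁ N₁ hN₁fin hN₁).and (hfinite m₂ hm₂ N₂ hN₂fin hN₂)))
  obtain ⟨a, ha⟩ := ENat.ne_top_iff_exists.1 hy₁
  obtain ⟨b, hb⟩ := ENat.ne_top_iff_exists.1 hy₂
  rw [← ha, ← hb, indicator_of_mem hyB] at hy
  have : 2 * j * a = 2 * j * b + 1 := by
    simp only [ENat.toENNReal_coe, Pi.one_apply] at hy
    exact_mod_cast hy
  have h2 : 2 * (j * a) = 2 * (j * b) + 1 := by linarith
  omega

/-- A continuous even map on the unit sphere is radial at some point. -/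
theorem exists_mem_span_singleton_of_even_continuousOn_sphere [Nontrivial E] {f : E → E}
    (hf : ContinuousOn f (Metric.sphere 0 1)) (heven : ∀ x ∈ Metric.sphere 0 1, f (-x) = f x) :
    ∃ x ∈ Metric.sphere (0 : E) 1, f x ∈ ℝ ∙ x := by
  by_contra! hcon
  have hcpt : IsCompact (Metric.sphere (0 : E) 1) := isCompact_sphere 0 1
  obtain ⟨z, hz, hzmin⟩ := hcpt.exists_isMinOn (NormedSpace.sphere_nonempty.2 zero_le_one)
    (f := fun x => ‖f x - ⟪f x, x⟫_ℝ • x‖) (by fun_prop)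
  have hδ : 0 < ‖f z - ⟪f z, z⟫_ℝ • z‖ := norm_pos_iff.2 fun h =>
    hcon z hz (Submodule.mem_span_singleton.2 ⟨_, (sub_eq_zero.1 h).symm⟩)
  set δ := ‖f z - ⟪f z, z⟫_ℝ • z‖
  obtain ⟨F, hF⟩ := ContinuousMap.exists_restrict_eq
    (Metric.isClosed_sphere (x := (0 : E)) (ε := 1))
    ⟨(Metric.sphere (0 : E) 1).domRestrict f, hf.domRestrict⟩
  have hFf : ∀ x ∈ Metric.sphere (0 : E) 1, F x = f x := fun x hx => DFunLike.congr_fun hF ⟨x, hx⟩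
  obtain ⟨g, hg, hgF, -⟩ := F.continuous.exists_contDiff_approx 1 (ε := fun _ => δ / 2)
    continuous_const (fun _ => half_pos hδ)
  set h : E → E := fun x => (2⁻¹ : ℝ) • (g x + g (-x)) with hh
  have hheven : ∀ x, h (-x) = h x := fun x => by simp [hh, add_comm]
  have hhC : ContDiff ℝ 1 h := (hg.add (hg.comp contDiff_neg)).const_smul _
  have hhf : ∀ x ∈ Metric.sphere (0 : E) 1, ‖f x - h x‖ < δ / 2 := fun x hx => by
    have hx' : -x ∈ Metric.sphere (0 : E) 1 := by simpa using hx
    have h1 := hgF x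
    have h2 := hgF (-x)
    rw [hFf x hx, dist_comm, dist_eq_norm] at h1
    rw [hFf _ hx', heven x hx, dist_comm, dist_eq_norm] at h2
    have h3 : f x - h x = (2⁻¹ : ℝ) • ((f x - g x) + (f x - g (-x))) := by
      simp only [hh]
      module
    rw [h3, norm_smul]
    have := norm_add_le (f x - g x) (f x - g (-x))
    norm_num
    linarith
  set w : E → E := fun x => h x - ⟪h x, x⟫_ℝ • x with hw
  have hwC : ContDiff ℝ 1 w := hhC.sub ((hhC.inner ℝ contDiff_id).smul contDiff_id)
  have hw0 : ∀ x ∈ Metric.sphere (0 : E) 1, w x ≠ 0 := fun x hx h0 => by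
    have h1 : δ ≤ ‖f x - ⟪f x, x⟫_ℝ • x‖ := hzmin hx
    have h2 : f x - ⟪f x, x⟫_ℝ • x = (f x - h x) - ⟪f x - h x, x⟫_ℝ • x + w x := by
      simp only [hw, inner_sub_left]
      module
    rw [h2, h0, add_zero] at h1
    have hx1 : ‖x‖ = 1 := mem_sphere_zero_iff_norm.1 hx
    have h3 := norm_sub_le (f x - h x) (⟪f x - h x, x⟫_ℝ • x)
    rw [norm_smul, hx1, mul_one] at h3
    have h4 := norm_inner_le_norm (𝕜 := ℝ) (f x - h x) x
    rw [hx1, mul_one] at h4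
    linarith [hhf x hx]
  obtain ⟨K, hK⟩ := LocallyLipschitzOn.exists_lipschitzOnWith_of_compact
    (f := fun x => ‖w x‖⁻¹ • w x)
    hcpt fun x hx => by
      have : ContDiffAt ℝ 1 (fun x => ‖w x‖⁻¹ • w x) x :=
        ((hwC.contDiffAt.norm ℝ (hw0 x hx)).inv (norm_ne_zero_iff.2 (hw0 x hx))).smul hwC.contDiffAt
      obtain ⟨K, t, ht, hK⟩ := this.exists_lipschitzOnWith
      exact ⟨K, t, mem_nhdsWithin_of_mem_nhds ht, hK⟩
  have hu1 : ∀ x ∈ Metric.sphere (0 : E) 1, ‖‖w x‖⁻¹ • w x‖ = 1 := fun x hx => by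
    simpa using norm_smul_inv_norm (𝕜 := ℝ) (hw0 x hx)
  have hsph : ∀ x : E, x ≠ 0 → ‖x‖⁻¹ • x ∈ Metric.sphere (0 : E) 1 := fun x hx => by
    simpa using norm_smul_inv_norm (𝕜 := ℝ) hx
  refine not_exists_lipschitz_even_tangent (lipschitzWith_norm_smul_comp_inv_norm_smul hK hu1)
    (fun x => ?_) (fun x => ?_) (fun x => ?_)
  · rcases eq_or_ne x 0 with rfl | hx
    · simp
    have h1 : ∀ y ∈ Metric.sphere (0 : E) 1, ⟪y, w y⟫_ℝ = 0 := fun y hy => by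
      simp only [hw, inner_sub_right, inner_smul_right, real_inner_self_eq_norm_sq,
        mem_sphere_zero_iff_norm.1 hy, real_inner_comm]
      ring
    have h2 := h1 _ (hsph x hx)
    rw [real_inner_smul_left, mul_eq_zero, or_iff_right (inv_ne_zero (norm_ne_zero_iff.2 hx))] at h2
    simp [inner_smul_right, h2]
  · rcases eq_or_ne x 0 with rfl | hx
    · simp
    · rw [norm_smul, hu1 _ (hsph x hx), norm_norm, mul_one]
  · simp [hw, hheven]

end

end

/-- The lines of a continuous Kakeya line configuration cover the whole space. -/
theorem exists_sub_mem_submodule_projectivization {E : Type*} [NormedAddCommGroup E]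
    [InnerProductSpace ℝ E] [FiniteDimensional ℝ E] [Nontrivial E] {σ : ℙ ℝ E → E}
    (hσ : Continuous σ) (p : E) : ∃ L : ℙ ℝ E, p - σ L ∈ L.submodule := by
  classical
  borelize E
  set f : E → E := fun x => if hx : x ≠ 0 then p - σ (Projectivization.mk ℝ x hx) else 0
  have hne : ∀ x ∈ Metric.sphere (0 : E) 1, x ≠ 0 := fun x hx =>
    ne_zero_of_mem_unit_sphere ⟨x, hx⟩
  have hfx : ∀ x (hx : x ≠ 0), f x = p - σ (Projectivization.mk ℝ x hx) := fun x hx => dif_pos hx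
  obtain ⟨x, hx, hfm⟩ := exists_mem_span_singleton_of_even_continuousOn_sphere (f := f) (by
    rw [continuousOn_iff_continuous_domRestrict]
    have hq : Continuous fun x : {x : E // x ≠ 0} => Projectivization.mk ℝ x.1 x.2 :=
      continuous_quotient_mk'
    have : (Metric.sphere (0 : E) 1).domRestrict f =
        fun x => p - σ (Projectivization.mk ℝ x.1 (hne _ x.2)) :=
      funext fun x => hfx x.1 (hne _ x.2)
    rw [this]
    have hi : Continuous fun x : Metric.sphere (0 : E) 1 =>
        (⟨x.1, hne _ x.2⟩ : {x : E // x ≠ 0}) := continuous_subtype_val.subtype_mk _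
    exact continuous_const.sub (hσ.comp (hq.comp hi))) fun x hx => by
    rw [hfx _ (hne x hx), hfx _ (neg_ne_zero.2 (hne x hx))]
    congr 2
    exact (Projectivization.mk_eq_mk_iff' _ _ _ _ _).2 ⟨-1, by simp⟩
  refine ⟨Projectivization.mk ℝ x (hne x hx), ?_⟩
  rwa [Projectivization.submodule_mk, ← hfx]

/-- For a continuous unoriented Kakeya line configuration in `ℝ^n`, some `R`-elongation of the
associated Kakeya needle set has positive Lebesgue measure. -/
theorem exists_elongation_pos_measure (n : ℕ) (hn : 1 ≤ n)
    (σ : ℙ ℝ (EuclideanSpace ℝ (Fin n)) → EuclideanSpace ℝ (Fin n))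
    (hσ : Continuous σ) :
    ∃ R : ℝ, 1 ≤ R ∧
      0 < volume (⋃ L : ℙ ℝ (EuclideanSpace ℝ (Fin n)),
        {y : EuclideanSpace ℝ (Fin n) | ∃ x ∈ L.submodule, ‖x‖ ≤ R / 2 ∧ y = σ L + x}) := by
  have : NeZero n := ⟨by omega⟩
  by_contra! hcon
  have hnull : volume (⋃ k : ℕ, ⋃ L : ℙ ℝ (EuclideanSpace ℝ (Fin n)),
      {y : EuclideanSpace ℝ (Fin n) |
        ∃ x ∈ L.submodule, ‖x‖ ≤ ((k : ℝ) + 1) / 2 ∧ y = σ L + x}) = 0 :=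
    measure_iUnion_null fun k => le_zero_iff.1 (hcon _ (by linarith [k.cast_nonneg (α := ℝ)]))
  refine NeZero.ne (volume : Measure (EuclideanSpace ℝ (Fin n)))
    (Measure.measure_univ_eq_zero.1 (measure_mono_null (fun p _ => ?_) hnull))
  obtain ⟨L, hL⟩ := exists_sub_mem_submodule_projectivization hσ p
  obtain ⟨k, hk⟩ := exists_nat_ge (2 * ‖p - σ L‖)
  exact Set.mem_iUnion.2 ⟨k, Set.mem_iUnion.2 ⟨L, p - σ L, hL, by linarith, by abel⟩⟩
end

section
/- Let n ≥ 1 and let σ : S^{2n} → ℝ^{2n+1} be a continuous oriented Kakeya line configuration. Then its underlying space is all of ℝ^{2n+1}, i.e., ⋃_{x ∈ S^{2n}} (σ(x) + ℝx) = ℝ^{2n+1}. -/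
open Metric Set MeasureTheory Module Polynomial
open scoped RealInnerProductSpace NNReal

theorem Polynomial.not_forall_eval_eq_sqrt_one_add_sq_pow {N : ℕ} (hN : Odd N) (P : ℝ[X])
    {δ : ℝ} (hδ : 0 < δ) : ¬ ∀ t ∈ Ioo 0 δ, P.eval t = √(1 + t ^ 2) ^ N := by
  intro h
  have hP : P ^ 2 = (1 + X ^ 2) ^ N := by
    refine Polynomial.eq_of_infinite_eval_eq _ _ ((Ioo_infinite hδ).mono fun t ht ↦ ?_)
    simp only [mem_ofPred_eq, eval_pow, eval_add, eval_one, eval_X, h t ht]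
    rw [← pow_mul, mul_comm, pow_mul, Real.sq_sqrt (by positivity)]
  set Q : ℂ[X] := P.map (algebraMap ℝ ℂ)
  have hQ : Q ^ 2 = ((X - C Complex.I) * (X - C (-Complex.I))) ^ N := by
    have h1 : (X - C Complex.I) * (X - C (-Complex.I)) = 1 + X ^ 2 := by
      have : (C Complex.I * C Complex.I : ℂ[X]) = -1 := by simp [← C_mul]
      rw [C_neg]
      linear_combination -this
    rw [h1, ← Polynomial.map_pow, hP]
    simp
  have hne : (X - C Complex.I) * (X - C (-Complex.I)) ≠ 0 :=
    mul_ne_zero (X_sub_C_ne_zero _) (X_sub_C_ne_zero _)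
  have hI : Complex.I ≠ -Complex.I := by
    intro h
    have := congrArg Complex.im h
    norm_num at this
  have hm := congrArg (rootMultiplicity Complex.I) hQ
  rw [← count_roots, ← count_roots, roots_pow, roots_pow, roots_mul hne, roots_X_sub_C,
    roots_X_sub_C] at hm
  simp [hI] at hm
  obtain ⟨k, hk⟩ := hN
  omega

section

variable {E : Type*} [NormedAddCommGroup E] [NormedSpace ℝ E]

theorem LipschitzOnWith.lipschitzWith_norm_smul_comp_normalize {F : Type*} [NormedAddCommGroup F]
    [NormedSpace ℝ F] {g : E → F} {L : ℝ≥0} (hg : LipschitzOnWith L g (sphere 0 1))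
    (hg1 : ∀ x ∈ sphere (0 : E) 1, ‖g x‖ ≤ 1) :
    LipschitzWith (1 + 2 * L) fun x ↦ ‖x‖ • g (‖x‖⁻¹ • x) := by
  have hmem : ∀ x : E, x ≠ 0 → ‖x‖⁻¹ • x ∈ sphere (0 : E) 1 := fun x hx ↦ by
    simp [norm_smul, hx]
  have hbound : ∀ x : E, ‖‖x‖ • g (‖x‖⁻¹ • x)‖ ≤ ‖x‖ := fun x ↦ by
    rcases eq_or_ne x 0 with rfl | hx
    · simp
    · rw [norm_smul, norm_norm]
      exact mul_le_of_le_one_right (norm_nonneg x) (hg1 _ (hmem x hx))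
  refine LipschitzWith.of_dist_le_mul fun x y ↦ ?_
  simp only [dist_eq_norm]
  push_cast
  rcases eq_or_ne x 0 with rfl | hx
  · have := hbound y
    have : 0 ≤ L * ‖y‖ := by positivity
    simp only [norm_zero, zero_smul, zero_sub, norm_neg]
    linarith
  rcases eq_or_ne y 0 with rfl | hy
  · have := hbound x
    have : 0 ≤ L * ‖x‖ := by positivity
    simp only [norm_zero, zero_smul, sub_zero]
    linarith
  have hx0 : ‖x‖ ≠ 0 := norm_ne_zero_iff.2 hx
  have hy0 : ‖y‖ ≠ 0 := norm_ne_zero_iff.2 hy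
  have h1 : |‖x‖ - ‖y‖| ≤ ‖x - y‖ := abs_norm_sub_norm_le x y
  have h2 : ‖y‖ * ‖‖x‖⁻¹ • x - ‖y‖⁻¹ • y‖ ≤ 2 * ‖x - y‖ := by
    calc ‖y‖ * ‖‖x‖⁻¹ • x - ‖y‖⁻¹ • y‖ = ‖(‖y‖ - ‖x‖) • (‖x‖⁻¹ • x) + (x - y)‖ := by
          rw [← norm_norm y, ← norm_smul, norm_norm]
          congr 1
          rw [smul_sub, sub_smul, smul_inv_smul₀ hy0, smul_inv_smul₀ hx0]
          abel
      _ ≤ |‖y‖ - ‖x‖| * 1 + ‖x - y‖ := by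
          refine (norm_add_le _ _).trans_eq ?_
          rw [norm_smul, mem_sphere_zero_iff_norm.1 (hmem x hx), Real.norm_eq_abs]
      _ ≤ 2 * ‖x - y‖ := by rw [abs_sub_comm]; linarith
  have h3 := hg.dist_le_mul _ (hmem x hx) _ (hmem y hy)
  rw [dist_eq_norm, dist_eq_norm] at h3
  calc ‖‖x‖ • g (‖x‖⁻¹ • x) - ‖y‖ • g (‖y‖⁻¹ • y)‖
      = ‖(‖x‖ - ‖y‖) • g (‖x‖⁻¹ • x) + ‖y‖ • (g (‖x‖⁻¹ • x) - g (‖y‖⁻¹ • y))‖ := by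
        congr 1
        rw [smul_sub, sub_smul]
        abel
    _ ≤ |‖x‖ - ‖y‖| * ‖g (‖x‖⁻¹ • x)‖ + ‖y‖ * ‖g (‖x‖⁻¹ • x) - g (‖y‖⁻¹ • y)‖ := by
        refine (norm_add_le _ _).trans_eq ?_
        rw [norm_smul, norm_smul, norm_norm, Real.norm_eq_abs]
    _ ≤ ‖x - y‖ * 1 + L * (‖y‖ * ‖‖x‖⁻¹ • x - ‖y‖⁻¹ • y‖) := by
        have := mul_le_mul_of_nonneg_left h3 (norm_nonneg y)
        have := mul_le_mul h1 (hg1 _ (hmem x hx)) (norm_nonneg _) (norm_nonneg _)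
        linarith
    _ ≤ (1 + 2 * L) * ‖x - y‖ := by
        have := mul_le_mul_of_nonneg_left h2 L.coe_nonneg
        linarith

variable [FiniteDimensional ℝ E]

theorem ContinuousLinearMap.det_id_add_pos {B : E →L[ℝ] E} (hB : ‖B‖ < 1) :
    0 < (ContinuousLinearMap.id ℝ E + B).det := by
  have hcont : Continuous fun s : ℝ ↦ (ContinuousLinearMap.id ℝ E + s • B).det :=
    ContinuousLinearMap.continuous_det.comp (by fun_prop)
  have hne : ∀ s ∈ Icc (0 : ℝ) 1, (ContinuousLinearMap.id ℝ E + s • B).det ≠ 0 := by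
    intro s hs h0
    have hker := LinearMap.bot_lt_ker_of_det_eq_zero
      (f := (ContinuousLinearMap.id ℝ E + s • B).toLinearMap) h0
    obtain ⟨x, hx, hx0⟩ := Submodule.exists_mem_ne_zero_of_ne_bot hker.ne'
    have hx' : x + s • B x = 0 := by simpa using hx
    have h1 : ‖x‖ = s * ‖B x‖ := by
      rw [← Real.norm_of_nonneg hs.1, ← norm_smul, ← norm_neg (s • B x),
        ← eq_neg_of_add_eq_zero_left hx']
    have h2 := B.le_opNorm x
    have h3 : 0 < ‖x‖ := norm_pos_iff.2 hx0
    nlinarith [hs.1, hs.2, norm_nonneg (B x)]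
  by_contra hneg
  push Not at hneg
  have h0 : (0 : ℝ) ∈ Icc ((ContinuousLinearMap.id ℝ E + (1 : ℝ) • B).det)
      ((ContinuousLinearMap.id ℝ E + (0 : ℝ) • B).det) := by
    refine ⟨by simpa using hneg, ?_⟩
    simp [ContinuousLinearMap.det]
  obtain ⟨s, hs, hs0⟩ := intermediate_value_Icc' zero_le_one hcont.continuousOn h0
  exact hne s hs hs0

theorem ContinuousLinearMap.exists_polynomial_eval_eq_det_id_add_smul (A : E →L[ℝ] E) :
    ∃ p : ℝ[X], p.natDegree ≤ finrank ℝ E ∧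
      ∀ t : ℝ, p.eval t = (ContinuousLinearMap.id ℝ E + t • A).det := by
  let b := finBasis ℝ E
  generalize hM : LinearMap.toMatrix b b A.toLinearMap = M
  refine ⟨((X : ℝ[X]) • M.map C + (1 : Matrix _ _ ℝ).map C).det, ?_, fun t ↦ ?_⟩
  · simpa using natDegree_det_X_add_C_le M 1
  · have hdet : (ContinuousLinearMap.id ℝ E + t • A).det = (1 + t • M).det := by
      rw [ContinuousLinearMap.det, ← LinearMap.det_toMatrix b, ← hM,
        ← LinearMap.toMatrix_id b, ← map_smul, ← map_add]
      rfl
    rw [hdet, ← coe_evalRingHom, RingHom.map_det]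
    congr 1
    ext i j
    simp only [RingHom.mapMatrix_apply, Matrix.map_apply, Matrix.add_apply, Matrix.smul_apply,
      coe_evalRingHom, eval_add, smul_eq_mul, eval_mul, eval_X, eval_C]
    ring

end

section

variable {E : Type*} [NormedAddCommGroup E] [InnerProductSpace ℝ E]

theorem norm_sub_inner_smul_le {x : E} (hx : ‖x‖ = 1) (a : E) : ‖a - ⟪x, a⟫ • x‖ ≤ ‖a‖ := by
  have h : ‖a - ⟪x, a⟫ • x‖ ^ 2 = ‖a‖ ^ 2 - ⟪x, a⟫ ^ 2 := by
    rw [norm_sub_sq_real, inner_smul_right, norm_smul, hx, real_inner_comm, Real.norm_eq_abs,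
      mul_one, sq_abs]
    ring
  exact le_of_sq_le_sq (by nlinarith [sq_nonneg ⟪x, a⟫]) (norm_nonneg a)

theorem norm_add_smul_eq_of_inner_eq_zero {x w : E} (h : ⟪x, w⟫ = 0) (hn : ‖w‖ = ‖x‖) (t : ℝ) :
    ‖x + t • w‖ = √(1 + t ^ 2) * ‖x‖ := by
  have h1 : ‖x + t • w‖ ^ 2 = (1 + t ^ 2) * ‖x‖ ^ 2 := by
    rw [norm_add_sq_real, inner_smul_right, h, norm_smul, hn, mul_pow, Real.norm_eq_abs, sq_abs]
    ring
  rw [← Real.sqrt_sq (norm_nonneg (x + t • w)), h1, Real.sqrt_mul (by positivity),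
    Real.sqrt_sq (norm_nonneg x)]

variable [FiniteDimensional ℝ E]

theorem LipschitzWith.bijective_add_smul {v : E → E} {K : ℝ≥0} (hv : LipschitzWith K v) {t : ℝ}
    (ht : |t| * K < 1) : Function.Bijective fun x ↦ x + t • v x := by
  rcases subsingleton_or_nontrivial E with hE | hE
  · exact ⟨Function.injective_of_subsingleton _, Function.surjective_to_subsingleton _⟩
  have happ : ApproximatesLinearOn (fun x ↦ x + t • v x)
      (ContinuousLinearEquiv.refl ℝ E : E →L[ℝ] E) univ (‖t‖₊ * K) := by
    intro x _ y _
    have h1 : x + t • v x - (y + t • v y) - (ContinuousLinearEquiv.refl ℝ E : E →L[ℝ] E) (x - y)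
        = t • (v x - v y) := by
      simp [smul_sub]
      abel
    rw [h1, norm_smul, NNReal.coe_mul, coe_nnnorm, mul_assoc]
    exact mul_le_mul_of_nonneg_left (hv.norm_sub_le x y) (norm_nonneg t)
  have hc : ‖t‖₊ * K < ‖((ContinuousLinearEquiv.refl ℝ E).symm : E →L[ℝ] E)‖₊⁻¹ := by
    have : ‖((ContinuousLinearEquiv.refl ℝ E).symm : E →L[ℝ] E)‖₊ = 1 := by
      rw [← NNReal.coe_inj]
      exact ContinuousLinearMap.norm_id
    rw [this, inv_one, ← NNReal.coe_lt_coe]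
    simpa using ht
  exact ⟨injOn_univ.1 (happ.injOn (Or.inr hc)), happ.surjective (Or.inr hc)⟩

theorem image_add_smul_ball_diff_zero {v : E → E} {K : ℝ≥0} (hv : LipschitzWith K v)
    (hvx : ∀ x, ⟪x, v x⟫ = 0) (hvn : ∀ x, ‖v x‖ = ‖x‖) {t : ℝ} (ht : |t| * K < 1) :
    (fun x ↦ x + t • v x) '' (ball 0 1 \ {0}) = ball 0 √(1 + t ^ 2) \ {0} := by
  have hpos : 0 < √(1 + t ^ 2) := Real.sqrt_pos.2 (by positivity)
  have key : ∀ x, x + t • v x ∈ ball 0 √(1 + t ^ 2) \ {0} ↔ x ∈ ball (0 : E) 1 \ {0} := by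
    intro x
    rw [mem_sdiff, mem_sdiff, mem_ball_zero_iff, mem_ball_zero_iff, mem_singleton_iff,
      mem_singleton_iff, ← norm_eq_zero,
      norm_add_smul_eq_of_inner_eq_zero (hvx x) (hvn x), mul_eq_zero, norm_eq_zero,
      mul_lt_iff_lt_one_right hpos]
    simp [hpos.ne']
  ext y
  constructor
  · rintro ⟨x, hx, rfl⟩
    exact (key x).2 hx
  · intro hy
    obtain ⟨x, rfl⟩ := (hv.bijective_add_smul ht).2 y
    exact ⟨x, (key x).1 hy, rfl⟩

theorem integral_det_id_add_smul_fderiv [MeasurableSpace E] [BorelSpace E] [Nontrivial E]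
    (μ : Measure E) [μ.IsAddHaarMeasure] {v : E → E} {K : ℝ≥0} (hv : LipschitzWith K v)
    (hvd : ∀ x ≠ 0, DifferentiableAt ℝ v x)
    (hvx : ∀ x, ⟪x, v x⟫ = 0) (hvn : ∀ x, ‖v x‖ = ‖x‖) {t : ℝ} (ht : |t| * K < 1) :
    IntegrableOn (fun x ↦ (ContinuousLinearMap.id ℝ E + t • fderiv ℝ v x).det)
      (ball 0 1 \ {0}) μ ∧
    ∫ x in ball 0 1 \ {0}, (ContinuousLinearMap.id ℝ E + t • fderiv ℝ v x).det ∂μ =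
      √(1 + t ^ 2) ^ finrank ℝ E * μ.real (ball 0 1) := by
  have hms : MeasurableSet (ball (0 : E) 1 \ {0}) :=
    measurableSet_ball.diff (measurableSet_singleton 0)
  have hder : ∀ x ∈ ball (0 : E) 1 \ {0}, HasFDerivWithinAt (fun x ↦ x + t • v x)
      (ContinuousLinearMap.id ℝ E + t • fderiv ℝ v x) (ball 0 1 \ {0}) x := fun x hx ↦
    ((hasFDerivAt_id x).add ((hvd x hx.2).hasFDerivAt.const_smul t)).hasFDerivWithinAt
  have hinj : InjOn (fun x ↦ x + t • v x) (ball 0 1 \ {0}) := (hv.bijective_add_smul ht).1.injOn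
  have hdet : ∀ x, 0 < (ContinuousLinearMap.id ℝ E + t • fderiv ℝ v x).det := fun x ↦ by
    refine ContinuousLinearMap.det_id_add_pos ?_
    rw [norm_smul, Real.norm_eq_abs]
    exact (mul_le_mul_of_nonneg_left (norm_fderiv_le_of_lipschitz ℝ hv) (abs_nonneg t)).trans_lt ht
  have hint := integrableOn_image_iff_integrableOn_abs_det_fderiv_smul μ hms hder hinj
    (fun _ ↦ (1 : ℝ))
  have heq := integral_image_eq_integral_abs_det_fderiv_smul μ hms hder hinj (fun _ ↦ (1 : ℝ))
  simp only [abs_of_pos (hdet _), smul_eq_mul, mul_one,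
    image_add_smul_ball_diff_zero hv hvx hvn ht] at hint heq
  refine ⟨hint.1 ?_, ?_⟩
  · refine integrableOn_const ?_
    exact (measure_mono sdiff_subset |>.trans_lt measure_ball_lt_top).ne
  · rw [← heq, setIntegral_const, smul_eq_mul, mul_one, measureReal_def,
      measure_sdiff_null (measure_singleton 0), Measure.addHaar_ball μ 0 (Real.sqrt_nonneg _),
      ENNReal.toReal_mul, ENNReal.toReal_ofReal (by positivity), measureReal_def]

theorem not_lipschitzWith_of_inner_eq_zero_of_norm_eq (hE : Odd (finrank ℝ E)) {v : E → E}
    (hvd : ∀ x ≠ 0, DifferentiableAt ℝ v x)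
    (hvx : ∀ x, ⟪x, v x⟫ = 0) (hvn : ∀ x, ‖v x‖ = ‖x‖) (K : ℝ≥0) : ¬ LipschitzWith K v := by
  intro hv
  borelize E
  have : Nontrivial E := nontrivial_of_finrank_pos (R := ℝ) hE.pos
  let μ : Measure E := Measure.addHaar
  have hμ : 0 < μ.real (ball 0 1) :=
    ENNReal.toReal_pos (measure_ball_pos μ 0 one_pos).ne' measure_ball_lt_top.ne
  obtain ⟨δ, hδ, hδK⟩ : ∃ δ : ℝ, 0 < δ ∧ ∀ t ∈ Ioo 0 δ, |t| * K < 1 := by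
    refine ⟨((K : ℝ) + 1)⁻¹, by positivity, fun t ht ↦ ?_⟩
    have h1 : t * (K + 1) < 1 := by
      rw [← lt_div_iff₀ (by positivity), one_div]
      exact ht.2
    rw [abs_of_pos ht.1]
    nlinarith [ht.1]
  obtain ⟨s, hs, hcard⟩ := (Ioo_infinite hδ).exists_subset_card_eq (finrank ℝ E + 1)
  choose p hpdeg hp using fun x ↦
    (fderiv ℝ v x).exists_polynomial_eval_eq_det_id_add_smul
  have hinterp : ∀ (x : E) (t : ℝ), (ContinuousLinearMap.id ℝ E + t • fderiv ℝ v x).det =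
      ∑ i ∈ s, (ContinuousLinearMap.id ℝ E + i • fderiv ℝ v x).det *
        (Lagrange.basis s id i).eval t := by
    intro x t
    have hlt : (p x).degree < s.card := by
      rw [hcard]
      refine degree_le_natDegree.trans_lt ?_
      exact_mod_cast Nat.lt_succ_of_le (hpdeg x)
    have h1 := Lagrange.eq_interpolate (v := id) (injOn_id _) hlt
    rw [← hp, h1, Lagrange.interpolate_apply, eval_finsetSum]
    simp [hp]
  refine Polynomial.not_forall_eval_eq_sqrt_one_add_sq_pow hE
    (∑ i ∈ s, C (√(1 + i ^ 2) ^ finrank ℝ E) * Lagrange.basis s id i) hδ fun t ht ↦ ?_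
  have h1 := (integral_det_id_add_smul_fderiv μ hv hvd hvx hvn (hδK t ht)).2
  simp only [hinterp _ t] at h1
  rw [integral_finsetSum _ fun i hi ↦ Integrable.mul_const
    (integral_det_id_add_smul_fderiv μ hv hvd hvx hvn (hδK i (hs hi))).1 _] at h1
  simp only [integral_mul_const] at h1
  rw [Finset.sum_congr rfl fun i hi ↦ by
    rw [(integral_det_id_add_smul_fderiv μ hv hvd hvx hvn (hδK i (hs hi))).2]] at h1
  refine mul_right_cancel₀ hμ.ne' (Eq.trans ?_ h1)
  rw [eval_finsetSum, Finset.sum_mul]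
  refine Finset.sum_congr rfl fun i _ ↦ ?_
  rw [eval_mul, eval_C]
  ring

theorem exists_eq_zero_of_contDiff_of_inner_eq_zero (hE : Odd (finrank ℝ E)) {w : E → E}
    (hw : ContDiff ℝ 1 w) (hwx : ∀ x ∈ sphere (0 : E) 1, ⟪x, w x⟫ = 0) :
    ∃ x ∈ sphere (0 : E) 1, w x = 0 := by
  by_contra! hne
  have hdiff : ∀ x ∈ sphere (0 : E) 1, ContDiffAt ℝ 1 (fun x ↦ ‖w x‖⁻¹ • w x) x := fun x hx ↦
    ((hw.contDiffAt.norm ℝ (hne x hx)).inv (norm_ne_zero_iff.2 (hne x hx))).smul hw.contDiffAt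
  have hnorm : ∀ x ∈ sphere (0 : E) 1, ‖‖w x‖⁻¹ • w x‖ = 1 := fun x hx ↦ by
    simp [norm_smul, hne x hx]
  have hloc : LocallyLipschitzOn (sphere (0 : E) 1) fun x ↦ ‖w x‖⁻¹ • w x := by
    intro x hx
    obtain ⟨L, t, ht, hL⟩ := (hdiff x hx).exists_lipschitzOnWith
    exact ⟨L, t, mem_nhdsWithin_of_mem_nhds ht, hL⟩
  obtain ⟨L, hL⟩ := hloc.exists_lipschitzOnWith_of_compact (isCompact_sphere 0 1)
  have hmem : ∀ x : E, x ≠ 0 → ‖x‖⁻¹ • x ∈ sphere (0 : E) 1 := fun x hx ↦ by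
    simp [norm_smul, hx]
  refine not_lipschitzWith_of_inner_eq_zero_of_norm_eq hE ?_ ?_ ?_ _
    (hL.lipschitzWith_norm_smul_comp_normalize fun x hx ↦ (hnorm x hx).le)
  · intro x hx
    have h1 : DifferentiableAt ℝ (fun y : E ↦ ‖y‖) x := differentiableAt_id.norm ℝ hx
    have h2 : DifferentiableAt ℝ (fun y : E ↦ ‖y‖⁻¹ • y) x :=
      (h1.inv (norm_ne_zero_iff.2 hx)).smul differentiableAt_id
    exact h1.smul (DifferentiableAt.comp (f := fun y : E ↦ ‖y‖⁻¹ • y) x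
      ((hdiff _ (hmem x hx)).differentiableAt one_ne_zero) h2)
  · intro x
    rcases eq_or_ne x 0 with rfl | hx
    · simp
    have h1 := hwx _ (hmem x hx)
    rw [real_inner_smul_left, mul_eq_zero, or_iff_right (inv_ne_zero (norm_ne_zero_iff.2 hx))] at h1
    simp only [inner_smul_right, h1, mul_zero]
  · intro x
    rcases eq_or_ne x 0 with rfl | hx
    · simp
    · rw [norm_smul, hnorm _ (hmem x hx), norm_norm, mul_one]

/-- The **hairy ball theorem**, in terms of a vector field `u` that need not be tangent. -/
theorem exists_sub_inner_smul_eq_zero (hE : Odd (finrank ℝ E)) {u : sphere (0 : E) 1 → E}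
    (hu : Continuous u) : ∃ x : sphere (0 : E) 1, u x - ⟪(x : E), u x⟫ • (x : E) = 0 := by
  by_contra! hne
  have : Nontrivial E := nontrivial_of_finrank_pos (R := ℝ) hE.pos
  have hne' : Nonempty (sphere (0 : E) 1) := (NormedSpace.sphere_nonempty.2 zero_le_one).to_subtype
  have hcont : Continuous fun x : sphere (0 : E) 1 ↦ ‖u x - ⟪(x : E), u x⟫ • (x : E)‖ := by
    fun_prop
  obtain ⟨x₀, -, hx₀⟩ := isCompact_univ.exists_isMinOn univ_nonempty hcont.continuousOn
  obtain ⟨U, hU⟩ := ContinuousMap.exists_restrict_eq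
    (isClosed_sphere (x := (0 : E)) (ε := 1)) ⟨u, hu⟩
  obtain ⟨g, hg, hgU⟩ : ∃ g : E → E, ContDiff ℝ 1 g ∧ ∀ x ∈ sphere (0 : E) 1,
      dist (U x) (g x) < ‖u x₀ - ⟪(x₀ : E), u x₀⟫ • (x₀ : E)‖ := by
    have h1 := ContinuousMap.dense_setOfPred_contDiff U
    rw [mem_closure_iff_nhds_basis
      (nhds_basis_uniformity Metric.uniformity_basis_dist.compactConvergenceUniformity)] at h1
    obtain ⟨g, hg, hgU⟩ := h1 (sphere 0 1, ‖u x₀ - ⟪(x₀ : E), u x₀⟫ • (x₀ : E)‖)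
      ⟨isCompact_sphere 0 1, norm_pos_iff.2 (hne x₀)⟩
    refine ⟨g, ContDiff.of_le (mem_ofPred_eq ▸ hg) (by exact_mod_cast le_top), fun x hx ↦ ?_⟩
    have := hgU x hx
    simpa [dist_comm] using this
  obtain ⟨x, hx, hx0⟩ := exists_eq_zero_of_contDiff_of_inner_eq_zero hE
    (w := fun x ↦ g x - ⟪x, g x⟫ • x) (hg.sub ((contDiff_id.inner ℝ hg).smul contDiff_id)) (fun x hx ↦ by
      rw [inner_sub_right, inner_smul_right, real_inner_self_eq_norm_sq,
        mem_sphere_zero_iff_norm.1 hx]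
      ring)
  have hUx : U x = u ⟨x, hx⟩ := congrArg (fun f ↦ f ⟨x, hx⟩) hU
  have h1 := (norm_sub_inner_smul_le (mem_sphere_zero_iff_norm.1 hx) (U x - g x)).trans_lt
    ((dist_eq_norm (U x) (g x)).symm.trans_lt (hgU x hx))
  have h2 : U x - g x - ⟪x, U x - g x⟫ • x = U x - ⟪x, U x⟫ • x - (g x - ⟪x, g x⟫ • x) := by
    rw [inner_sub_right, sub_smul]
    abel
  rw [h2, hx0, sub_zero, hUx] at h1
  exact (hx₀ (mem_univ ⟨x, hx⟩)).not_gt h1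

end

/-- The underlying space of a continuous oriented Kakeya line configuration in `ℝ^{2n+1}` is all
of `ℝ^{2n+1}`. -/
theorem oriented_underlying_space_eq_univ (n : ℕ) (hn : 1 ≤ n)
    (σ : Metric.sphere (0 : EuclideanSpace ℝ (Fin (2 * n + 1))) 1 →
      EuclideanSpace ℝ (Fin (2 * n + 1)))
    (hσ : Continuous σ) :
    (⋃ x : Metric.sphere (0 : EuclideanSpace ℝ (Fin (2 * n + 1))) 1,
        {y : EuclideanSpace ℝ (Fin (2 * n + 1)) |
          ∃ t : ℝ, y = σ x + t • (x : EuclideanSpace ℝ (Fin (2 * n + 1)))}) = Set.univ := by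
  refine Set.eq_univ_of_forall fun p ↦ ?_
  obtain ⟨x, hx⟩ := exists_sub_inner_smul_eq_zero (u := fun x ↦ p - σ x)
    (by rw [finrank_euclideanSpace_fin]; exact odd_two_mul_add_one n) (by fun_prop)
  exact Set.mem_iUnion.2 ⟨x, _, eq_add_of_sub_eq' (sub_eq_zero.1 hx)⟩
end

section
/- Let n ≥ 1 and let C > 0. Then there exists a continuous oriented Kakeya line configuration σ : S^{2n-1} → ℝ^{2n} whose underlying space ⋃_{x ∈ S^{2n-1}} (σ(x) + ℝx) is disjoint from the open ball of radius C about the origin; in particular the underlying space is not all of ℝ^{2n}. -/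
/-- `ℝ^{2n}` carries a continuous norm-preserving map sending every vector to an orthogonal one,
namely multiplication by `i` on `ℂⁿ`. -/
theorem exists_continuous_norm_eq_inner_eq_zero (n : ℕ) :
    ∃ J : EuclideanSpace ℝ (Fin (2 * n)) → EuclideanSpace ℝ (Fin (2 * n)),
      Continuous J ∧ (∀ x, ‖J x‖ = ‖x‖) ∧ ∀ x, inner ℝ (J x) x = 0 := by
  have hrank : Module.finrank ℝ (EuclideanSpace ℂ (Fin n)) = 2 * n := by
    rw [finrank_real_of_complex, finrank_euclideanSpace_fin]
  let e : EuclideanSpace ℂ (Fin n) ≃ₗᵢ[ℝ] EuclideanSpace ℝ (Fin (2 * n)) :=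
    ((stdOrthonormalBasis ℝ (EuclideanSpace ℂ (Fin n))).reindex (finCongr hrank)).repr
  refine ⟨fun x => e (Complex.I • e.symm x), ?_, fun x => ?_, fun x => ?_⟩
  · exact e.continuous.comp (e.symm.continuous.const_smul Complex.I)
  · simp [norm_smul]
  · have h : inner ℝ (e (Complex.I • e.symm x)) (e (e.symm x)) = 0 := by
      rw [e.inner_map_map, PiLp.inner_apply]
      refine Finset.sum_eq_zero fun i _ => ?_
      simp [Complex.inner, mul_comm]
    rwa [e.apply_symm_apply] at h

/-- Translating `v` along an orthogonal direction does not decrease its norm. -/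
theorem norm_le_norm_add_smul_of_inner_eq_zero {E : Type*} [NormedAddCommGroup E]
    [InnerProductSpace ℝ E] {v x : E} (h : inner ℝ v x = 0) (t : ℝ) : ‖v‖ ≤ ‖v + t • x‖ := by
  have key := norm_add_sq_eq_norm_sq_add_norm_sq_of_inner_eq_zero v (t • x)
    (by rw [inner_smul_right, h, mul_zero])
  nlinarith [norm_nonneg v, norm_nonneg (v + t • x), mul_self_nonneg ‖t • x‖]


/-- In even dimensions `ℝ^{2n}` there are continuous oriented Kakeya line configurations whose
underlying space avoids the open ball of radius `C` about the origin; in particular the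
underlying space is not all of `ℝ^{2n}`. -/
theorem exists_oriented_configuration_avoiding_ball (n : ℕ) (hn : 1 ≤ n) (C : ℝ) (hC : 0 < C) :
    ∃ σ : Metric.sphere (0 : EuclideanSpace ℝ (Fin (2 * n))) 1 →
        EuclideanSpace ℝ (Fin (2 * n)),
      Continuous σ ∧
      (⋃ x : Metric.sphere (0 : EuclideanSpace ℝ (Fin (2 * n))) 1,
          {y : EuclideanSpace ℝ (Fin (2 * n)) |
            ∃ t : ℝ, y = σ x + t • (x : EuclideanSpace ℝ (Fin (2 * n)))}) ∩
        Metric.ball (0 : EuclideanSpace ℝ (Fin (2 * n))) C = ∅ ∧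
      (⋃ x : Metric.sphere (0 : EuclideanSpace ℝ (Fin (2 * n))) 1,
          {y : EuclideanSpace ℝ (Fin (2 * n)) |
            ∃ t : ℝ, y = σ x + t • (x : EuclideanSpace ℝ (Fin (2 * n)))}) ≠ Set.univ := by
  obtain ⟨J, hJc, hJn, hJx⟩ := exists_continuous_norm_eq_inner_eq_zero n
  have hline (x : Metric.sphere (0 : EuclideanSpace ℝ (Fin (2 * n))) 1) (t : ℝ) :
      C ≤ ‖C • J x + t • (x : EuclideanSpace ℝ (Fin (2 * n)))‖ := by
    have h := norm_le_norm_add_smul_of_inner_eq_zero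
      (v := C • J x) (x := x) (by rw [real_inner_smul_left, hJx, mul_zero]) t
    rwa [norm_smul, hJn, norm_eq_of_mem_sphere, mul_one, Real.norm_of_nonneg hC.le] at h
  refine ⟨fun x => C • J x, (hJc.comp continuous_subtype_val).const_smul C, ?_, fun huniv => ?_⟩
  · refine Set.eq_empty_of_forall_notMem ?_
    rintro y ⟨hy, hball⟩
    obtain ⟨x, t, rfl⟩ := Set.mem_iUnion.mp hy
    exact (hline x t).not_gt (mem_ball_zero_iff.mp hball)
  · obtain ⟨x, t, h⟩ := Set.mem_iUnion.mp (huniv.ge (Set.mem_univ 0))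
    have hle := hline x t
    rw [← h, norm_zero] at hle
    exact hle.not_gt hC
end
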